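/- (Lebedev expansion theorem.) Let f be measurable on (0,∞) with ∫_0^1 |f(y)|·y^{−1/2} dy < ∞ and ∫_1^∞ |f(y)|·y^{1/2} dy < ∞. Then for all x > 0, ∫_x^∞ f(y) dy = (4/π²)·∫_0^∞ τ·sinh(πτ)·K_{iτ}(x)²·( ∫_0^∞ f(y)·[I_{iτ}(y) + I_{−iτ}(y)]·K_{iτ}(y) dy ) dτ, where the inner integral converges absolutely and the outer integral is an improper Riemann integral (limit of ∫_0^N as N → ∞). -/

import Mathlib

open MeasureTheory Set Filter Asymptotics

/-- Modified Bessel function of the second kind (integral representation, for Re z > 0). -/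
noncomputable def besselK (nu z : ℂ) : ℂ :=
  ∫ t in Set.Ioi (0:ℝ), Complex.exp (-z * (Real.cosh t : ℂ)) * Complex.cosh (nu * (t : ℂ))

/-- The kernel 𝒦(x,τ) = ker²_{2iτ}(2(4x)^{1/4}) + kei²_{2iτ}(2(4x)^{1/4})
    = K_{2iτ}(2(4x)^{1/4}e^{iπ/4}) · K_{2iτ}(2(4x)^{1/4}e^{-iπ/4}), which is real. -/
noncomputable def kernelK (x τ : ℝ) : ℝ :=
  (besselK (2 * Complex.I * (τ:ℂ))
      (((2 * (4*x) ^ ((1:ℝ)/4) : ℝ) : ℂ) * Complex.exp (Complex.I * (Real.pi:ℂ) / 4)) *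
   besselK (2 * Complex.I * (τ:ℂ))
      (((2 * (4*x) ^ ((1:ℝ)/4) : ℝ) : ℂ) * Complex.exp (-(Complex.I * (Real.pi:ℂ)) / 4))).re

/-- K₀(y) = ∫₀^∞ exp(−y·cosh t) dt. -/
noncomputable def besselK0 (y : ℝ) : ℝ := ∫ t in Set.Ioi (0:ℝ), Real.exp (-y * Real.cosh t)

/-- K_{iτ}(x) = ∫₀^∞ exp(−x·cosh t)·cos(τt) dt (real-valued, purely imaginary order). -/
noncomputable def besselKi (τ x : ℝ) : ℝ :=
  ∫ t in Set.Ioi (0:ℝ), Real.exp (-x * Real.cosh t) * Real.cos (τ * t)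

/-- Modified Bessel function of the first kind I_ν(z) (power series). -/
noncomputable def besselI (nu z : ℂ) : ℂ :=
  ∑' n : ℕ, (z/2) ^ (nu + 2*(n:ℂ)) / ((n.factorial : ℂ) * Complex.Gamma (nu + (n:ℂ) + 1))

/-- B_ν(w) = ber²_ν(w) + bei²_ν(w) = I_ν(w·e^{iπ/4})·I_ν(w·e^{−iπ/4}). -/
noncomputable def kelvinB (nu w : ℂ) : ℂ :=
  besselI nu (w * Complex.exp (Complex.I * (Real.pi:ℂ) / 4)) *
  besselI nu (w * Complex.exp (-(Complex.I * (Real.pi:ℂ)) / 4))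

/-- Index transform (1.1): (F f)(τ) = ∫₀^∞ 𝒦(x,τ) f(x) dx. -/
noncomputable def indexF (f : ℝ → ℝ) (τ : ℝ) : ℝ := ∫ x in Set.Ioi (0:ℝ), kernelK x τ * f x

/-- Index transform (1.2): (G g)(x) = ∫₀^∞ 𝒦(x,τ) g(τ) dτ. -/
noncomputable def indexG (g : ℝ → ℝ) (x : ℝ) : ℝ := ∫ τ in Set.Ioi (0:ℝ), kernelK x τ * g τ

/-- Index transform (1.2) for complex-valued densities. -/
noncomputable def indexGC (g : ℝ → ℂ) (x : ℝ) : ℂ :=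
  ∫ τ in Set.Ioi (0:ℝ), (kernelK x τ : ℂ) * g τ

/-- Mellin transform of a real function. -/
noncomputable def mellinT (f : ℝ → ℝ) (s : ℂ) : ℂ :=
  ∫ x in Set.Ioi (0:ℝ), (f x : ℂ) * (x:ℂ) ^ (s - 1)

/-- Mellin transform of a complex function. -/
noncomputable def mellinC (F : ℝ → ℂ) (s : ℂ) : ℂ :=
  ∫ x in Set.Ioi (0:ℝ), F x * (x:ℂ) ^ (s - 1)

/-- The L_{ν,p}(ℝ₊) norm. -/
noncomputable def Lnorm (ν p : ℝ) (f : ℝ → ℝ) : ℝ :=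
  (∫ x in Set.Ioi (0:ℝ), |f x| ^ p * x ^ (ν*p - 1)) ^ (1/p)

/-- Euler beta function B(a,b) = Γ(a)Γ(b)/Γ(a+b). -/
noncomputable def betaFn (a b : ℝ) : ℝ := Real.Gamma a * Real.Gamma b / Real.Gamma (a+b)

/-- The entire function `∑ zⁿ / (n! Γ(ν + n + 1))`, for which `I_ν(y) = (y/2)^ν reducedI ν (y²/4)`. -/
noncomputable def reducedI (ν z : ℂ) : ℂ :=
  ∑' n : ℕ, ((n.factorial : ℂ)⁻¹ * (Complex.Gamma (ν + n + 1))⁻¹) * z ^ n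

lemma norm_le_norm_add_natCast {ν : ℂ} (hν : 0 ≤ ν.re) (n : ℕ) : ((n : ℝ) + 1) ≤ ‖ν + n + 1‖ := by
  have h := Complex.abs_re_le_norm (ν + n + 1)
  have h2 : (ν + n + 1).re = ν.re + n + 1 := by simp
  rw [h2] at h
  exact le_trans (by linarith [le_abs_self (ν.re + n + 1)]) h

lemma norm_inv_Gamma_add_natCast_le {ν : ℂ} (hν : 0 ≤ ν.re) (n : ℕ) :
    ‖(Complex.Gamma (ν + n + 1))⁻¹‖ ≤ ‖(Complex.Gamma (ν + 1))⁻¹‖ / n.factorial := by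
  induction n with
  | zero => simp
  | succ n ih =>
    have h := Complex.one_div_Gamma_eq_self_mul_one_div_Gamma_add_one (ν + n + 1)
    have h1 := norm_le_norm_add_natCast hν n
    have h3 : ν + ((n + 1 : ℕ) : ℂ) + 1 = ν + n + 1 + 1 := by push_cast; ring
    rw [h3]
    rw [h, norm_mul] at ih
    rw [Nat.factorial_succ, Nat.cast_mul, mul_comm ((n + 1 : ℕ) : ℝ), ← div_div, le_div_iff₀ (by positivity)]
    refine le_trans ?_ ih
    rw [mul_comm]
    push_cast
    gcongr

lemma norm_reducedI_term_le {ν : ℂ} (hν : 0 ≤ ν.re) (z : ℂ) (n : ℕ) :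
    ‖((n.factorial : ℂ)⁻¹ * (Complex.Gamma (ν + n + 1))⁻¹) * z ^ n‖ ≤
      ‖(Complex.Gamma (ν + 1))⁻¹‖ * (‖z‖ ^ n / (n.factorial : ℝ) ^ 2) := by
  have h := norm_inv_Gamma_add_natCast_le hν n
  rw [norm_mul, norm_mul, norm_inv, norm_pow, Complex.norm_natCast]
  calc _ ≤ (n.factorial : ℝ)⁻¹ * (‖(Complex.Gamma (ν + 1))⁻¹‖ / n.factorial) * ‖z‖ ^ n := by gcongr
    _ = _ := by field_simp

lemma summable_pow_div_factorial_sq (x : ℝ) (hx : 0 ≤ x) :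
    Summable fun n : ℕ => x ^ n / (n.factorial : ℝ) ^ 2 := by
  refine Summable.of_nonneg_of_le (fun n => by positivity) (fun n => ?_)
    (Real.summable_pow_div_factorial x)
  have : (1 : ℝ) ≤ n.factorial := by exact_mod_cast n.factorial_pos
  gcongr
  nlinarith

lemma tsum_pow_div_factorial_sq_le (x : ℝ) (hx : 0 ≤ x) :
    ∑' n : ℕ, x ^ n / (n.factorial : ℝ) ^ 2 ≤ Real.exp (2 * √x) := by
  have hs : Summable fun n : ℕ => (√x) ^ n / (n.factorial : ℝ) := Real.summable_pow_div_factorial _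
  have he : Real.exp (√x) = ∑' n : ℕ, (√x) ^ n / (n.factorial : ℝ) := by
    rw [Real.exp_eq_exp_ℝ, NormedSpace.exp_eq_tsum_div]
  rw [two_mul, Real.exp_add]
  have hb : ∀ n : ℕ, (√x) ^ n / (n.factorial : ℝ) ≤ Real.exp (√x) := by
    intro n
    rw [he]
    exact hs.le_tsum n (fun m _ => by positivity)
  have h2 : ∀ n : ℕ, x ^ n / (n.factorial : ℝ) ^ 2 ≤ Real.exp (√x) * ((√x) ^ n / (n.factorial : ℝ)) := by
    intro n
    have : x ^ n / (n.factorial : ℝ) ^ 2 = ((√x) ^ n / (n.factorial : ℝ)) *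
        ((√x) ^ n / (n.factorial : ℝ)) := by
      rw [div_mul_div_comm, ← mul_pow, Real.mul_self_sqrt hx, sq]
    rw [this]
    gcongr
    exact hb n
  calc _ ≤ ∑' n : ℕ, Real.exp (√x) * ((√x) ^ n / (n.factorial : ℝ)) :=
        (summable_pow_div_factorial_sq x hx).tsum_le_tsum h2 (hs.mul_left _)
    _ = _ := by rw [tsum_mul_left, ← he]

lemma summable_reducedI {ν : ℂ} (hν : 0 ≤ ν.re) (z : ℂ) :
    Summable fun n : ℕ => ((n.factorial : ℂ)⁻¹ * (Complex.Gamma (ν + n + 1))⁻¹) * z ^ n :=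
  Summable.of_norm_bounded ((summable_pow_div_factorial_sq ‖z‖ (norm_nonneg _)).mul_left _)
    (norm_reducedI_term_le hν z)

lemma norm_reducedI_le {ν : ℂ} (hν : 0 ≤ ν.re) (z : ℂ) :
    ‖reducedI ν z‖ ≤ ‖(Complex.Gamma (ν + 1))⁻¹‖ * Real.exp (2 * √‖z‖) := by
  have h := (summable_pow_div_factorial_sq ‖z‖ (norm_nonneg _)).mul_left
    ‖(Complex.Gamma (ν + 1))⁻¹‖
  refine (tsum_of_norm_bounded h.hasSum (norm_reducedI_term_le hν z)).trans ?_
  rw [tsum_mul_left]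
  gcongr
  exact tsum_pow_div_factorial_sq_le _ (norm_nonneg _)

lemma reducedI_zero (ν : ℂ) : reducedI ν 0 = (Complex.Gamma (ν + 1))⁻¹ := by
  unfold reducedI
  rw [tsum_eq_single 0]
  · simp
  · intro n hn
    simp [hn]

lemma hasDerivAt_reducedI {ν : ℂ} (hν : 0 ≤ ν.re) (z : ℂ) :
    HasDerivAt (reducedI ν) (reducedI (ν + 1) z) z := by
  set c : ℕ → ℂ := fun n => (n.factorial : ℂ)⁻¹ * (Complex.Gamma (ν + n + 1))⁻¹ with hc
  set R : ℝ := ‖z‖ + 1 with hR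
  have hR0 : 0 < R := by positivity
  have hν1 : 0 ≤ (ν + 1).re := by simp; linarith
  have hterm : ∀ (n : ℕ) (w : ℂ), c (n + 1) * ((n + 1 : ℕ) * w ^ n) =
      ((n.factorial : ℂ)⁻¹ * (Complex.Gamma (ν + 1 + n + 1))⁻¹) * w ^ n := by
    intro n w
    have h2 : ν + ((n + 1 : ℕ) : ℂ) + 1 = ν + 1 + n + 1 := by push_cast; ring
    simp only [hc, h2]
    rw [Nat.factorial_succ]
    push_cast
    have : ((n : ℂ) + 1) ≠ 0 := by exact_mod_cast Nat.succ_ne_zero n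
    have h3 : ((n.factorial : ℂ)) ≠ 0 := by exact_mod_cast n.factorial_ne_zero
    field_simp
  have hu : Summable fun n : ℕ => ‖c n * (n * (R : ℂ) ^ (n - 1))‖ := by
    rw [← summable_nat_add_iff 1]
    have := (summable_reducedI hν1 (R : ℂ)).norm
    refine this.congr (fun n => ?_)
    rw [← hterm]; simp
  have := hasDerivAt_tsum_of_isPreconnected (g := fun n w => c n * w ^ n)
    (g' := fun n w => c n * (n * w ^ (n - 1))) (t := Metric.ball 0 R) (y₀ := z) (y := z) hu
    Metric.isOpen_ball (convex_ball _ _).isPreconnected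
    (fun n y _ => (hasDerivAt_pow n y).const_mul _)
    (fun n y hy => by
      rw [norm_mul (c n), norm_mul (c n), norm_mul (n : ℂ), norm_mul (n : ℂ), norm_pow, norm_pow]
      rw [mem_ball_zero_iff] at hy
      have : ‖(R : ℂ)‖ = R := by simp [abs_of_pos hR0]
      rw [this]
      gcongr) (by simp [hR]) (summable_reducedI hν z) (by simp [hR])
  refine (show HasDerivAt (reducedI ν) _ z from this).congr_deriv ?_
  unfold reducedI
  rw [Summable.tsum_eq_zero_add]
  · simp only [Nat.cast_zero, zero_mul, mul_zero, zero_add, Nat.add_sub_cancel]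
    exact tsum_congr (fun n => hterm n z)
  · rw [← summable_nat_add_iff 1]
    refine (summable_reducedI hν1 z).congr (fun n => ?_)
    rw [← hterm]; simp

lemma reducedI_recurrence {ν : ℂ} (hν : 0 ≤ ν.re) (z : ℂ) :
    z * reducedI (ν + 2) z + (ν + 1) * reducedI (ν + 1) z = reducedI ν z := by
  have hν1 : 0 ≤ (ν + 1).re := by simp; linarith
  have hν2 : 0 ≤ (ν + 2).re := by simp; linarith
  unfold reducedI
  rw [(summable_reducedI hν1 z).tsum_eq_zero_add, (summable_reducedI hν z).tsum_eq_zero_add, mul_add,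
    ← tsum_mul_left, ← tsum_mul_left]
  have h0 := Complex.one_div_Gamma_eq_self_mul_one_div_Gamma_add_one (ν + 1)
  have hs1 := (summable_nat_add_iff 1).2 (summable_reducedI hν1 z)
  have key : ∀ n : ℕ, z * (((n.factorial : ℂ)⁻¹ * (Complex.Gamma (ν + 2 + n + 1))⁻¹) * z ^ n) +
      (ν + 1) * ((((n + 1).factorial : ℂ)⁻¹ * (Complex.Gamma (ν + 1 + (n + 1 : ℕ) + 1))⁻¹) * z ^ (n + 1)) =
      (((n + 1).factorial : ℂ)⁻¹ * (Complex.Gamma (ν + (n + 1 : ℕ) + 1))⁻¹) * z ^ (n + 1) := by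
    intro n
    have h := Complex.one_div_Gamma_eq_self_mul_one_div_Gamma_add_one (ν + (n + 1 : ℕ) + 1)
    have e1 : ν + 2 + n + 1 = ν + (n + 1 : ℕ) + 1 + 1 := by push_cast; ring
    have e2 : ν + 1 + (n + 1 : ℕ) + 1 = ν + (n + 1 : ℕ) + 1 + 1 := by push_cast; ring
    rw [h, e1, e2, Nat.factorial_succ]
    push_cast
    have : ((n : ℂ) + 1) ≠ 0 := by exact_mod_cast Nat.succ_ne_zero n
    have h3 : ((n.factorial : ℂ)) ≠ 0 := by exact_mod_cast n.factorial_ne_zero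
    field_simp
    ring
  rw [← tsum_congr key, Summable.tsum_add ((summable_reducedI hν2 z).mul_left _) (hs1.mul_left _)]
  simp only [Nat.factorial_zero, Nat.cast_one, inv_one, Nat.cast_zero, add_zero, pow_zero, mul_one, one_mul]
  rw [h0]
  ring

lemma continuous_reducedI {ν : ℂ} (hν : 0 ≤ ν.re) : Continuous (reducedI ν) :=
  continuous_iff_continuousAt.2 fun z => (hasDerivAt_reducedI hν z).continuousAt

lemma continuousWithinAt_reducedI_order {ν : ℂ} (z : ℂ) :
    ContinuousWithinAt (fun μ => reducedI μ z) {μ | 0 ≤ μ.re} ν := by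
  have hG : Continuous fun μ : ℂ => (Complex.Gamma μ)⁻¹ :=
    Complex.differentiable_one_div_Gamma.continuous
  have hG1 : Continuous fun μ : ℂ => ‖(Complex.Gamma (μ + 1))⁻¹‖ := by
    exact (hG.comp (continuous_id.add continuous_const)).norm
  have hev : ∀ᶠ μ in nhdsWithin ν {μ : ℂ | 0 ≤ μ.re},
      ‖(Complex.Gamma (μ + 1))⁻¹‖ ≤ ‖(Complex.Gamma (ν + 1))⁻¹‖ + 1 :=
    ((hG1.tendsto ν).eventually_le_const (by linarith)).filter_mono nhdsWithin_le_nhds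
  refine tendsto_tsum_of_dominated_convergence
    (bound := fun n => (‖(Complex.Gamma (ν + 1))⁻¹‖ + 1) * (‖z‖ ^ n / (n.factorial : ℝ) ^ 2))
    ((summable_pow_div_factorial_sq ‖z‖ (norm_nonneg _)).mul_left _) ?_ ?_
  · intro n
    refine Tendsto.mono_left ?_ nhdsWithin_le_nhds
    have : Continuous fun μ : ℂ => ((n.factorial : ℂ)⁻¹ * (Complex.Gamma (μ + n + 1))⁻¹) * z ^ n :=
      (continuous_const.mul (hG.comp ((continuous_id.add continuous_const).add continuous_const))).mul
        continuous_const
    exact this.tendsto ν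
  · filter_upwards [hev, self_mem_nhdsWithin] with μ hμ hμ0 n
    refine (norm_reducedI_term_le hμ0 z n).trans ?_
    gcongr

lemma besselI_eq_reducedI (ν : ℂ) {y : ℝ} (hy : 0 < y) :
    besselI ν y = ((y / 2 : ℝ) : ℂ) ^ ν * reducedI ν ((y ^ 2 / 4 : ℝ) : ℂ) := by
  unfold besselI reducedI
  rw [← tsum_mul_left]
  refine tsum_congr (fun n => ?_)
  have h0 : ((y / 2 : ℝ) : ℂ) ≠ 0 := by
    exact_mod_cast (by positivity : (y / 2) ≠ 0)
  have h1 : (y : ℂ) / 2 = ((y / 2 : ℝ) : ℂ) := by push_cast; rfl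
  have h2 : ((y / 2 : ℝ) : ℂ) ^ (2 * (n : ℂ)) = ((y ^ 2 / 4 : ℝ) : ℂ) ^ n := by
    have : (2 * (n : ℂ)) = ((2 * n : ℕ) : ℂ) := by push_cast; rfl
    rw [this, Complex.cpow_natCast, pow_mul, ← Complex.ofReal_pow]
    congr 2
    ring
  rw [h1, Complex.cpow_add _ _ h0, h2, div_eq_mul_inv, mul_inv]
  ring

/-- For purely imaginary order `iτ`, `reducedI` is close to `1 / Γ(1 + iτ)` for large `τ`. -/
lemma norm_Gamma_mul_reducedI_sub_one_le {τ : ℝ} (hτ : 0 < τ) (z : ℂ) :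
    ‖Complex.Gamma (Complex.I * τ + 1) * reducedI (Complex.I * τ) z - 1‖ ≤
      Real.exp (‖z‖ / τ) - 1 := by
  set ν : ℂ := Complex.I * τ with hν
  have hre : 0 ≤ ν.re := by simp [hν]
  have hGne : Complex.Gamma (ν + 1) ≠ 0 := Complex.Gamma_ne_zero_of_re_pos (by simp [hν])
  have hb : ∀ n : ℕ, ‖Complex.Gamma (ν + 1) * (Complex.Gamma (ν + n + 1))⁻¹‖ ≤ (1 / τ) ^ n := by
    intro n
    induction n with
    | zero => simp [hGne]
    | succ n ih =>
      have h := Complex.one_div_Gamma_eq_self_mul_one_div_Gamma_add_one (ν + n + 1)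
      have h3 : ν + ((n + 1 : ℕ) : ℂ) + 1 = ν + n + 1 + 1 := by push_cast; ring
      have h4 : τ ≤ ‖ν + n + 1‖ := by
        have h := Complex.abs_im_le_norm (ν + n + 1)
        have h2 : (ν + n + 1).im = τ := by simp [hν]
        rw [h2] at h
        exact (le_abs_self _).trans h
      rw [h3, pow_succ, mul_one_div, le_div_iff₀ hτ]
      refine le_trans ?_ ih
      rw [h, norm_mul, norm_mul, norm_mul, mul_assoc, mul_comm (‖(Complex.Gamma (ν + n + 1 + 1))⁻¹‖)]
      gcongr
  have hexp : Real.exp (‖z‖ / τ) = ∑' n : ℕ, (‖z‖ / τ) ^ n / (n.factorial : ℝ) := by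
    rw [Real.exp_eq_exp_ℝ, NormedSpace.exp_eq_tsum_div]
  have hsum : Summable fun n : ℕ => (‖z‖ / τ) ^ n / (n.factorial : ℝ) := Real.summable_pow_div_factorial _
  have h1 : Real.exp (‖z‖ / τ) - 1 = ∑' n : ℕ, (‖z‖ / τ) ^ (n + 1) / ((n + 1).factorial : ℝ) := by
    rw [hexp, hsum.tsum_eq_zero_add]; simp
  have h2 : Complex.Gamma (ν + 1) * reducedI ν z - 1 = ∑' n : ℕ, Complex.Gamma (ν + 1) *
      ((((n + 1).factorial : ℂ)⁻¹ * (Complex.Gamma (ν + (n + 1 : ℕ) + 1))⁻¹) * z ^ (n + 1)) := by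
    unfold reducedI
    rw [(summable_reducedI hre z).tsum_eq_zero_add, tsum_mul_left]
    simp [mul_add, hGne]
  rw [h1, h2]
  refine tsum_of_norm_bounded ((summable_nat_add_iff 1).2 hsum).hasSum (fun n => ?_)
  have := hb (n + 1)
  calc _ = ((n + 1).factorial : ℝ)⁻¹ * ‖Complex.Gamma (ν + 1) *
      (Complex.Gamma (ν + (n + 1 : ℕ) + 1))⁻¹‖ * ‖z‖ ^ (n + 1) := by
        simp only [norm_mul, norm_inv, norm_pow, Complex.norm_natCast]; ring
    _ ≤ ((n + 1).factorial : ℝ)⁻¹ * (1 / τ) ^ (n + 1) * ‖z‖ ^ (n + 1) := by gcongr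
    _ = _ := by rw [div_pow, div_pow, one_pow]; ring

/-- The weight `t^(ν-1) exp(-t - w/t)` defining `reducedK`. -/
noncomputable def reducedKWeight (ν : ℂ) (w t : ℝ) : ℂ :=
  (t : ℂ) ^ (ν - 1) * (Real.exp (-t - w / t) : ℂ)

/-- The function `∫ t^(ν-1) exp(-t - w/t) dt`, for which
`K_ν(y) = (y/2)^(-ν) reducedK ν (y²/4) / 2`. -/
noncomputable def reducedK (ν : ℂ) (w : ℝ) : ℂ := ∫ t in Ioi (0 : ℝ), reducedKWeight ν w t

lemma integral_Ioi_deriv_eq_zero {F F' : ℝ → ℂ} (hd : ∀ t ∈ Ioi (0 : ℝ), HasDerivAt F (F' t) t)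
    (hi : IntegrableOn F' (Ioi 0)) (h0 : Tendsto F (nhdsWithin 0 (Ioi 0)) (nhds 0))
    (h1 : Tendsto F atTop (nhds 0)) : ∫ t in Ioi (0 : ℝ), F' t = 0 := by
  have := integral_Ioi_deriv_mul_eq_sub (u := F) (v := fun _ => (1 : ℂ)) (u' := F')
    (v' := fun _ => (0 : ℂ)) (a := 0) (a' := 0) (b' := 0) hd (fun x _ => hasDerivAt_const x 1)
    (by convert hi using 1; ext t; simp) (by convert h0 using 1; ext t; simp)
    (by convert h1 using 1; ext t; simp)
  simpa using this

lemma norm_reducedKWeight (ν : ℂ) (w : ℝ) {t : ℝ} (ht : 0 < t) :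
    ‖reducedKWeight ν w t‖ = t ^ (ν.re - 1) * Real.exp (-t - w / t) := by
  rw [reducedKWeight, norm_mul, Complex.norm_cpow_eq_rpow_re_of_pos ht, Complex.norm_real,
    Real.norm_of_nonneg (Real.exp_pos _).le]
  simp

lemma continuousOn_reducedKWeight (ν : ℂ) (w : ℝ) : ContinuousOn (reducedKWeight ν w) (Ioi 0) := by
  unfold reducedKWeight
  refine ContinuousOn.mul ?_ ?_
  · exact ContinuousOn.cpow_const Complex.continuous_ofReal.continuousOn
      (fun t (ht : 0 < t) => Complex.ofReal_mem_slitPlane.2 ht)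
  · refine Complex.continuous_ofReal.comp_continuousOn (Real.continuous_exp.comp_continuousOn ?_)
    refine continuousOn_id.neg.sub (continuousOn_const.div continuousOn_id ?_)
    exact fun t (ht : 0 < t) => ht.ne'

lemma aestronglyMeasurable_reducedKWeight (ν : ℂ) (w : ℝ) :
    AEStronglyMeasurable (reducedKWeight ν w) (volume.restrict (Ioi 0)) :=
  (continuousOn_reducedKWeight ν w).aestronglyMeasurable measurableSet_Ioi

lemma exp_neg_div_le {w t : ℝ} (hw : 0 < w) (ht : 0 < t) (n : ℕ) :
    Real.exp (-(w / t)) ≤ n.factorial * (t / w) ^ n := by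
  have h := Real.pow_div_factorial_le_exp (w / t) (by positivity) n
  rw [Real.exp_neg]
  have h2 : 0 < (w / t) ^ n / (n.factorial : ℝ) := by positivity
  calc _ ≤ ((w / t) ^ n / (n.factorial : ℝ))⁻¹ := by gcongr
    _ = _ := by rw [inv_div, ← inv_div w t, inv_pow]; rfl

lemma rpow_mul_exp_le {a w t : ℝ} (hw : 0 < w) (ht : 0 < t) (n : ℕ) :
    t ^ a * Real.exp (-t - w / t) ≤ n.factorial / w ^ n * (Real.exp (-t) * t ^ (a + n)) := by
  have h := exp_neg_div_le hw ht n
  rw [sub_eq_add_neg, Real.exp_add, Real.rpow_add ht, Real.rpow_natCast]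
  calc _ ≤ t ^ a * (Real.exp (-t) * (n.factorial * (t / w) ^ n)) := by gcongr
    _ = _ := by rw [div_pow]; ring

lemma integrableOn_rpow_mul_exp_of_pos (a : ℝ) {w : ℝ} (hw : 0 < w) :
    IntegrableOn (fun t => t ^ a * Real.exp (-t - w / t)) (Ioi 0) := by
  obtain ⟨n, hn⟩ := exists_nat_gt (-a - 1 : ℝ)
  have h := (Real.GammaIntegral_convergent (s := a + n + 1) (by linarith)).const_mul
    ((n.factorial : ℝ) / w ^ n)
  refine Integrable.mono' h ?_ ?_
  · refine ContinuousOn.aestronglyMeasurable ?_ measurableSet_Ioi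
    refine ContinuousOn.mul (continuousOn_id.rpow_const fun t (ht : 0 < t) => Or.inl ht.ne') ?_
    refine Real.continuous_exp.comp_continuousOn ?_
    exact continuousOn_id.neg.sub (continuousOn_const.div continuousOn_id
      fun t (ht : 0 < t) => ht.ne')
  · refine (ae_restrict_iff' measurableSet_Ioi).2 (ae_of_all _ fun t (ht : 0 < t) => ?_)
    rw [Real.norm_of_nonneg (by positivity)]
    have := rpow_mul_exp_le (a := a) hw ht n
    rwa [show a + n = a + n + 1 - 1 by ring] at this

lemma integrableOn_reducedKWeight_of_pos (ν : ℂ) {w : ℝ} (hw : 0 < w) :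
    IntegrableOn (reducedKWeight ν w) (Ioi 0) := by
  refine Integrable.mono' (integrableOn_rpow_mul_exp_of_pos (ν.re - 1) hw)
    (aestronglyMeasurable_reducedKWeight ν w) ?_
  refine (ae_restrict_iff' measurableSet_Ioi).2 (ae_of_all _ fun t (ht : 0 < t) => ?_)
  rw [norm_reducedKWeight _ _ ht]

lemma reducedK_zero {ν : ℂ} (hν : 0 < ν.re) : reducedK ν 0 = Complex.Gamma ν := by
  rw [Complex.Gamma_eq_integral hν, reducedK, Complex.GammaIntegral]
  refine setIntegral_congr_fun measurableSet_Ioi fun t ht => ?_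
  simp [reducedKWeight, mul_comm]

lemma hasDerivAt_reducedK (ν : ℂ) {w : ℝ} (hw : 0 < w) :
    HasDerivAt (reducedK ν) (-reducedK (ν - 1) w) w := by
  have key := hasDerivAt_integral_of_dominated_loc_of_deriv_le (μ := volume.restrict (Ioi (0 : ℝ)))
    (F := fun w t => reducedKWeight ν w t) (F' := fun w t => -reducedKWeight (ν - 1) w t)
    (x₀ := w) (s := Metric.ball w (w / 2))
    (bound := fun t => t ^ ((ν - 1).re - 1) * Real.exp (-t - (w / 2) / t))
    (Metric.ball_mem_nhds _ (by positivity))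
    (Eventually.of_forall fun w => aestronglyMeasurable_reducedKWeight ν w)
    (integrableOn_reducedKWeight_of_pos ν hw) (aestronglyMeasurable_reducedKWeight (ν - 1) w).neg
    ?_ (integrableOn_rpow_mul_exp_of_pos _ (by positivity)) ?_
  · refine (key.2).congr_deriv ?_
    rw [integral_neg]; rfl
  · refine (ae_restrict_iff' measurableSet_Ioi).2 (ae_of_all _ fun t (ht : 0 < t) v hv => ?_)
    rw [norm_neg, norm_reducedKWeight _ _ ht]
    rw [Metric.mem_ball, Real.dist_eq, abs_lt] at hv
    have : w / 2 / t ≤ v / t := by gcongr; linarith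
    gcongr
  · refine (ae_restrict_iff' measurableSet_Ioi).2 (ae_of_all _ fun t (ht : 0 < t) v hv => ?_)
    have h1 : HasDerivAt (fun v : ℝ => Real.exp (-t - v / t))
        (Real.exp (-t - v / t) * (-(1 / t))) v :=
      (((hasDerivAt_id v).div_const t).const_sub (-t)).exp
    refine (h1.ofReal_comp.const_mul ((t : ℂ) ^ (ν - 1))).congr_deriv ?_
    have ht' : (t : ℂ) ≠ 0 := by exact_mod_cast ht.ne'
    rw [reducedKWeight, Complex.cpow_sub (ν - 1) 1 ht', Complex.cpow_one]
    push_cast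
    field_simp

lemma hasDerivAt_ofReal_cpow {t : ℝ} (ht : 0 < t) (ν : ℂ) :
    HasDerivAt (fun t : ℝ => (t : ℂ) ^ ν) (ν * (t : ℂ) ^ (ν - 1)) t := by
  have := ((hasDerivAt_id (t : ℂ)).cpow_const (c := ν)
    (Complex.ofReal_mem_slitPlane.2 ht)).comp_ofReal
  simpa using this

lemma hasDerivAt_reducedKWeight (ν : ℂ) (w : ℝ) {t : ℝ} (ht : 0 < t) :
    HasDerivAt (fun t => reducedKWeight (ν + 1) w t)
      (ν * reducedKWeight ν w t - reducedKWeight (ν + 1) w t + w * reducedKWeight (ν - 1) w t) t := by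
  have h1 : HasDerivAt (fun t : ℝ => Real.exp (-t - w / t))
      (Real.exp (-t - w / t) * (-1 - (-w / t ^ 2))) t := by
    have := ((hasDerivAt_id t).neg.sub ((hasDerivAt_const t w).div (hasDerivAt_id t) ht.ne')).exp
    refine this.congr_deriv ?_
    simp
  have h2 := (hasDerivAt_ofReal_cpow ht (ν + 1 - 1)).mul h1.ofReal_comp
  refine h2.congr_deriv ?_
  have ht' : (t : ℂ) ≠ 0 := by exact_mod_cast ht.ne'
  simp only [reducedKWeight, add_sub_cancel_right]
  rw [Complex.cpow_sub ν 1 ht', Complex.cpow_sub (ν - 1) 1 ht', Complex.cpow_sub ν 1 ht',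
    Complex.cpow_one]
  push_cast
  field_simp
  ring

lemma tendsto_reducedKWeight_zero {ν : ℂ} {w : ℝ} (h : (0 < w) ∨ (0 ≤ w ∧ 1 < ν.re)) :
    Tendsto (reducedKWeight ν w) (nhdsWithin 0 (Ioi 0)) (nhds 0) := by
  have hw : 0 ≤ w := by rcases h with h | h <;> linarith
  have hb : ∃ C b : ℝ, 0 < b ∧ ∀ t : ℝ, 0 < t → ‖reducedKWeight ν w t‖ ≤ C * t ^ b := by
    rcases h with h | h
    · obtain ⟨n, hn⟩ := exists_nat_gt (1 - ν.re : ℝ)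
      refine ⟨n.factorial / w ^ n, ν.re - 1 + n, by linarith, fun t ht => ?_⟩
      rw [norm_reducedKWeight _ _ ht]
      refine (rpow_mul_exp_le h ht n).trans ?_
      gcongr
      have : Real.exp (-t) ≤ 1 := Real.exp_le_one_iff.2 (by linarith)
      exact mul_le_of_le_one_left (by positivity) this
    · refine ⟨1, ν.re - 1, by linarith, fun t ht => ?_⟩
      rw [norm_reducedKWeight _ _ ht, one_mul]
      have : 0 ≤ w / t := by positivity
      exact mul_le_of_le_one_right (by positivity) (Real.exp_le_one_iff.2 (by linarith))
  obtain ⟨C, b, hb, hC⟩ := hb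
  refine squeeze_zero_norm' (eventually_nhdsWithin_of_forall fun t ht => hC t ht) ?_
  have : Tendsto (fun t : ℝ => C * t ^ b) (nhds 0) (nhds (C * 0 ^ b)) :=
    ((Real.continuousAt_rpow_const _ _ (Or.inr hb.le)).tendsto).const_mul C
  rw [Real.zero_rpow hb.ne', mul_zero] at this
  exact this.mono_left nhdsWithin_le_nhds

lemma reducedK_recurrence (ν : ℂ) {w : ℝ} (hw : 0 < w) :
    ν * reducedK ν w - reducedK (ν + 1) w + w * reducedK (ν - 1) w = 0 := by
  have i0 := integrableOn_reducedKWeight_of_pos ν hw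
  have i1 := integrableOn_reducedKWeight_of_pos (ν + 1) hw
  have i2 := integrableOn_reducedKWeight_of_pos (ν - 1) hw
  have hi := ((i0.const_mul ν).sub i1).add (i2.const_mul (w : ℂ))
  have hd := fun t (ht : t ∈ Ioi (0 : ℝ)) => hasDerivAt_reducedKWeight ν w ht
  have := integral_Ioi_deriv_eq_zero hd hi (tendsto_reducedKWeight_zero (Or.inl hw))
    (tendsto_zero_of_hasDerivAt_of_integrableOn_Ioi hd hi i1)
  have e := integral_add ((i0.const_mul ν).sub i1) (i2.const_mul (w : ℂ))
  simp only [Pi.sub_apply] at e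
  rw [e, integral_sub (i0.const_mul ν) i1, integral_const_mul, integral_const_mul] at this
  exact this

lemma continuousAt_reducedK_order (ν : ℂ) {w : ℝ} (hw : 0 < w) :
    ContinuousAt (fun μ => reducedK μ w) ν := by
  refine continuousAt_of_dominated
    (bound := fun t => t ^ (ν.re - 2) * Real.exp (-t - w / t) + t ^ ν.re * Real.exp (-t - w / t))
    (Eventually.of_forall fun μ => aestronglyMeasurable_reducedKWeight μ w) ?_
    ((integrableOn_rpow_mul_exp_of_pos _ hw).add (integrableOn_rpow_mul_exp_of_pos _ hw)) ?_
  · filter_upwards [Metric.ball_mem_nhds ν one_pos] with μ hμ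
    refine (ae_restrict_iff' measurableSet_Ioi).2 (ae_of_all _ fun t (ht : 0 < t) => ?_)
    rw [norm_reducedKWeight _ _ ht, ← add_mul]
    have hre : |μ.re - ν.re| < 1 := by
      rw [Metric.mem_ball, dist_eq_norm] at hμ
      exact (Complex.abs_re_le_norm (μ - ν)).trans_lt hμ
    rw [abs_lt] at hre
    gcongr
    rcases le_total t 1 with h | h
    · exact (Real.rpow_le_rpow_of_exponent_ge ht h (by linarith)).trans
        (le_add_of_nonneg_right (by positivity))
    · exact (Real.rpow_le_rpow_of_exponent_le h (by linarith)).trans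
        (le_add_of_nonneg_left (by positivity))
  · refine (ae_restrict_iff' measurableSet_Ioi).2 (ae_of_all _ fun t (ht : 0 < t) => ?_)
    have ht' : (t : ℂ) ≠ 0 := by exact_mod_cast ht.ne'
    refine ContinuousAt.mul ?_ continuousAt_const
    exact (continuousAt_const_cpow ht').comp (continuousAt_id.sub continuousAt_const)

lemma tendsto_reducedK_add_one_zero {ν : ℂ} (hν : 0 ≤ ν.re) :
    Tendsto (reducedK (ν + 1)) (nhdsWithin 0 (Ioi 0)) (nhds (Complex.Gamma (ν + 1))) := by
  have hν1 : 0 < (ν + 1).re := by simp; linarith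
  rw [← reducedK_zero hν1]
  refine tendsto_integral_filter_of_dominated_convergence
    (fun t => Real.exp (-t) * t ^ ((ν + 1).re - 1))
    (Eventually.of_forall fun w => aestronglyMeasurable_reducedKWeight _ w) ?_
    (Real.GammaIntegral_convergent hν1) ?_
  · refine eventually_nhdsWithin_of_forall fun w (hw : 0 < w) => ?_
    refine (ae_restrict_iff' measurableSet_Ioi).2 (ae_of_all _ fun t (ht : 0 < t) => ?_)
    rw [norm_reducedKWeight _ _ ht, mul_comm]
    have : 0 ≤ w / t := by positivity
    gcongr
    linarith
  · refine ae_of_all _ fun t => ?_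
    have : Continuous fun w => reducedKWeight (ν + 1) w t := by
      unfold reducedKWeight; fun_prop
    exact (this.tendsto 0).mono_left nhdsWithin_le_nhds

lemma tendsto_mul_reducedK_zero {ν : ℂ} (hν : 0 ≤ ν.re) :
    Tendsto (fun w : ℝ => w * reducedK ν w) (nhdsWithin 0 (Ioi 0)) (nhds 0) := by
  have hν1 : 0 < ν.re + 1 := by linarith
  have e : (fun w : ℝ => (w : ℂ) * reducedK ν w) =
      fun w : ℝ => ∫ t in Ioi (0 : ℝ), w * reducedKWeight ν w t := by
    ext w; rw [integral_const_mul]; rfl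
  have e0 : (0 : ℂ) = ∫ t in Ioi (0 : ℝ), 0 := by simp
  rw [e, e0]
  refine tendsto_integral_filter_of_dominated_convergence
    (fun t => Real.exp (-t) * t ^ (ν.re + 1 - 1))
    (Eventually.of_forall fun w => (aestronglyMeasurable_reducedKWeight _ w).const_mul _) ?_
    (Real.GammaIntegral_convergent hν1) ?_
  · refine eventually_nhdsWithin_of_forall fun w (hw : 0 < w) => ?_
    refine (ae_restrict_iff' measurableSet_Ioi).2 (ae_of_all _ fun t (ht : 0 < t) => ?_)
    rw [norm_mul, norm_reducedKWeight _ _ ht, Complex.norm_real, Real.norm_of_nonneg hw.le]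
    have h := exp_neg_div_le hw ht 1
    calc w * (t ^ (ν.re - 1) * Real.exp (-t - w / t))
        = w * (t ^ (ν.re - 1) * (Real.exp (-t) * Real.exp (-(w / t)))) := by
          rw [← Real.exp_add, ← sub_eq_add_neg]
      _ ≤ w * (t ^ (ν.re - 1) * (Real.exp (-t) * (Nat.factorial 1 * (t / w) ^ 1))) := by gcongr
      _ = Real.exp (-t) * t ^ (ν.re + 1 - 1) := by
          rw [show ν.re + 1 - 1 = ν.re - 1 + 1 by ring, Real.rpow_add ht, Real.rpow_one]
          field_simp
          simp
  · refine ae_of_all _ fun t => ?_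
    have : Continuous fun w : ℝ => (w : ℂ) * reducedKWeight ν w t := by
      unfold reducedKWeight; fun_prop
    have := (this.tendsto 0).mono_left (nhdsWithin_le_nhds (s := Ioi 0))
    simpa using this

/-- The substitution `t = (y/2) e^r`. -/
lemma reducedK_eq_integral_exp (ν : ℂ) {y : ℝ} (hy : 0 < y) :
    reducedK ν (y ^ 2 / 4) = ((y / 2 : ℝ) : ℂ) ^ ν *
      ∫ r : ℝ, Complex.exp (ν * r) * (Real.exp (-y * Real.cosh r) : ℂ) := by
  have hy2 : 0 < y / 2 := by positivity
  have himg : (fun r : ℝ => y / 2 * Real.exp r) '' univ = Ioi 0 := by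
    ext t
    constructor
    · rintro ⟨r, -, rfl⟩
      exact mul_pos hy2 (Real.exp_pos r)
    · intro (ht : 0 < t)
      refine ⟨Real.log (t / (y / 2)), mem_univ _, ?_⟩
      simp only
      rw [Real.exp_log (by positivity)]
      field_simp
  rw [reducedK, ← himg, integral_image_eq_integral_abs_deriv_smul (f' := fun r => y / 2 * Real.exp r)
    MeasurableSet.univ (fun r _ => ((Real.hasDerivAt_exp r).const_mul (y / 2)).hasDerivWithinAt)
    (fun a _ b _ hab => by simpa [hy.ne'] using hab), setIntegral_univ, ← integral_const_mul]
  congr 1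
  ext r
  have hpos : 0 < y / 2 * Real.exp r := by positivity
  have hne : ((y / 2 * Real.exp r : ℝ) : ℂ) ≠ 0 := by exact_mod_cast hpos.ne'
  rw [reducedKWeight, abs_of_pos hpos, Complex.real_smul, ← mul_assoc]
  have h1 : ((y / 2 * Real.exp r : ℝ) : ℂ) * ((y / 2 * Real.exp r : ℝ) : ℂ) ^ (ν - 1) =
      ((y / 2 * Real.exp r : ℝ) : ℂ) ^ ν := by
    rw [Complex.cpow_sub _ _ hne, Complex.cpow_one, mul_div_cancel₀ _ hne]
  have h2 : ((y / 2 * Real.exp r : ℝ) : ℂ) ^ ν = ((y / 2 : ℝ) : ℂ) ^ ν * Complex.exp (ν * r) := by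
    rw [Complex.ofReal_mul, Complex.mul_cpow_ofReal_nonneg hy2.le (Real.exp_pos r).le,
      Complex.cpow_def_of_ne_zero (Complex.ofReal_ne_zero.2 (Real.exp_ne_zero r)),
      ← Complex.ofReal_log (Real.exp_pos r).le, Real.log_exp, mul_comm (r : ℂ)]
  rw [h1, h2, mul_assoc]
  congr 3
  rw [Real.cosh_eq, Real.exp_neg]
  congr 1
  have := Real.exp_pos r
  field_simp
  ring

lemma reducedK_neg_order (ν : ℂ) {w : ℝ} (hw : 0 < w) :
    reducedK (-ν) w = (w : ℂ) ^ (-ν) * reducedK ν w := by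
  set y := 2 * √w with hy
  have hy0 : 0 < y := by positivity
  have hw2 : w = y ^ 2 / 4 := by
    rw [hy, mul_pow, Real.sq_sqrt hw.le]; ring
  have hy2 : ((y / 2 : ℝ) : ℂ) ≠ 0 := by exact_mod_cast (by positivity : y / 2 ≠ 0)
  have hsq : (w : ℂ) ^ (-ν) = ((y / 2 : ℝ) : ℂ) ^ (-ν) * ((y / 2 : ℝ) : ℂ) ^ (-ν) := by
    rw [← Complex.mul_cpow_ofReal_nonneg (by positivity) (by positivity), ← Complex.ofReal_mul, hw2]
    congr 2
    ring
  rw [hsq, hw2, reducedK_eq_integral_exp _ hy0, reducedK_eq_integral_exp _ hy0]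
  have h1 : ((y / 2 : ℝ) : ℂ) ^ (-ν) * ((y / 2 : ℝ) : ℂ) ^ ν = 1 := by
    rw [← Complex.cpow_add _ _ hy2]; simp
  have h2 : ∫ r : ℝ, Complex.exp (-ν * r) * (Real.exp (-y * Real.cosh r) : ℂ) =
      ∫ r : ℝ, Complex.exp (ν * r) * (Real.exp (-y * Real.cosh r) : ℂ) := by
    rw [← integral_neg_eq_self]
    congr 1
    ext r
    simp
  rw [h2]
  linear_combination -(((y / 2 : ℝ) : ℂ) ^ (-ν) * ∫ r : ℝ, Complex.exp (ν * r) *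
      (Real.exp (-y * Real.cosh r) : ℂ)) * h1

lemma reducedI_mul_reducedK_add_one {ν : ℂ} (hν : 0 ≤ ν.re) {w : ℝ} (hw : 0 < w) :
    reducedI ν w * reducedK (ν + 1) w + w * reducedK ν w * reducedI (ν + 1) w = 1 := by
  have hν1 : 0 ≤ (ν + 1).re := by simp; linarith
  set G : ℝ → ℂ := fun w => reducedI ν w * reducedK (ν + 1) w + w * reducedK ν w * reducedI (ν + 1) w
    with hG
  have hd : ∀ v ∈ Ioi (0 : ℝ), HasDerivAt G 0 v := by
    intro v (hv : 0 < v)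
    have h1 := ((hasDerivAt_reducedI hν (v : ℂ)).comp_ofReal.mul (hasDerivAt_reducedK (ν + 1) hv))
    have h2 := ((Complex.ofRealCLM.hasDerivAt (x := v)).mul (hasDerivAt_reducedK ν hv)).mul
      (hasDerivAt_reducedI hν1 (v : ℂ)).comp_ofReal
    refine (h1.add h2).congr_deriv ?_
    have r1 := reducedI_recurrence hν (v : ℂ)
    have r2 := reducedK_recurrence ν hv
    simp only [Pi.mul_apply, add_sub_cancel_right, Complex.ofRealCLM_apply, Complex.ofReal_one, one_mul]
    rw [show ν + 1 + 1 = ν + 2 by ring]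
    linear_combination reducedK ν v * r1 - reducedI (ν + 1) v * r2
  have hconst : ∀ v ∈ Ioi (0 : ℝ), G v = G w := fun v hv =>
    isOpen_Ioi.is_const_of_deriv_eq_zero isPreconnected_Ioi
      (fun x hx => (hd x hx).differentiableAt.differentiableWithinAt) (fun x hx => (hd x hx).deriv)
      hv hw
  have hI : ∀ {μ : ℂ}, 0 ≤ μ.re → Tendsto (fun v : ℝ => reducedI μ v) (nhdsWithin 0 (Ioi 0))
      (nhds (Complex.Gamma (μ + 1))⁻¹) := by
    intro μ hμ
    have := ((continuous_reducedI hμ).comp Complex.continuous_ofReal).tendsto 0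
    simp only [Function.comp_apply, Complex.ofReal_zero, reducedI_zero] at this
    exact this.mono_left nhdsWithin_le_nhds
  have hlim := ((hI hν).mul (tendsto_reducedK_add_one_zero hν)).add
    ((tendsto_mul_reducedK_zero hν).mul (hI hν1))
  have hlim2 : Tendsto G (nhdsWithin 0 (Ioi 0)) (nhds (G w)) :=
    tendsto_const_nhds.congr' (eventually_nhdsWithin_of_forall fun v hv => (hconst v hv).symm)
  have := tendsto_nhds_unique hlim2 hlim
  have hne : Complex.Gamma (ν + 1) ≠ 0 :=
    Complex.Gamma_ne_zero_of_re_pos (by simp; linarith)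
  rw [zero_mul, add_zero, inv_mul_cancel₀ hne] at this
  exact this

lemma inv_Gamma_mul_inv_Gamma (ν : ℂ) :
    ν * ((Complex.Gamma (ν + 1))⁻¹ * (Complex.Gamma (-ν + 1))⁻¹) =
      Complex.sin (Real.pi * ν) / Real.pi := by
  by_cases h0 : ν = 0
  · simp [h0]
  · have h := Complex.Gamma_mul_Gamma_one_sub ν
    rw [Complex.Gamma_add_one ν h0, show -ν + 1 = 1 - ν by ring, ← mul_inv, mul_assoc, h, mul_inv,
      ← mul_assoc, mul_inv_cancel₀ h0, one_mul, inv_div]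

lemma reducedI_cross_eq {ν : ℂ} (hν : ν.re = 0) (z : ℂ) :
    reducedI ν z * (z * reducedI (-ν + 1) z - ν * reducedI (-ν) z) -
      z * reducedI (ν + 1) z * reducedI (-ν) z = -(Complex.sin (Real.pi * ν) / Real.pi) := by
  have h0 : 0 ≤ ν.re := hν.ge
  have h1 : 0 ≤ (ν + 1).re := by simp [hν]
  have h2 : 0 ≤ (-ν).re := by simp [hν]
  have h3 : 0 ≤ (-ν + 1).re := by simp [hν]
  set G : ℂ → ℂ := fun z => reducedI ν z * (z * reducedI (-ν + 1) z - ν * reducedI (-ν) z) -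
      z * reducedI (ν + 1) z * reducedI (-ν) z with hG
  have hd : ∀ z, HasDerivAt G 0 z := by
    intro z
    have d := ((hasDerivAt_reducedI h0 z).mul (((hasDerivAt_id z).mul (hasDerivAt_reducedI h3 z)).sub
      ((hasDerivAt_reducedI h2 z).const_mul ν))).sub
      (((hasDerivAt_id z).mul (hasDerivAt_reducedI h1 z)).mul (hasDerivAt_reducedI h2 z))
    refine d.congr_deriv ?_
    have r1 := reducedI_recurrence h0 z
    have r2 := reducedI_recurrence h2 z
    simp only [id_eq, Pi.mul_apply, Pi.sub_apply]
    rw [show ν + 1 + 1 = ν + 2 by ring, show -ν + 1 + 1 = -ν + 2 by ring]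
    linear_combination reducedI ν z * r2 - reducedI (-ν) z * r1
  have hc := is_const_of_deriv_eq_zero (fun z => (hd z).differentiableAt) (fun z => (hd z).deriv) z 0
  change G z = _
  rw [hc]
  simp only [hG, reducedI_zero, zero_mul, sub_zero, zero_sub]
  rw [← inv_Gamma_mul_inv_Gamma]
  ring

/-- The connection formula `K_ν = π (I_{-ν} - I_ν) / (2 sin πν)` in reduced form. -/
lemma reducedK_connection {ν : ℂ} (hν : ν.re = 0) {w : ℝ} (hw : 0 < w) :
    Complex.sin (Real.pi * ν) / Real.pi * reducedK ν w =
      reducedI (-ν) w - (w : ℂ) ^ ν * reducedI ν w := by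
  have hw0 : (w : ℂ) ≠ 0 := by exact_mod_cast hw.ne'
  have X := reducedI_cross_eq hν (w : ℂ)
  have W := reducedI_mul_reducedK_add_one hν.ge hw
  have W' := reducedI_mul_reducedK_add_one (ν := -ν) (by simp [hν]) hw
  have r := reducedK_recurrence ν hw
  have n1 := reducedK_neg_order ν hw
  have n2 := reducedK_neg_order (ν - 1) hw
  rw [show -(ν - 1) = -ν + 1 by ring, Complex.cpow_add _ _ hw0, Complex.cpow_one] at n2
  have hp : (w : ℂ) ^ ν * (w : ℂ) ^ (-ν) = 1 := by rw [← Complex.cpow_add _ _ hw0]; simp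
  have W2 : reducedI (-ν) w * (reducedK (ν + 1) w - ν * reducedK ν w) +
      w * reducedK ν w * reducedI (-ν + 1) w = (w : ℂ) ^ ν := by
    rw [n1, n2] at W'
    linear_combination (w : ℂ) ^ ν * W' - hp * (reducedI (-ν) w * w * reducedK (ν - 1) w +
      w * reducedK ν w * reducedI (-ν + 1) w) - reducedI (-ν) w * r
  linear_combination reducedK ν w * X - reducedI ν w * W2 + reducedI (-ν) w * W

lemma reducedI_conj (ν z : ℂ) :
    reducedI (starRingEnd ℂ ν) (starRingEnd ℂ z) = starRingEnd ℂ (reducedI ν z) := by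
  unfold reducedI
  rw [Complex.conj_tsum]
  refine tsum_congr fun n => ?_
  rw [map_mul, map_mul, map_inv₀, map_inv₀, map_pow, ← Complex.Gamma_conj]
  simp

lemma besselI_neg_order_eq_conj (τ : ℝ) {y : ℝ} (hy : 0 < y) :
    besselI (-(Complex.I * τ)) y = starRingEnd ℂ (besselI (Complex.I * τ) y) := by
  have hc : starRingEnd ℂ (Complex.I * τ) = -(Complex.I * τ) := by simp
  rw [besselI_eq_reducedI _ hy, besselI_eq_reducedI _ hy, map_mul, ← reducedI_conj, hc,
    Complex.conj_ofReal]
  congr 1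
  rw [← hc, Complex.cpow_conj _ _ (by
    rw [Complex.arg_ofReal_of_nonneg (by positivity)]; exact Real.pi_pos.ne), Complex.conj_ofReal]

lemma sq_le_sinh_sq (x : ℝ) : x ^ 2 ≤ Real.sinh x ^ 2 := by
  rcases le_total 0 x with h | h
  · exact pow_le_pow_left₀ h (Real.self_le_sinh_iff.2 h) 2
  · have := Real.sinh_le_self_iff.2 h
    nlinarith

lemma one_add_sq_div_two_le_cosh (r : ℝ) : 1 + r ^ 2 / 2 ≤ Real.cosh r := by
  have h := sq_le_sinh_sq (r / 2)
  have h2 := Real.cosh_two_mul (r / 2)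
  have h3 := Real.cosh_sq (r / 2)
  rw [mul_div_cancel₀ _ (two_ne_zero' ℝ)] at h2
  nlinarith

lemma besselKi_eq_reducedK (τ : ℝ) {y : ℝ} (hy : 0 < y) :
    (besselKi τ y : ℂ) = 1 / 2 * ((y / 2 : ℝ) : ℂ) ^ (-(Complex.I * τ)) *
      reducedK (Complex.I * τ) (y ^ 2 / 4) := by
  have hy2 : ((y / 2 : ℝ) : ℂ) ≠ 0 := by exact_mod_cast (by positivity : y / 2 ≠ 0)
  have h1 : ((y / 2 : ℝ) : ℂ) ^ (-(Complex.I * τ)) * ((y / 2 : ℝ) : ℂ) ^ (Complex.I * τ) = 1 := by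
    rw [← Complex.cpow_add _ _ hy2]; simp
  rw [reducedK_eq_integral_exp _ hy, mul_assoc, ← mul_assoc _ _ (∫ _, _), h1, one_mul]
  set F : ℝ → ℂ := fun r => Complex.exp (Complex.I * τ * r) * (Real.exp (-y * Real.cosh r) : ℂ)
    with hF
  have hFi : Integrable F := by
    have hb : Integrable fun r : ℝ => Real.exp (-(y / 2) * r ^ 2) := integrable_exp_neg_mul_sq (by positivity)
    refine Integrable.mono' hb ?_ ?_
    · refine Continuous.aestronglyMeasurable ?_
      fun_prop
    · refine ae_of_all _ fun r => ?_
      have : ‖Complex.exp (Complex.I * τ * r)‖ = 1 := by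
        rw [show Complex.I * (τ : ℂ) * r = ((τ * r : ℝ) : ℂ) * Complex.I by push_cast; ring]
        exact Complex.norm_exp_ofReal_mul_I _
      rw [norm_mul, this, one_mul, Complex.norm_real, Real.norm_of_nonneg (Real.exp_pos _).le]
      have h := one_add_sq_div_two_le_cosh r
      refine Real.exp_le_exp.2 ?_
      nlinarith
  have hsplit : ∫ r, F r = (∫ r in Ioi (0 : ℝ), F (-r)) + ∫ r in Ioi (0 : ℝ), F r := by
    rw [integral_comp_neg_Ioi, neg_zero, ← setIntegral_union (Iic_disjoint_Ioi le_rfl)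
      measurableSet_Ioi hFi.integrableOn hFi.integrableOn, Iic_union_Ioi, setIntegral_univ]
  rw [hsplit, ← integral_add hFi.comp_neg.integrableOn hFi.integrableOn, besselKi, ← integral_complex_ofReal,
    ← integral_const_mul]
  congr 1
  ext r
  simp only [hF, Complex.ofReal_neg, Real.cosh_neg]
  push_cast
  rw [Complex.cos, show (τ : ℂ) * r * Complex.I = Complex.I * τ * r by ring, 
    show -((τ : ℂ) * r) * Complex.I = Complex.I * τ * -r by ring]
  ring

/-- `K_{iτ}` in terms of the imaginary part of `I_{iτ}`. -/
lemma sinh_mul_besselKi (τ : ℝ) {y : ℝ} (hy : 0 < y) :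
    Real.sinh (Real.pi * τ) * besselKi τ y = -Real.pi * (besselI (Complex.I * τ) y).im := by
  have hy2 : ((y / 2 : ℝ) : ℂ) ≠ 0 := by exact_mod_cast (by positivity : y / 2 ≠ 0)
  have h := reducedK_connection (ν := Complex.I * τ) (by simp) (w := y ^ 2 / 4) (by positivity)
  have hw : ((y ^ 2 / 4 : ℝ) : ℂ) ^ (Complex.I * (τ : ℂ)) =
      ((y / 2 : ℝ) : ℂ) ^ (Complex.I * (τ : ℂ)) * ((y / 2 : ℝ) : ℂ) ^ (Complex.I * (τ : ℂ)) := by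
    rw [← Complex.mul_cpow_ofReal_nonneg (by positivity) (by positivity), ← Complex.ofReal_mul]
    congr 2
    ring
  have h1 : ((y / 2 : ℝ) : ℂ) ^ (-(Complex.I * τ)) * ((y / 2 : ℝ) : ℂ) ^ (Complex.I * τ) = 1 := by
    rw [← Complex.cpow_add _ _ hy2]; simp
  have hs : Complex.sin (Real.pi * (Complex.I * τ)) = Real.sinh (Real.pi * τ) * Complex.I := by
    rw [show (Real.pi : ℂ) * (Complex.I * τ) = (Real.pi * τ : ℂ) * Complex.I by ring, Complex.sin_mul_I]
    push_cast; ring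
  have hpi : (Real.pi : ℂ) ≠ 0 := by exact_mod_cast Real.pi_ne_zero
  have hK := besselKi_eq_reducedK τ hy
  have hc := besselI_neg_order_eq_conj τ hy
  have hI := besselI_eq_reducedI (Complex.I * τ) hy
  have hI' := besselI_eq_reducedI (-(Complex.I * τ)) hy
  have him := Complex.sub_conj (besselI (Complex.I * τ) y)
  rw [hs, hw] at h
  have key : (Real.sinh (Real.pi * τ) * besselKi τ y : ℂ) * (2 * Complex.I) =
      (-Real.pi * (besselI (Complex.I * τ) y).im : ℂ) * (2 * Complex.I) := by
    rw [← hc, hI', Complex.ofReal_mul, Complex.ofReal_ofNat] at him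
    nth_rewrite 1 [hI] at him
    rw [hK]
    field_simp at h
    linear_combination ((y / 2 : ℝ) : ℂ) ^ (-(Complex.I * τ)) * h - Real.pi * him
      - Real.pi * h1 * ((y / 2 : ℝ) : ℂ) ^ (Complex.I * τ) * reducedI (Complex.I * τ) ((y ^ 2 / 4 : ℝ) : ℂ)
  have := mul_right_cancel₀ (by simp) key
  exact_mod_cast this

/-- The product `I_{iτ}(y) K_{iτ}(y)`. -/
noncomputable def besselIK (τ y : ℝ) : ℂ :=
  1 / 2 * (reducedI (Complex.I * τ) ((y ^ 2 / 4 : ℝ) : ℂ) * reducedK (Complex.I * τ) (y ^ 2 / 4))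

lemma besselI_mul_besselKi (τ : ℝ) {y : ℝ} (hy : 0 < y) :
    besselI (Complex.I * τ) y * besselKi τ y = besselIK τ y := by
  have hy2 : ((y / 2 : ℝ) : ℂ) ≠ 0 := by exact_mod_cast (by positivity : y / 2 ≠ 0)
  have h1 : ((y / 2 : ℝ) : ℂ) ^ (-(Complex.I * τ)) * ((y / 2 : ℝ) : ℂ) ^ (Complex.I * τ) = 1 := by
    rw [← Complex.cpow_add _ _ hy2]; simp
  rw [besselKi_eq_reducedK τ hy, besselI_eq_reducedI _ hy, besselIK]
  linear_combination 1 / 2 * (reducedI (Complex.I * τ) ((y ^ 2 / 4 : ℝ) : ℂ) *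
    reducedK (Complex.I * τ) (y ^ 2 / 4)) * h1

lemma re_besselI_add_mul_besselKi (τ : ℝ) {y : ℝ} (hy : 0 < y) :
    (besselI (Complex.I * τ) y + besselI (-(Complex.I * τ)) y).re * besselKi τ y =
      2 * (besselIK τ y).re := by
  rw [← besselI_mul_besselKi τ hy, besselI_neg_order_eq_conj τ hy, Complex.re_mul_ofReal]
  simp
  ring

lemma sinh_mul_besselKi_sq (τ : ℝ) {y : ℝ} (hy : 0 < y) :
    Real.sinh (Real.pi * τ) * besselKi τ y ^ 2 = -Real.pi * (besselIK τ y).im := by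
  rw [← besselI_mul_besselKi τ hy, sq, ← mul_assoc, sinh_mul_besselKi τ hy, Complex.im_mul_ofReal]
  ring

/-- A version of the mean value inequality that ignores the derivative at the left endpoint. -/
lemma norm_le_of_norm_deriv_le_boundary {f f' : ℝ → ℂ} {B B' : ℝ → ℝ} {b : ℝ}
    (hf : ContinuousOn f (Icc 0 b)) (hf' : ∀ x ∈ Ioo 0 b, HasDerivAt f (f' x) x) (h0 : f 0 = 0)
    (hB : ContinuousOn B (Icc 0 b)) (hB' : ∀ x ∈ Ioo 0 b, HasDerivAt B (B' x) x) (hB0 : 0 ≤ B 0)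
    (bound : ∀ x ∈ Ioo 0 b, ‖f' x‖ ≤ B' x) {x : ℝ} (hx : x ∈ Icc 0 b) : ‖f x‖ ≤ B x := by
  rcases hx.1.eq_or_lt with h | h
  · rw [← h, h0, norm_zero]; exact hB0
  have key : ∀ ε ∈ Ioo 0 x, ‖f x - f ε‖ ≤ B x - B ε := by
    intro ε hε
    have hsub : Icc ε x ⊆ Icc 0 b := Icc_subset_Icc hε.1.le hx.2
    have hmem : ∀ z ∈ Ico ε x, z ∈ Ioo 0 b := fun z hz => ⟨hε.1.trans_le hz.1, hz.2.trans_le hx.2⟩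
    exact image_norm_le_of_norm_deriv_right_le_deriv_boundary' (f := fun z => f z - f ε) (f' := f')
      (B := fun z => B z - B ε) (B' := B')
      ((hf.mono hsub).sub continuousOn_const)
      (fun z hz => ((hf' z (hmem z hz)).sub_const _).hasDerivWithinAt) (by simp)
      ((hB.mono hsub).sub continuousOn_const)
      (fun z hz => ((hB' z (hmem z hz)).sub_const _).hasDerivWithinAt)
      (fun z hz => bound z (hmem z hz)) ⟨hε.2.le, le_rfl⟩
  have hb : 0 ≤ b := hx.1.trans hx.2
  have e : nhdsWithin (0 : ℝ) (Ioi 0) ≤ nhdsWithin 0 (Icc 0 b) := by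
    have : Ioo 0 b ⊆ Icc 0 b := Ioo_subset_Icc_self
    rw [← nhdsWithin_Ioo_eq_nhdsGT (h.trans_le hx.2)]
    exact nhdsWithin_mono _ this
  have l1 := (hf 0 ⟨le_rfl, hb⟩).mono_left e
  have l2 := (hB 0 ⟨le_rfl, hb⟩).mono_left e
  have := le_of_tendsto_of_tendsto ((tendsto_const_nhds (x := f x)).sub l1).norm
    ((tendsto_const_nhds (x := B x)).sub l2)
    (by filter_upwards [Ioo_mem_nhdsGT h] with ε hε using key ε hε)
  rw [h0, sub_zero] at this
  linarith

/-- The integrands `t^k e^{-ts} I(s t²)` against `reducedKWeight`. -/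
noncomputable def momentKernel (ν : ℂ) (w : ℝ) (k j : ℕ) (s t : ℝ) : ℂ :=
  reducedKWeight ν w t * (t : ℂ) ^ k * (Real.exp (-(t * s)) : ℂ) *
    reducedI (ν + j) ((s : ℂ) * (t : ℂ) ^ 2)

/-- The integral of `momentKernel`. -/
noncomputable def momentIntegral (ν : ℂ) (w : ℝ) (k j : ℕ) (s : ℝ) : ℂ :=
  ∫ t in Ioi (0 : ℝ), momentKernel ν w k j s t

/-- A dominating function for `momentKernel`. -/
noncomputable def momentBound (ν : ℂ) (k j : ℕ) (b t : ℝ) : ℝ :=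
  ‖(Complex.Gamma (ν + j + 1))⁻¹‖ * (t ^ (ν.re - 1 + k) * Real.exp (-((1 - √b) ^ 2) * t ^ (1 : ℝ)))

lemma norm_momentKernel_le {ν : ℂ} {w : ℝ} (hν : 0 < ν.re) (hw : 0 ≤ w) (k j : ℕ) {s b t : ℝ}
    (hs : 0 ≤ s) (hsb : s ≤ b) (hb : b < 1)
    (ht : 0 < t) : ‖momentKernel ν w k j s t‖ ≤ momentBound ν k j b t := by
  have hj : 0 ≤ (ν + j).re := by simp; positivity
  have h1 := norm_reducedI_le hj ((s : ℂ) * (t : ℂ) ^ 2)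
  have h2 : √‖(s : ℂ) * (t : ℂ) ^ 2‖ = √s * t := by
    rw [norm_mul, norm_pow, Complex.norm_real, Complex.norm_real, Real.norm_of_nonneg hs,
      Real.norm_of_nonneg ht.le, Real.sqrt_mul hs, Real.sqrt_sq ht.le]
  rw [h2] at h1
  rw [momentKernel, norm_mul, norm_mul, norm_mul, norm_reducedKWeight _ _ ht, norm_pow,
    Complex.norm_real, Complex.norm_real, Real.norm_of_nonneg ht.le,
    Real.norm_of_nonneg (Real.exp_pos _).le]
  have hwt : 0 ≤ w / t := by positivity
  have hsb' : √s ≤ √b := Real.sqrt_le_sqrt hsb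
  have hb1 : √b < 1 := by rw [Real.sqrt_lt' one_pos]; simpa using hb
  have hss : √s ^ 2 = s := Real.sq_sqrt hs
  have hexp : Real.exp (-t - w / t) * (Real.exp (-(t * s)) * Real.exp (2 * (√s * t))) ≤
      Real.exp (-((1 - √b) ^ 2) * t ^ (1 : ℝ)) := by
    rw [← Real.exp_add, ← Real.exp_add, Real.rpow_one]
    refine Real.exp_le_exp.2 ?_
    have : (1 - √b) ^ 2 ≤ (1 - √s) ^ 2 := by nlinarith
    nlinarith
  calc _ ≤ t ^ (ν.re - 1) * Real.exp (-t - w / t) * t ^ k * Real.exp (-(t * s)) *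
        (‖(Complex.Gamma (ν + j + 1))⁻¹‖ * Real.exp (2 * (√s * t))) := by gcongr
    _ = ‖(Complex.Gamma (ν + j + 1))⁻¹‖ * ((t ^ (ν.re - 1) * t ^ k) *
        (Real.exp (-t - w / t) * (Real.exp (-(t * s)) * Real.exp (2 * (√s * t))))) := by ring
    _ ≤ _ := by
      rw [momentBound, Real.rpow_add ht, Real.rpow_natCast]
      gcongr

lemma integrableOn_momentBound {ν : ℂ} (hν : 0 < ν.re) (k j : ℕ) {b : ℝ} (hb : b < 1) :
    IntegrableOn (momentBound ν k j b) (Ioi 0) := by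
  have hb1 : √b < 1 := by rw [Real.sqrt_lt' one_pos]; simpa using hb
  refine Integrable.const_mul (integrableOn_rpow_mul_exp_neg_mul_rpow ?_ one_pos ?_) _
  · have : (0 : ℝ) ≤ k := k.cast_nonneg
    linarith
  · have : 0 < 1 - √b := by linarith
    positivity

lemma aestronglyMeasurable_momentKernel {ν : ℂ} (hν : 0 < ν.re) (w : ℝ) (k j : ℕ) (s : ℝ) :
    AEStronglyMeasurable (momentKernel ν w k j s) (volume.restrict (Ioi 0)) := by
  have hj : 0 ≤ (ν + j).re := by simp; positivity
  have hc := continuous_reducedI hj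
  have h1 : Continuous fun t : ℝ => (t : ℂ) ^ k := by fun_prop
  have h2 : Continuous fun t : ℝ => (Real.exp (-(t * s)) : ℂ) := by fun_prop
  have h3 : Continuous fun t : ℝ => reducedI (ν + j) ((s : ℂ) * (t : ℂ) ^ 2) :=
    hc.comp (by fun_prop)
  exact (((aestronglyMeasurable_reducedKWeight ν w).mul h1.aestronglyMeasurable).mul
    h2.aestronglyMeasurable).mul h3.aestronglyMeasurable

lemma integrableOn_momentKernel {ν : ℂ} {w : ℝ} (hν : 0 < ν.re) (hw : 0 ≤ w) (k j : ℕ) {s : ℝ}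
    (hs : 0 ≤ s) (hs1 : s < 1) :
    IntegrableOn (momentKernel ν w k j s) (Ioi 0) :=
  Integrable.mono' (integrableOn_momentBound hν k j hs1) (aestronglyMeasurable_momentKernel hν w k j s)
    ((ae_restrict_iff' measurableSet_Ioi).2 (ae_of_all _ fun _ ht =>
      norm_momentKernel_le hν hw k j hs le_rfl hs1 ht))

lemma hasDerivAt_momentKernel {ν : ℂ} (hν : 0 < ν.re) (w : ℝ) (k j : ℕ) (s t : ℝ) :
    HasDerivAt (fun s => momentKernel ν w k j s t)
      (-momentKernel ν w (k + 1) j s t + momentKernel ν w (k + 2) (j + 1) s t) s := by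
  have hj : 0 ≤ (ν + j).re := by simp; positivity
  have h1 : HasDerivAt (fun s : ℝ => Real.exp (-(t * s))) (Real.exp (-(t * s)) * (-t)) s := by
    simpa using ((hasDerivAt_id s).const_mul t).neg.exp
  have h2 : HasDerivAt (fun z : ℂ => reducedI (ν + j) (z * (t : ℂ) ^ 2))
      (reducedI (ν + j + 1) ((s : ℂ) * (t : ℂ) ^ 2) * (t : ℂ) ^ 2) (s : ℂ) := by
    have := (hasDerivAt_reducedI hj ((s : ℂ) * (t : ℂ) ^ 2)).comp (s : ℂ)
      ((hasDerivAt_id (s : ℂ)).mul_const ((t : ℂ) ^ 2))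
    simpa [Function.comp_def] using this
  have h3 := (h1.ofReal_comp.const_mul (reducedKWeight ν w t * (t : ℂ) ^ k)).mul h2.comp_ofReal
  refine h3.congr_deriv ?_
  simp only [momentKernel]
  push_cast
  rw [show ν + ((j : ℂ) + 1) = ν + j + 1 by ring]
  ring

lemma continuousOn_momentIntegral {ν : ℂ} {w : ℝ} (hν : 0 < ν.re) (hw : 0 ≤ w) (k j : ℕ) {b : ℝ}
    (hb : b < 1) :
    ContinuousOn (momentIntegral ν w k j) (Icc 0 b) :=
  continuousOn_of_dominated (fun s _ => aestronglyMeasurable_momentKernel hν w k j s)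
    (fun _ hs => (ae_restrict_iff' measurableSet_Ioi).2 (ae_of_all _ fun _ ht =>
      norm_momentKernel_le hν hw k j hs.1 hs.2 hb ht)) (integrableOn_momentBound hν k j hb)
    (ae_of_all _ fun t s _ => (hasDerivAt_momentKernel hν w k j s t).continuousAt.continuousWithinAt)

lemma hasDerivAt_momentIntegral {ν : ℂ} {w : ℝ} (hν : 0 < ν.re) (hw : 0 ≤ w) (k j : ℕ) {s : ℝ}
    (hs : s ∈ Ioo (0 : ℝ) 1) :
    HasDerivAt (momentIntegral ν w k j)
      (-momentIntegral ν w (k + 1) j s + momentIntegral ν w (k + 2) (j + 1) s) s := by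
  obtain ⟨b, hsb, hb⟩ := exists_between hs.2
  have key := hasDerivAt_integral_of_dominated_loc_of_deriv_le (μ := volume.restrict (Ioi (0 : ℝ)))
    (F := momentKernel ν w k j)
    (F' := fun s t => -momentKernel ν w (k + 1) j s t + momentKernel ν w (k + 2) (j + 1) s t)
    (x₀ := s) (s := Ioo 0 b)
    (bound := fun t => momentBound ν (k + 1) j b t + momentBound ν (k + 2) (j + 1) b t)
    (Ioo_mem_nhds hs.1 hsb)
    (Eventually.of_forall fun s => aestronglyMeasurable_momentKernel hν w k j s)
    (integrableOn_momentKernel hν hw k j hs.1.le hs.2)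
    ((aestronglyMeasurable_momentKernel hν w _ _ s).neg.add (aestronglyMeasurable_momentKernel hν w _ _ s))
    ((ae_restrict_iff' measurableSet_Ioi).2 (ae_of_all _ fun t (ht : 0 < t) v hv => by
      refine (norm_add_le _ _).trans ?_
      rw [norm_neg]
      exact add_le_add (norm_momentKernel_le hν hw _ _ hv.1.le hv.2.le hb ht)
        (norm_momentKernel_le hν hw _ _ hv.1.le hv.2.le hb ht)))
    ((integrableOn_momentBound hν _ _ hb).add (integrableOn_momentBound hν _ _ hb))
    (ae_of_all _ fun t v _ => hasDerivAt_momentKernel hν w k j v t)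
  refine key.2.congr_deriv ?_
  have i1 := integrableOn_momentKernel hν hw (k + 1) j hs.1.le hs.2
  have i2 := integrableOn_momentKernel hν hw (k + 2) (j + 1) hs.1.le hs.2
  have e := integral_add i1.neg i2
  simp only [Pi.neg_apply] at e
  rw [e, integral_neg]
  rfl

lemma momentIntegral_recurrence {ν : ℂ} {w : ℝ} (hν : 0 < ν.re) (hw : 0 ≤ w) {s : ℝ} (hs : 0 ≤ s)
    (hs1 : s < 1) :
    s * momentIntegral ν w 4 2 s + (ν + 1) * momentIntegral ν w 2 1 s = momentIntegral ν w 2 0 s := by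
  simp only [momentIntegral]
  rw [← integral_const_mul, ← integral_const_mul, ← integral_add
    ((integrableOn_momentKernel hν hw 4 2 hs hs1).const_mul _)
    ((integrableOn_momentKernel hν hw 2 1 hs hs1).const_mul _)]
  congr 1
  ext t
  have r := reducedI_recurrence hν.le ((s : ℂ) * (t : ℂ) ^ 2)
  simp only [momentKernel, Nat.cast_ofNat, Nat.cast_one, Nat.cast_zero, add_zero]
  linear_combination reducedKWeight ν w t * (t : ℂ) ^ 2 * (Real.exp (-(t * s)) : ℂ) * r

lemma reducedKWeight_add_natCast (ν : ℂ) (w : ℝ) (k : ℕ) {t : ℝ} (ht : 0 < t) :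
    reducedKWeight (ν + k) w t = reducedKWeight ν w t * (t : ℂ) ^ k := by
  have ht' : (t : ℂ) ≠ 0 := by exact_mod_cast ht.ne'
  rw [reducedKWeight, reducedKWeight, show ν + k - 1 = ν - 1 + k by ring, Complex.cpow_add _ _ ht',
    Complex.cpow_natCast]
  ring

lemma momentIntegral_by_parts {ν : ℂ} {w : ℝ} (hν : 0 < ν.re) (hw : 0 ≤ w) {s : ℝ} (hs : 0 ≤ s)
    (hs1 : s < 1) :
    (1 + s) * momentIntegral ν w 2 0 s - 2 * s * momentIntegral ν w 3 1 s -
      (ν + 1) * momentIntegral ν w 1 0 s - w * momentIntegral ν w 0 0 s = 0 := by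
  have hint := fun k j => integrableOn_momentKernel hν hw k j hs hs1
  have hd : ∀ t ∈ Ioi (0 : ℝ), HasDerivAt (fun t => -momentKernel ν w 2 0 s t)
      ((1 + s) * momentKernel ν w 2 0 s t - 2 * s * momentKernel ν w 3 1 s t -
      (ν + 1) * momentKernel ν w 1 0 s t - w * momentKernel ν w 0 0 s t) t := by
    intro t (ht : 0 < t)
    have e : (fun t => -momentKernel ν w 2 0 s t) =ᶠ[nhds t] fun t =>
        -(reducedKWeight (ν + 1 + 1) w t * ((Real.exp (-(t * s)) : ℂ) *
          reducedI ν ((s : ℂ) * (t : ℂ) ^ 2))) := by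
      filter_upwards [Ioi_mem_nhds ht] with t ht
      have := reducedKWeight_add_natCast ν w 2 ht
      rw [show ν + 1 + 1 = ν + (2 : ℕ) by push_cast; ring, this]
      simp only [momentKernel, Nat.cast_zero, add_zero]
      ring
    refine HasDerivAt.congr_of_eventuallyEq ?_ e
    have h1 : HasDerivAt (fun t : ℝ => Real.exp (-(t * s))) (Real.exp (-(t * s)) * (-s)) t := by
      simpa using ((hasDerivAt_id t).mul_const s).neg.exp
    have h2 : HasDerivAt (fun z : ℂ => reducedI ν ((s : ℂ) * z ^ 2))
        (reducedI (ν + 1) ((s : ℂ) * (t : ℂ) ^ 2) * ((s : ℂ) * (2 * t))) (t : ℂ) := by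
      have := (hasDerivAt_reducedI hν.le ((s : ℂ) * (t : ℂ) ^ 2)).comp (t : ℂ)
        ((hasDerivAt_pow 2 (t : ℂ)).const_mul (s : ℂ))
      simpa [Function.comp_def] using this
    have h3 := ((hasDerivAt_reducedKWeight (ν + 1) w ht).mul
      (h1.ofReal_comp.mul h2.comp_ofReal)).neg
    refine h3.congr_deriv ?_
    have k2 := reducedKWeight_add_natCast ν w 2 ht
    have k1 := reducedKWeight_add_natCast ν w 1 ht
    simp only [Nat.cast_one, Nat.cast_ofNat] at k1 k2
    simp only [add_sub_cancel_right, Pi.mul_apply]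
    rw [show ν + 1 + 1 = ν + 2 by ring, k2, k1]
    simp only [momentKernel, Nat.cast_zero, Nat.cast_one, add_zero]
    push_cast
    ring
  have i1 := (hint 2 0).const_mul (1 + s : ℂ)
  have i2 := (hint 3 1).const_mul (2 * s : ℂ)
  have i3 := (hint 1 0).const_mul (ν + 1 : ℂ)
  have i4 := (hint 0 0).const_mul (w : ℂ)
  have h0 : Tendsto (fun t => -momentKernel ν w 2 0 s t) (nhdsWithin 0 (Ioi 0)) (nhds 0) := by
    have hc : Continuous fun t : ℝ => (Real.exp (-(t * s)) : ℂ) * reducedI ν ((s : ℂ) * (t : ℂ) ^ 2) := by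
      refine Continuous.mul (by fun_prop) ((continuous_reducedI hν.le).comp (by fun_prop))
    have hk := tendsto_reducedKWeight_zero (ν := ν + (2 : ℕ)) (w := w) (Or.inr ⟨hw, by simp; linarith⟩)
    have := (hk.mul ((hc.tendsto 0).mono_left nhdsWithin_le_nhds)).neg
    rw [zero_mul, neg_zero] at this
    refine this.congr' (eventually_nhdsWithin_of_forall fun t ht => ?_)
    rw [reducedKWeight_add_natCast ν w 2 ht]
    simp only [momentKernel, Nat.cast_zero, add_zero]
    ring
  have hi := ((i1.sub i2).sub i3).sub i4
  have := integral_Ioi_deriv_eq_zero hd hi h0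
    (tendsto_zero_of_hasDerivAt_of_integrableOn_Ioi hd hi (hint 2 0).neg)
  have e := integral_sub ((i1.sub i2).sub i3) i4
  have e2 := integral_sub (i1.sub i2) i3
  simp only [Pi.sub_apply] at e e2
  rw [e, e2, integral_sub i1 i2, integral_const_mul, integral_const_mul, integral_const_mul,
    integral_const_mul] at this
  exact this

/-- A weighted integral of `reducedI` factors as `reducedI` times `reducedK`. -/
lemma momentIntegral_eq_mul {ν : ℂ} {w : ℝ} (hν : 0 < ν.re) (hw : 0 ≤ w) {s : ℝ} (hs : 0 ≤ s) (hs1 : s < 1) :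
    momentIntegral ν w 0 0 s = reducedI ν ((s * w : ℝ) : ℂ) * reducedK ν w := by
  have hν1 : 0 ≤ (ν + 1).re := by simp; linarith
  set κ := reducedK ν w
  set R : ℝ → ℂ := fun s => reducedI ν ((s * w : ℝ) : ℂ) * κ
  set R' : ℝ → ℂ := fun s => w * reducedI (ν + 1) ((s * w : ℝ) : ℂ) * κ
  set L' : ℝ → ℂ := fun s => -momentIntegral ν w 1 0 s + momentIntegral ν w 2 1 s
  set D : ℝ → ℂ := fun s => momentIntegral ν w 0 0 s - R s with hD
  set P : ℝ → ℂ := fun s => s * (L' s - R' s) + ν * D s with hP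
  have hRI : ∀ {μ : ℂ}, 0 ≤ μ.re → ∀ s : ℝ, HasDerivAt (fun s : ℝ => reducedI μ ((s * w : ℝ) : ℂ))
      (reducedI (μ + 1) ((s * w : ℝ) : ℂ) * w) s := by
    intro μ hμ s
    have h := (hasDerivAt_reducedI hμ ((s : ℂ) * w)).comp (s : ℂ)
      ((hasDerivAt_id (s : ℂ)).mul_const (w : ℂ))
    have := h.comp_ofReal
    simpa [Function.comp_def] using this
  have hDd : ∀ s ∈ Ioo (0 : ℝ) 1, HasDerivAt D (L' s - R' s) s := by
    intro s hs
    have h1 := (hasDerivAt_momentIntegral hν hw 0 0 hs).sub ((hRI hν.le s).mul_const κ)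
    refine h1.congr_deriv ?_
    simp only [L', R']
    ring
  have hPd : ∀ s ∈ Ioo (0 : ℝ) 1, HasDerivAt P (w * D s) s := by
    intro s hs
    have h1 := ((hasDerivAt_momentIntegral hν hw 1 0 hs).neg.add
      (hasDerivAt_momentIntegral hν hw 2 1 hs)).sub (((hRI hν1 s).const_mul (w : ℂ)).mul_const κ)
    have h2 := ((Complex.ofRealCLM.hasDerivAt (x := s)).mul h1).add ((hDd s hs).const_mul ν)
    refine h2.congr_deriv ?_
    have r1 := momentIntegral_recurrence hν hw hs.1.le hs.2
    have r2 := momentIntegral_by_parts hν hw hs.1.le hs.2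
    have r3 := reducedI_recurrence hν.le ((s * w : ℝ) : ℂ)
    simp only [Complex.ofRealCLM_apply, Complex.ofReal_one, Pi.sub_apply, Pi.add_apply, Pi.neg_apply,
      hD, L', R', R]
    norm_num
    rw [show ν + 1 + 1 = ν + 2 by ring]
    push_cast at r3
    linear_combination r1 + r2 - w * κ * r3
  obtain ⟨b, hsb, hb⟩ := exists_between hs1
  have hb0 : 0 < b := hs.trans_lt hsb
  have hsub : Ioo 0 b ⊆ Ioo (0 : ℝ) 1 := Ioo_subset_Ioo_right hb.le
  have hRc : ∀ {μ : ℂ}, 0 ≤ μ.re → Continuous (fun s : ℝ => reducedI μ ((s * w : ℝ) : ℂ)) :=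
    fun hμ => (continuous_reducedI hμ).comp (by fun_prop)
  have hDc : ContinuousOn D (Icc 0 b) :=
    (continuousOn_momentIntegral hν hw 0 0 hb).sub ((hRc hν.le).mul continuous_const).continuousOn
  have hPc : ContinuousOn P (Icc 0 b) := by
    refine ContinuousOn.add (ContinuousOn.mul Complex.continuous_ofReal.continuousOn
      (ContinuousOn.sub ?_ ?_)) (continuousOn_const.mul hDc)
    · exact (continuousOn_momentIntegral hν hw 1 0 hb).neg.add (continuousOn_momentIntegral hν hw 2 1 hb)
    · exact ((continuous_const.mul (hRc hν1)).mul continuous_const).continuousOn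
  have hD0 : D 0 = 0 := by
    simp only [hD, R, κ, momentIntegral, momentKernel, reducedK]
    rw [← integral_const_mul, sub_eq_zero]
    congr 1
    ext t
    simp [mul_comm]
  have hP0 : P 0 = 0 := by simp [hP, hD0]
  set a := ν.re
  set l : ℝ := 2 * w / a + 1 with hl
  have hl0 : 0 < l := by positivity
  obtain ⟨m, hm, hmax⟩ := isCompact_Icc.exists_isMaxOn (nonempty_Icc.2 hb0.le)
    (f := fun σ => ‖D σ‖ * Real.exp (-(l * σ))) (hDc.norm.mul (by fun_prop))
  set M : ℝ := ‖D m‖ * Real.exp (-(l * m)) with hM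
  have hM0 : 0 ≤ M := by positivity
  have hDM : ∀ σ ∈ Icc 0 b, ‖D σ‖ ≤ M * Real.exp (l * σ) := by
    intro σ hσ
    have : ‖D σ‖ * Real.exp (-(l * σ)) ≤ M := hmax hσ
    rw [Real.exp_neg] at this
    rwa [← div_eq_mul_inv, div_le_iff₀ (Real.exp_pos _)] at this
  have hexpd : ∀ σ : ℝ, HasDerivAt (fun σ => Real.exp (l * σ)) (Real.exp (l * σ) * l) σ := by
    intro σ
    simpa using ((hasDerivAt_id σ).const_mul l).exp
  have hPM : ∀ σ ∈ Icc 0 b, ‖P σ‖ ≤ w * M / l * Real.exp (l * σ) := by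
    intro σ hσ
    refine norm_le_of_norm_deriv_le_boundary hPc (fun x hx => hPd x (hsub hx)) hP0
      (B := fun σ => w * M / l * Real.exp (l * σ)) (B' := fun σ => w * M / l * (Real.exp (l * σ) * l))
      (by fun_prop) (fun x _ => (hexpd x).const_mul _) (by positivity) ?_ hσ
    intro x hx
    rw [norm_mul, Complex.norm_real, Real.norm_of_nonneg hw]
    calc w * ‖D x‖ ≤ w * (M * Real.exp (l * x)) := by
          gcongr; exact hDM x (Ioo_subset_Icc_self hx)
      _ = _ := by field_simp
  have hDM2 : ∀ σ ∈ Icc 0 b, ‖(σ : ℂ) ^ ν * D σ‖ ≤ σ ^ a * (w * M / (l * a) * Real.exp (l * σ)) := by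
    intro σ hσ
    refine norm_le_of_norm_deriv_le_boundary (f := fun σ : ℝ => (σ : ℂ) ^ ν * D σ)
      (f' := fun σ => (σ : ℂ) ^ (ν - 1) * P σ)
      (B := fun σ => σ ^ a * (w * M / (l * a) * Real.exp (l * σ)))
      (B' := fun σ => a * σ ^ (a - 1) * (w * M / (l * a) * Real.exp (l * σ)) +
        σ ^ a * (w * M / (l * a) * (Real.exp (l * σ) * l))) ?_ ?_ ?_ ?_ ?_ ?_ ?_ hσ
    · exact (Complex.continuous_ofReal_cpow_const hν).continuousOn.mul hDc
    · intro x hx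
      have hx0 : (x : ℂ) ≠ 0 := by exact_mod_cast hx.1.ne'
      refine ((hasDerivAt_ofReal_cpow hx.1 ν).mul (hDd x (hsub hx))).congr_deriv ?_
      simp only [hP]
      rw [Complex.cpow_sub _ _ hx0, Complex.cpow_one]
      field_simp
      ring
    · simp [hD0]
    · exact ((Real.continuous_rpow_const hν.le).mul (by fun_prop)).continuousOn
    · intro x hx
      exact (Real.hasDerivAt_rpow_const (Or.inl hx.1.ne')).mul ((hexpd x).const_mul _)
    · simp [Real.zero_rpow hν.ne']
    · intro x hx
      have hx0 : 0 < x := hx.1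
      rw [norm_mul, Complex.norm_cpow_eq_rpow_re_of_pos hx0, Complex.sub_re, Complex.one_re]
      have h1 : 0 ≤ x ^ a * (w * M / (l * a) * (Real.exp (l * x) * l)) := by positivity
      have h2 : a * x ^ (a - 1) * (w * M / (l * a) * Real.exp (l * x)) =
          x ^ (a - 1) * (w * M / l * Real.exp (l * x)) := by
        have : a ≠ 0 := hν.ne'
        field_simp
      have h3 : x ^ (a - 1) * ‖P x‖ ≤ x ^ (a - 1) * (w * M / l * Real.exp (l * x)) := by
        gcongr
        exact hPM x (Ioo_subset_Icc_self hx)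
      linarith
  have hMz : M = 0 := by
    rcases hm.1.eq_or_lt with h | h
    · rw [hM, ← h, hD0]; simp
    · have h1 := hDM2 m hm
      rw [norm_mul, Complex.norm_cpow_eq_rpow_re_of_pos h] at h1
      have h2 := le_of_mul_le_mul_left h1 (Real.rpow_pos_of_pos h a)
      have h3 : M ≤ w * M / (l * a) := by
        have e : Real.exp (l * m) * Real.exp (-(l * m)) = 1 := by rw [← Real.exp_add]; simp
        calc M ≤ w * M / (l * a) * Real.exp (l * m) * Real.exp (-(l * m)) := by rw [hM] at h2 ⊢; gcongr
          _ = _ := by rw [mul_assoc, e, mul_one]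
      have h4 : l * a = 2 * w + a := by
        have : a ≠ 0 := hν.ne'
        rw [hl]; field_simp
      rw [h4, le_div_iff₀ (by positivity)] at h3
      nlinarith
  have := hDM s ⟨hs, hsb.le⟩
  rw [hMz, zero_mul, norm_le_zero_iff, hD, sub_eq_zero] at this
  exact this

/-- The function `∑ (-v)ⁿ / n!²`, for which the Bessel function `J₀` is `J₀(z) = reducedJ (z²/4)`. -/
noncomputable def reducedJ (v : ℝ) : ℝ := (reducedI 0 ((-v : ℝ) : ℂ)).re

/-- The derivative of `reducedJ`, up to sign. -/
noncomputable def reducedJOne (v : ℝ) : ℝ := (reducedI 1 ((-v : ℝ) : ℂ)).re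

lemma continuous_reducedJ : Continuous reducedJ :=
  Complex.continuous_re.comp ((continuous_reducedI (by simp)).comp (by fun_prop))

lemma reducedJ_zero : reducedJ 0 = 1 := by
  simp [reducedJ, reducedI_zero]

lemma hasDerivAt_re_reducedI_neg {ν : ℂ} (hν : 0 ≤ ν.re) (v : ℝ) :
    HasDerivAt (fun v : ℝ => (reducedI ν ((-v : ℝ) : ℂ)).re) (-(reducedI (ν + 1) ((-v : ℝ) : ℂ)).re) v := by
  have h := ((hasDerivAt_reducedI hν (-(v : ℂ))).comp (v : ℂ) (hasDerivAt_neg (v : ℂ))).real_of_complex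
  simpa [Function.comp_def] using h

lemma hasDerivAt_reducedJ (v : ℝ) : HasDerivAt reducedJ (-reducedJOne v) v := by
  refine (hasDerivAt_re_reducedI_neg (ν := 0) (by simp) v).congr_deriv ?_
  rw [zero_add, reducedJOne]

lemma hasDerivAt_reducedJOne {v : ℝ} (hv : v ≠ 0) :
    HasDerivAt reducedJOne ((reducedJ v - reducedJOne v) / v) v := by
  have h := hasDerivAt_re_reducedI_neg (ν := 1) (by simp) v
  refine h.congr_deriv ?_
  have r := congrArg Complex.re (reducedI_recurrence (ν := 0) (by simp) ((-v : ℝ) : ℂ))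
  rw [Complex.add_re, Complex.re_ofReal_mul] at r
  simp only [zero_add, one_mul] at r
  rw [one_add_one_eq_two, eq_div_iff hv, reducedJ, reducedJOne]
  linarith

lemma continuous_reducedJOne : Continuous reducedJOne :=
  Complex.continuous_re.comp ((continuous_reducedI (by simp)).comp (by fun_prop))

lemma reducedJ_sq_add_le_one {v : ℝ} (hv : 0 ≤ v) : reducedJ v ^ 2 + v * reducedJOne v ^ 2 ≤ 1 := by
  have hd : ∀ v : ℝ, 0 < v → HasDerivAt (fun v => reducedJ v ^ 2 + v * reducedJOne v ^ 2)
      (-reducedJOne v ^ 2) v := by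
    intro v hv
    have h := ((hasDerivAt_reducedJ v).pow 2).add ((hasDerivAt_id v).mul
      ((hasDerivAt_reducedJOne hv.ne').pow 2))
    refine h.congr_deriv ?_
    simp only [id]
    field_simp
    simp
    ring
  have hanti : AntitoneOn (fun v => reducedJ v ^ 2 + v * reducedJOne v ^ 2) (Ici 0) := by
    refine antitoneOn_of_deriv_nonpos (convex_Ici 0) ?_ ?_ ?_
    · have := continuous_reducedJ
      have := continuous_reducedJOne
      fun_prop
    · intro v hv
      rw [interior_Ici] at hv
      exact (hd v hv).differentiableAt.differentiableWithinAt
    · intro v hv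
      rw [interior_Ici] at hv
      rw [(hd v hv).deriv]
      nlinarith [sq_nonneg (reducedJOne v)]
  have h := hanti (mem_Ici.2 le_rfl) hv hv
  simpa only [reducedJ_zero, zero_mul, add_zero, one_pow] using h

lemma abs_reducedJ_le_one {v : ℝ} (hv : 0 ≤ v) : |reducedJ v| ≤ 1 := by
  rw [← sq_le_one_iff_abs_le_one]
  nlinarith [mul_nonneg hv (sq_nonneg (reducedJOne v)), reducedJ_sq_add_le_one hv]

lemma mul_reducedJ_sq_le {z : ℝ} (hz : 0 < z) : z * reducedJ (z ^ 2 / 4) ^ 2 ≤ 2 := by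
  set J : ℝ → ℝ := fun z => reducedJ (z ^ 2 / 4) with hJ
  set K : ℝ → ℝ := fun z => z / 2 * reducedJOne (z ^ 2 / 4) with hK
  have hq : ∀ z : ℝ, HasDerivAt (fun z : ℝ => z ^ 2 / 4) (z / 2) z := by
    intro z
    refine ((hasDerivAt_pow 2 z).div_const 4).congr_deriv ?_
    ring
  have hJd : ∀ z : ℝ, HasDerivAt J (-K z) z := by
    intro z
    refine ((hasDerivAt_reducedJ (z ^ 2 / 4)).comp z (hq z)).congr_deriv ?_
    simp only [hK]; ring
  have hKd : ∀ z : ℝ, 0 < z → HasDerivAt K (J z - K z / z) z := by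
    intro z hz
    refine (((hasDerivAt_id z).div_const 2).mul
      ((hasDerivAt_reducedJOne (by positivity : z ^ 2 / 4 ≠ 0)).comp z (hq z))).congr_deriv ?_
    simp only [hK, hJ, id, Function.comp]
    field_simp
    ring
  set W : ℝ → ℝ := fun z => z * K z ^ 2 - J z * K z + J z ^ 2 * (2 * z)⁻¹ + z * J z ^ 2 with hW
  have hWd : ∀ z : ℝ, 0 < z → HasDerivAt W (-J z ^ 2 / (2 * z ^ 2)) z := by
    intro z hz
    have h2 : HasDerivAt (fun z : ℝ => (2 * z)⁻¹) (-2 / (2 * z) ^ 2) z := by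
      refine (((hasDerivAt_id z).const_mul 2).fun_inv (by simpa using hz.ne')).congr_deriv ?_
      simp
    have h := ((((hasDerivAt_id z).mul ((hKd z hz).pow 2)).sub ((hJd z).mul (hKd z hz))).add
      (((hJd z).pow 2).mul h2)).add ((hasDerivAt_id z).mul ((hJd z).pow 2))
    refine h.congr_deriv ?_
    simp only [id]
    field_simp
    simp
    ring
  have hanti : AntitoneOn W (Ici 1) := by
    refine antitoneOn_of_deriv_nonpos (convex_Ici 1) ?_ ?_ ?_
    · exact fun z hz => (hWd z (one_pos.trans_le hz)).continuousAt.continuousWithinAt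
    · intro v hv
      rw [interior_Ici] at hv
      exact (hWd v (one_pos.trans hv)).differentiableAt.differentiableWithinAt
    · intro v hv
      rw [interior_Ici] at hv
      rw [(hWd v (one_pos.trans hv)).deriv, neg_div]
      have := div_nonneg (sq_nonneg (J v)) (by positivity : 0 ≤ 2 * v ^ 2)
      linarith
  rcases le_total z 1 with h | h
  · have := abs_reducedJ_le_one (by positivity : 0 ≤ z ^ 2 / 4)
    have : reducedJ (z ^ 2 / 4) ^ 2 ≤ 1 := (sq_le_one_iff_abs_le_one _).2 this
    nlinarith [sq_nonneg (reducedJ (z ^ 2 / 4))]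
  · have hW1 : W 1 ≤ 2 := by
      have := reducedJ_sq_add_le_one (by positivity : 0 ≤ (1 : ℝ) ^ 2 / 4)
      simp only [hW, hJ, hK]
      nlinarith [sq_nonneg (reducedJ (1 ^ 2 / 4) + 1 / 2 * reducedJOne (1 ^ 2 / 4))]
    refine le_trans ?_ ((hanti (mem_Ici.2 le_rfl) h h).trans hW1)
    have e : W z = z * J z ^ 2 + (J z ^ 2 + (2 * z * K z - J z) ^ 2) / (4 * z) := by
      simp only [hW]
      field_simp
      ring
    rw [e]
    have : 0 ≤ (J z ^ 2 + (2 * z * K z - J z) ^ 2) / (4 * z) := by positivity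
    linarith

/-- The Laplace transform of `reducedJ (w v)`. -/
lemma integral_reducedJ_mul_exp {w t : ℝ} (hw : 0 ≤ w) (ht : 0 < t) :
    ∫ v in Ioi (0 : ℝ), reducedJ (w * v) * Real.exp (-(t * v)) = Real.exp (-w / t) / t := by
  set F : ℕ → ℝ → ℝ := fun n v => ((n.factorial : ℝ)⁻¹ * (n.factorial : ℝ)⁻¹ * (-w) ^ n) *
    (v ^ ((n + 1 : ℝ) - 1) * Real.exp (-(t * v))) with hF
  have hmom : ∀ n : ℕ, ∫ v in Ioi (0 : ℝ), v ^ ((n + 1 : ℝ) - 1) * Real.exp (-(t * v)) =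
      n.factorial * (1 / t) ^ (n + 1) := by
    intro n
    rw [Real.integral_rpow_mul_exp_neg_mul_Ioi (by positivity) ht, Real.Gamma_nat_eq_factorial, mul_comm]
    norm_cast
  have hint : ∀ n : ℕ, IntegrableOn (fun v : ℝ => v ^ ((n + 1 : ℝ) - 1) * Real.exp (-(t * v))) (Ioi 0) := by
    intro n
    have := integrableOn_rpow_mul_exp_neg_mul_rpow (s := (n + 1 : ℝ) - 1) (p := 1) (b := t)
      (by have : (0 : ℝ) ≤ n := n.cast_nonneg
          linarith) one_pos ht
    simpa using this
  have hnorm : ∀ n : ℕ, ∫ v in Ioi (0 : ℝ), ‖F n v‖ = (w / t) ^ n / n.factorial * (1 / t) := by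
    intro n
    have : ∀ v ∈ Ioi (0 : ℝ), ‖F n v‖ = ((n.factorial : ℝ)⁻¹ * (n.factorial : ℝ)⁻¹ * w ^ n) *
        (v ^ ((n + 1 : ℝ) - 1) * Real.exp (-(t * v))) := by
      intro v (hv : 0 < v)
      simp only [hF, norm_mul, norm_inv, norm_pow, norm_neg, Real.norm_natCast, Real.norm_of_nonneg hw]
      rw [Real.norm_of_nonneg (Real.exp_pos _).le, Real.norm_of_nonneg (by positivity)]
    rw [setIntegral_congr_fun measurableSet_Ioi this, integral_const_mul, hmom]
    have : (n.factorial : ℝ) ≠ 0 := by positivity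
    rw [div_pow, one_pow, div_pow, pow_succ]
    field_simp
  have hs := hasSum_integral_of_summable_integral_norm (F := F) (μ := volume.restrict (Ioi (0 : ℝ)))
    (fun n => (hint n).const_mul _) (by
      simp only [hnorm]
      exact (Real.summable_pow_div_factorial _).mul_right _)
  have e1 : ∀ n : ℕ, ∫ v in Ioi (0 : ℝ), F n v = (-w / t) ^ n / n.factorial * (1 / t) := by
    intro n
    simp only [hF]
    rw [integral_const_mul, hmom]
    have : (n.factorial : ℝ) ≠ 0 := by positivity
    rw [div_pow, one_pow, div_pow, pow_succ]
    field_simp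
  simp only [e1] at hs
  have e2 : HasSum (fun n : ℕ => (-w / t) ^ n / n.factorial * (1 / t)) (Real.exp (-w / t) * (1 / t)) := by
    rw [Real.exp_eq_exp_ℝ]
    exact (NormedSpace.expSeries_div_hasSum_exp (-w / t)).mul_right _
  have e3 := hs.unique e2
  rw [← mul_one_div, ← e3]
  refine setIntegral_congr_fun measurableSet_Ioi fun v hv => ?_
  simp only [hF]
  have : reducedJ (w * v) = ∑' n : ℕ, ((n.factorial : ℝ)⁻¹ * (n.factorial : ℝ)⁻¹ * (-w) ^ n) * v ^ n := by
    rw [reducedJ, reducedI, ← Complex.ofReal_re (∑' n : ℕ, _), Complex.ofReal_tsum]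
    congr 2
    ext n
    rw [zero_add, Complex.Gamma_nat_eq_factorial]
    push_cast
    ring
  rw [this, ← tsum_mul_right]
  refine tsum_congr fun n => ?_
  rw [add_sub_cancel_right, Real.rpow_natCast]
  ring

/-- Increasing changes of variables on the half-line. -/
lemma image_Ioi_zero {φ : ℝ → ℝ} (hc : Continuous φ) (h0 : φ 0 = 0) (hm : StrictMonoOn φ (Ici 0))
    (htop : Tendsto φ atTop atTop) : φ '' Ioi 0 = Ioi 0 := by
  ext v
  constructor
  · rintro ⟨u, hu, rfl⟩
    have := hm (mem_Ici.2 le_rfl) (mem_Ici.2 (le_of_lt hu)) hu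
    rwa [h0] at this
  · intro (hv : 0 < v)
    obtain ⟨b, hb0, hb⟩ := ((htop.eventually_gt_atTop v).and (eventually_gt_atTop 0)).exists
    obtain ⟨u, hu, rfl⟩ := intermediate_value_Icc hb.le hc.continuousOn
      (show v ∈ Icc (φ 0) (φ b) from ⟨by rw [h0]; exact hv.le, hb0.le⟩)
    refine ⟨u, lt_of_le_of_ne hu.1 ?_, rfl⟩
    rintro rfl
    exact hv.ne' h0

lemma strictMonoOn_Ici_of_hasDerivAt_pos {φ φ' : ℝ → ℝ} (hc : Continuous φ)
    (hd : ∀ u, 0 < u → HasDerivAt φ (φ' u) u) (hp : ∀ u, 0 < u → 0 < φ' u) : StrictMonoOn φ (Ici 0) := by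
  refine strictMonoOn_of_deriv_pos (convex_Ici 0) hc.continuousOn fun u hu => ?_
  rw [interior_Ici] at hu
  rw [(hd u hu).deriv]
  exact hp u hu

lemma integral_Ioi_zero_eq_integral_deriv_smul {E : Type*} [NormedAddCommGroup E] [NormedSpace ℝ E]
    {φ φ' : ℝ → ℝ} (hc : Continuous φ) (h0 : φ 0 = 0)
    (hd : ∀ u, 0 < u → HasDerivAt φ (φ' u) u) (hp : ∀ u, 0 < u → 0 < φ' u)
    (htop : Tendsto φ atTop atTop) (g : ℝ → E) :
    ∫ v in Ioi (0 : ℝ), g v = ∫ u in Ioi (0 : ℝ), φ' u • g (φ u) := by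
  have hm := strictMonoOn_Ici_of_hasDerivAt_pos hc hd hp
  have h := integral_image_eq_integral_deriv_smul_of_monotoneOn (s := Ioi 0) measurableSet_Ioi
    (fun u hu => (hd u hu).hasDerivWithinAt) (hm.monotoneOn.mono Ioi_subset_Ici_self) g
  rwa [image_Ioi_zero hc h0 hm htop] at h

lemma integrableOn_Ioi_zero_iff_deriv_smul {E : Type*} [NormedAddCommGroup E] [NormedSpace ℝ E]
    {φ φ' : ℝ → ℝ} (hc : Continuous φ) (h0 : φ 0 = 0)
    (hd : ∀ u, 0 < u → HasDerivAt φ (φ' u) u) (hp : ∀ u, 0 < u → 0 < φ' u)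
    (htop : Tendsto φ atTop atTop) (g : ℝ → E) :
    IntegrableOn g (Ioi 0) ↔ IntegrableOn (fun u => φ' u • g (φ u)) (Ioi 0) := by
  have hm := strictMonoOn_Ici_of_hasDerivAt_pos hc hd hp
  have h := integrableOn_image_iff_integrableOn_abs_deriv_smul (s := Ioi 0) measurableSet_Ioi
    (fun u hu => (hd u hu).hasDerivWithinAt) (hm.injOn.mono Ioi_subset_Ici_self) g
  rw [image_Ioi_zero hc h0 hm htop] at h
  rw [h]
  refine integrableOn_congr_fun (fun u hu => ?_) measurableSet_Ioi
  simp only [abs_of_pos (hp u hu)]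

/-- The exponent `e^u + s e^{-u} - 1 - s`. -/
noncomputable def expShift (s u : ℝ) : ℝ := Real.exp u + s * Real.exp (-u) - 1 - s

lemma continuous_expShift (s : ℝ) : Continuous (expShift s) := by
  unfold expShift; fun_prop

lemma expShift_zero (s : ℝ) : expShift s 0 = 0 := by simp [expShift]

lemma hasDerivAt_expShift (s u : ℝ) :
    HasDerivAt (expShift s) (Real.exp u - s * Real.exp (-u)) u := by
  have h1 : HasDerivAt (fun u : ℝ => Real.exp (-u)) (-Real.exp (-u)) u := by
    simpa using (hasDerivAt_neg u).exp
  refine ((((Real.hasDerivAt_exp u).add (h1.const_mul s)).sub_const 1).sub_const s).congr_deriv ?_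
  ring

lemma deriv_expShift_pos {s u : ℝ} (hs : s ≤ 1) (hu : 0 < u) : 0 < Real.exp u - s * Real.exp (-u) := by
  have h1 : 1 < Real.exp u := Real.one_lt_exp_iff.2 hu
  have h2 : Real.exp (-u) < 1 := by rw [Real.exp_lt_one_iff]; linarith
  nlinarith [Real.exp_pos (-u)]

lemma expShift_nonneg {s u : ℝ} (hs : s ≤ 1) (hu : 0 < u) : 0 ≤ expShift s u := by
  have hm := strictMonoOn_Ici_of_hasDerivAt_pos (continuous_expShift s)
    (fun u _ => hasDerivAt_expShift s u) (fun u hu => deriv_expShift_pos hs hu)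
  have := hm (mem_Ici.2 le_rfl) (mem_Ici.2 hu.le) hu
  rw [expShift_zero] at this
  exact this.le

lemma tendsto_expShift {s : ℝ} (hs : 0 ≤ s) : Tendsto (expShift s) atTop atTop := by
  refine tendsto_atTop_mono (f := fun u => Real.exp u + (-1 - s)) (fun u => ?_)
    (tendsto_atTop_add_const_right _ _ Real.tendsto_exp_atTop)
  have := mul_nonneg hs (Real.exp_pos (-u)).le
  simp only [expShift]
  linarith

lemma integral_expShift_reducedJ {s w t : ℝ} (hs : 0 ≤ s) (hs1 : s ≤ 1) (hw : 0 ≤ w) (ht : 0 < t) :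
    ∫ u in Ioi (0 : ℝ), (Real.exp u - s * Real.exp (-u)) *
      (reducedJ (w * expShift s u) * Real.exp (-(t * expShift s u))) = Real.exp (-w / t) / t := by
  rw [← integral_reducedJ_mul_exp hw ht]
  exact (integral_Ioi_zero_eq_integral_deriv_smul (continuous_expShift s) (expShift_zero s)
    (fun u _ => hasDerivAt_expShift s u) (fun u hu => deriv_expShift_pos hs1 hu)
    (tendsto_expShift hs) (fun v => reducedJ (w * v) * Real.exp (-(t * v)))).symm

lemma integrableOn_expShift {s t : ℝ} (hs : 0 ≤ s) (hs1 : s ≤ 1) (ht : 0 < t) :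
    IntegrableOn (fun u => (Real.exp u - s * Real.exp (-u)) * Real.exp (-(t * expShift s u))) (Ioi 0) := by
  refine (integrableOn_Ioi_zero_iff_deriv_smul (continuous_expShift s) (expShift_zero s)
    (fun u _ => hasDerivAt_expShift s u) (fun u hu => deriv_expShift_pos hs1 hu)
    (tendsto_expShift hs) (fun v => Real.exp (-(t * v)))).1 ?_
  simpa using integrableOn_exp_mul_Ioi (neg_lt_zero.2 ht) 0

lemma momentIntegral_one_zero {ν : ℂ} (hν : 0 < ν.re) {s : ℝ} (hs : 0 < s) (hs1 : s < 1) :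
    (1 - s) * momentIntegral ν 0 1 0 s = 1 := by
  have hν0 : ν ≠ 0 := fun h => by simp [h] at hν
  have h00 : ∀ s ∈ Ioo (0 : ℝ) 1, momentIntegral ν 0 0 0 s = 1 / ν := by
    intro s hs
    rw [momentIntegral_eq_mul hν le_rfl hs.1.le hs.2, mul_zero, Complex.ofReal_zero, reducedI_zero,
      reducedK_zero hν, Complex.Gamma_add_one _ hν0]
    have := Complex.Gamma_ne_zero_of_re_pos hν
    field_simp
  have hder : -momentIntegral ν 0 1 0 s + momentIntegral ν 0 2 1 s = 0 := by
    refine (hasDerivAt_momentIntegral (k := 0) (j := 0) hν le_rfl ⟨hs, hs1⟩).unique ?_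
    refine (hasDerivAt_const s (1 / ν)).congr_of_eventuallyEq ?_
    filter_upwards [Ioo_mem_nhds hs hs1] with s hs using h00 s hs
  have hint := fun k j => integrableOn_momentKernel (w := 0) hν le_rfl k j hs.le hs1
  have hd : ∀ t ∈ Ioi (0 : ℝ), HasDerivAt (fun t => momentKernel ν 0 1 0 s t)
      (ν * momentKernel ν 0 0 0 s t - (1 + s) * momentKernel ν 0 1 0 s t +
        2 * s * momentKernel ν 0 2 1 s t) t := by
    intro t (ht : 0 < t)
    have e : (fun t => momentKernel ν 0 1 0 s t) =ᶠ[nhds t] fun t =>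
        reducedKWeight (ν + 1) 0 t * ((Real.exp (-(t * s)) : ℂ) *
          reducedI ν ((s : ℂ) * (t : ℂ) ^ 2)) := by
      filter_upwards [Ioi_mem_nhds ht] with t ht
      have := reducedKWeight_add_natCast ν 0 1 ht
      rw [Nat.cast_one] at this
      rw [this]
      simp only [momentKernel, Nat.cast_zero, add_zero]
      ring
    refine HasDerivAt.congr_of_eventuallyEq ?_ e
    have h1 : HasDerivAt (fun t : ℝ => Real.exp (-(t * s))) (Real.exp (-(t * s)) * (-s)) t := by
      simpa using ((hasDerivAt_id t).mul_const s).neg.exp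
    have h2 : HasDerivAt (fun z : ℂ => reducedI ν ((s : ℂ) * z ^ 2))
        (reducedI (ν + 1) ((s : ℂ) * (t : ℂ) ^ 2) * ((s : ℂ) * (2 * t))) (t : ℂ) := by
      have := (hasDerivAt_reducedI hν.le ((s : ℂ) * (t : ℂ) ^ 2)).comp (t : ℂ)
        ((hasDerivAt_pow 2 (t : ℂ)).const_mul (s : ℂ))
      simpa [Function.comp_def] using this
    have h3 := (hasDerivAt_reducedKWeight ν 0 ht).mul (h1.ofReal_comp.mul h2.comp_ofReal)
    refine h3.congr_deriv ?_
    have k1 := reducedKWeight_add_natCast ν 0 1 ht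
    simp only [Nat.cast_one] at k1
    simp only [Pi.mul_apply]
    rw [k1]
    simp only [momentKernel, Nat.cast_zero, Nat.cast_one, add_zero]
    push_cast
    ring
  have i1 := (hint 0 0).const_mul ν
  have i2 := (hint 1 0).const_mul (1 + s : ℂ)
  have i3 := (hint 2 1).const_mul (2 * s : ℂ)
  have h0 : Tendsto (fun t => momentKernel ν 0 1 0 s t) (nhdsWithin 0 (Ioi 0)) (nhds 0) := by
    have hc : Continuous fun t : ℝ => (Real.exp (-(t * s)) : ℂ) * reducedI ν ((s : ℂ) * (t : ℂ) ^ 2) := by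
      refine Continuous.mul (by fun_prop) ((continuous_reducedI hν.le).comp (by fun_prop))
    have hk := tendsto_reducedKWeight_zero (ν := ν + (1 : ℕ)) (w := 0) (Or.inr ⟨le_rfl, by simp; linarith⟩)
    have := hk.mul ((hc.tendsto 0).mono_left nhdsWithin_le_nhds)
    rw [zero_mul] at this
    refine this.congr' (eventually_nhdsWithin_of_forall fun t ht => ?_)
    rw [reducedKWeight_add_natCast ν 0 1 ht]
    simp only [momentKernel, Nat.cast_zero, add_zero]
    ring
  have hi := (i1.sub i2).add i3
  have := integral_Ioi_deriv_eq_zero hd hi h0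
    (tendsto_zero_of_hasDerivAt_of_integrableOn_Ioi hd hi (hint 1 0))
  have e := integral_add (i1.sub i2) i3
  simp only [Pi.sub_apply] at e
  rw [e, integral_sub i1 i2, integral_const_mul, integral_const_mul, integral_const_mul] at this
  change ν * momentIntegral ν 0 0 0 s - (1 + s) * momentIntegral ν 0 1 0 s +
    2 * s * momentIntegral ν 0 2 1 s = 0 at this
  rw [h00 s ⟨hs, hs1⟩, mul_one_div_cancel hν0] at this
  linear_combination -this + 2 * s * hder

lemma integral_momentKernel_mul_exp {ν : ℂ} (hν : 0 < ν.re) {s u : ℝ} (hs : 0 < s) (hs1 : s < 1)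
    (hu : 0 < u) : (Real.exp u - s * Real.exp (-u) : ℂ) *
      ∫ t in Ioi (0 : ℝ), momentKernel ν 0 1 0 s t * (Real.exp (-(t * expShift s u)) : ℂ) =
    Complex.exp (-(ν * u)) := by
  set l := Real.exp u with hl
  have hl0 : 0 < l := Real.exp_pos u
  have hl1 : 1 < l := Real.one_lt_exp_iff.2 hu
  have hle : Real.exp (-u) = l⁻¹ := Real.exp_neg u
  set σ := s / l ^ 2 with hσ
  have hσ0 : 0 < σ := by positivity
  have hσ1 : σ < 1 := by
    rw [hσ, div_lt_one (by positivity)]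
    nlinarith
  have key : ∀ t ∈ Ioi (0 : ℝ), momentKernel ν 0 1 0 s t * (Real.exp (-(t * expShift s u)) : ℂ) =
      Complex.exp (-(ν * u)) * momentKernel ν 0 1 0 σ (l * t) := by
    intro t (ht : 0 < t)
    have k1 := reducedKWeight_add_natCast ν 0 1 ht
    have k2 := reducedKWeight_add_natCast ν 0 1 (mul_pos hl0 ht)
    simp only [momentKernel, Nat.cast_zero, add_zero]
    rw [← k1, ← k2]
    have e1 : (σ : ℂ) * ((l * t : ℝ) : ℂ) ^ 2 = (s : ℂ) * (t : ℂ) ^ 2 := by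
      have : σ * (l * t) ^ 2 = s * t ^ 2 := by rw [hσ]; field_simp
      exact_mod_cast this
    rw [e1]
    simp only [reducedKWeight, Nat.cast_one, add_sub_cancel_right, zero_div, sub_zero]
    have e2 : ((l * t : ℝ) : ℂ) ^ ν = Complex.exp (ν * u) * (t : ℂ) ^ ν := by
      rw [Complex.ofReal_mul, Complex.mul_cpow_ofReal_nonneg hl0.le ht.le, hl,
        Complex.cpow_def_of_ne_zero (by exact_mod_cast (Real.exp_pos u).ne'), ← Complex.ofReal_log
        (Real.exp_pos u).le, Real.log_exp, mul_comm (u : ℂ)]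
    have e3 : Real.exp (-t) * Real.exp (-(t * s)) * Real.exp (-(t * expShift s u)) =
        Real.exp (-(l * t)) * Real.exp (-(l * t * σ)) := by
      rw [← Real.exp_add, ← Real.exp_add, ← Real.exp_add]
      congr 1
      rw [expShift, hle, ← hl, hσ]
      field_simp
      ring
    have e3' : (Real.exp (-t) : ℂ) * Real.exp (-(t * s)) * Real.exp (-(t * expShift s u)) =
        Real.exp (-(l * t)) * Real.exp (-(l * t * σ)) := by exact_mod_cast e3
    have e4 : Complex.exp (-(ν * u)) * Complex.exp (ν * u) = 1 := by
      rw [← Complex.exp_add]; simp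
    rw [e2]
    linear_combination (t : ℂ) ^ ν * reducedI ν (s * t ^ 2) * e3' -
      (t : ℂ) ^ ν * reducedI ν (s * t ^ 2) * (Real.exp (-(l * t)) * Real.exp (-(l * t * σ))) * e4
  rw [setIntegral_congr_fun measurableSet_Ioi key, integral_const_mul,
    integral_comp_mul_left_Ioi (fun t => momentKernel ν 0 1 0 σ t) 0 hl0, mul_zero]
  have h := momentIntegral_one_zero hν hσ0 hσ1
  rw [momentIntegral] at h
  rw [hle, Complex.real_smul]
  have hl' : (l : ℂ) ≠ 0 := by exact_mod_cast hl0.ne'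
  have e5 : ((l : ℂ) - s * ((l⁻¹ : ℝ) : ℂ)) * ((l⁻¹ : ℝ) : ℂ) = 1 - σ := by
    rw [hσ]
    push_cast
    field_simp
  linear_combination Complex.exp (-(ν * u)) * h +
    Complex.exp (-(ν * u)) * (∫ t in Ioi (0 : ℝ), momentKernel ν 0 1 0 σ t) * e5

lemma reducedI_mul_reducedK_eq_integral_of_lt {ν : ℂ} (hν : 0 < ν.re) {w s : ℝ} (hw : 0 ≤ w)
    (hs : 0 < s) (hs1 : s < 1) :
    reducedI ν ((s * w : ℝ) : ℂ) * reducedK ν w =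
      ∫ u in Ioi (0 : ℝ), (reducedJ (w * expShift s u) : ℂ) * Complex.exp (-(ν * u)) := by
  set F : ℝ → ℝ → ℂ := fun t u => momentKernel ν 0 1 0 s t * (((Real.exp u - s * Real.exp (-u)) *
      (reducedJ (w * expShift s u) * Real.exp (-(t * expShift s u))) : ℝ) : ℂ) with hF
  set G : ℝ × ℝ → ℂ := fun p => momentKernel ν 0 1 0 s p.1 * (((Real.exp p.2 - s * Real.exp (-p.2)) *
      Real.exp (-(p.1 * expShift s p.2)) : ℝ) : ℂ) with hG
  have hmk : ∀ t, 0 < t → momentKernel ν 0 1 0 s t = momentKernel ν 0 0 0 s t * t := by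
    intro t ht
    simp only [momentKernel]
    ring
  have hes := continuous_expShift s
  have hGi : Integrable G ((volume.restrict (Ioi 0)).prod (volume.restrict (Ioi 0))) := by
    have hm : AEStronglyMeasurable G ((volume.restrict (Ioi 0)).prod (volume.restrict (Ioi 0))) := by
      refine (aestronglyMeasurable_momentKernel hν 0 1 0 s).comp_fst.mul
        (Continuous.aestronglyMeasurable ?_)
      fun_prop
    rw [integrable_prod_iff hm]
    constructor
    · refine (ae_restrict_iff' measurableSet_Ioi).2 (ae_of_all _ fun t ht => ?_)
      exact ((integrableOn_expShift hs.le hs1.le ht).ofReal (𝕜 := ℂ)).const_mul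
        (momentKernel ν 0 1 0 s t)
    · refine (integrableOn_momentKernel hν (w := 0) le_rfl 0 0 hs.le hs1).norm.congr ?_
      refine (ae_restrict_iff' measurableSet_Ioi).2 (ae_of_all _ fun t (ht : 0 < t) => ?_)
      have e : ∀ u ∈ Ioi (0 : ℝ), ‖G (t, u)‖ = ‖momentKernel ν 0 1 0 s t‖ *
          ((Real.exp u - s * Real.exp (-u)) * (reducedJ (0 * expShift s u) *
            Real.exp (-(t * expShift s u)))) := by
        intro u hu
        have := deriv_expShift_pos hs1.le hu
        simp only [hG]
        rw [norm_mul, Complex.norm_real, Real.norm_of_nonneg (by positivity), zero_mul, reducedJ_zero,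
          one_mul]
      simp only
      rw [setIntegral_congr_fun measurableSet_Ioi e, integral_const_mul,
        integral_expShift_reducedJ hs.le hs1.le le_rfl ht, hmk t ht, norm_mul, Complex.norm_real,
        Real.norm_of_nonneg ht.le]
      simp
      field_simp
  have hFi : Integrable (Function.uncurry F) ((volume.restrict (Ioi 0)).prod (volume.restrict (Ioi 0))) := by
    have hJ : Continuous fun p : ℝ × ℝ => (reducedJ (w * expShift s p.2) : ℂ) :=
      Complex.continuous_ofReal.comp (continuous_reducedJ.comp (by fun_prop))
    refine Integrable.mono hGi ?_ ?_
    · refine (hGi.aestronglyMeasurable.mul hJ.aestronglyMeasurable).congr (ae_of_all _ fun p => ?_)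
      simp only [hG, Function.uncurry, hF, Pi.mul_apply]
      push_cast
      ring
    · rw [Measure.prod_restrict]
      refine (ae_restrict_iff' (measurableSet_Ioi.prod measurableSet_Ioi)).2 (ae_of_all _ fun p hp => ?_)
      have e : Function.uncurry F p = G p * (reducedJ (w * expShift s p.2) : ℂ) := by
        simp only [hG, Function.uncurry, hF]
        push_cast
        ring
      rw [e, norm_mul, Complex.norm_real]
      exact mul_le_of_le_one_right (norm_nonneg _)
        (abs_reducedJ_le_one (mul_nonneg hw (expShift_nonneg hs1.le hp.2)))
  have hswap := integral_integral_swap hFi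
  rw [← momentIntegral_eq_mul hν hw hs.le hs1, momentIntegral]
  have e1 : ∀ t ∈ Ioi (0 : ℝ), momentKernel ν w 0 0 s t = ∫ u in Ioi (0 : ℝ), F t u := by
    intro t (ht : 0 < t)
    simp only [hF]
    rw [integral_const_mul, integral_complex_ofReal, integral_expShift_reducedJ hs.le hs1.le hw ht, hmk t ht]
    simp only [momentKernel, reducedKWeight]
    have ht' : (t : ℂ) ≠ 0 := by exact_mod_cast ht.ne'
    have : Real.exp (-t - w / t) = Real.exp (-t - 0 / t) * Real.exp (-w / t) := by
      rw [← Real.exp_add]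
      congr 1
      ring
    rw [this]
    push_cast
    field_simp
  rw [setIntegral_congr_fun measurableSet_Ioi e1, hswap]
  refine setIntegral_congr_fun measurableSet_Ioi fun u (hu : 0 < u) => ?_
  rw [← integral_momentKernel_mul_exp hν hs hs1 hu, ← integral_const_mul, ← integral_const_mul]
  congr 1
  ext t
  simp only [hF]
  push_cast
  ring

lemma integrableOn_exp_neg_mul {ν : ℂ} (hν : 0 < ν.re) :
    IntegrableOn (fun u : ℝ => Real.exp (-ν.re * u)) (Ioi 0) :=
  integrableOn_exp_mul_Ioi (neg_lt_zero.2 hν) 0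

lemma norm_exp_neg_mul (ν : ℂ) (u : ℝ) : ‖Complex.exp (-(ν * u))‖ = Real.exp (-ν.re * u) := by
  rw [Complex.norm_exp]
  simp

lemma expShift_one (u : ℝ) : expShift 1 u = 4 * Real.sinh (u / 2) ^ 2 := by
  have h : Real.exp u = Real.exp (u / 2) ^ 2 := by rw [← Real.exp_nat_mul]; congr 1; push_cast; ring
  have h2 : Real.exp (-u) = Real.exp (-(u / 2)) ^ 2 := by
    rw [← Real.exp_nat_mul]; congr 1; push_cast; ring
  have h3 : Real.exp (u / 2) * Real.exp (-(u / 2)) = 1 := by rw [← Real.exp_add]; simp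
  rw [expShift, Real.sinh_eq, h, h2]
  linear_combination 2 * h3

lemma reducedI_mul_reducedK_eq_integral {ν : ℂ} (hν : 0 < ν.re) {w : ℝ} (hw : 0 ≤ w) :
    reducedI ν (w : ℂ) * reducedK ν w =
      ∫ u in Ioi (0 : ℝ), (reducedJ (w * expShift 1 u) : ℂ) * Complex.exp (-(ν * u)) := by
  have hev : ∀ᶠ s : ℝ in nhdsWithin 1 (Iio 1), s ∈ Ioo (0 : ℝ) 1 := Ioo_mem_nhdsLT one_pos
  have h1 : Tendsto (fun s : ℝ => reducedI ν ((s * w : ℝ) : ℂ) * reducedK ν w) (nhdsWithin 1 (Iio 1))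
      (nhds (reducedI ν (w : ℂ) * reducedK ν w)) := by
    have hc : Continuous fun s : ℝ => reducedI ν ((s * w : ℝ) : ℂ) * reducedK ν w :=
      ((continuous_reducedI hν.le).comp (by fun_prop)).mul continuous_const
    have := (hc.tendsto 1).mono_left (nhdsWithin_le_nhds (s := Iio 1))
    simpa using this
  refine tendsto_nhds_unique h1 (Tendsto.congr' (f₁ := fun s => ∫ u in Ioi (0 : ℝ),
    (reducedJ (w * expShift s u) : ℂ) * Complex.exp (-(ν * u))) ?_ ?_)
  · filter_upwards [hev] with s hs using
      (reducedI_mul_reducedK_eq_integral_of_lt hν hw hs.1 hs.2).symm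
  · refine tendsto_integral_filter_of_dominated_convergence (fun u => Real.exp (-ν.re * u)) ?_ ?_
      (integrableOn_exp_neg_mul hν) ?_
    · refine Eventually.of_forall fun s => Continuous.aestronglyMeasurable ?_
      refine (Complex.continuous_ofReal.comp (continuous_reducedJ.comp ?_)).mul (by fun_prop)
      exact continuous_const.mul (continuous_expShift s)
    · filter_upwards [hev] with s hs
      refine (ae_restrict_iff' measurableSet_Ioi).2 (ae_of_all _ fun u hu => ?_)
      rw [norm_mul, norm_exp_neg_mul, Complex.norm_real]
      exact mul_le_of_le_one_left (Real.exp_pos _).le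
        (abs_reducedJ_le_one (mul_nonneg hw (expShift_nonneg hs.2.le hu)))
    · refine ae_of_all _ fun u => ?_
      have hc : Continuous fun s : ℝ => (reducedJ (w * expShift s u) : ℂ) * Complex.exp (-(ν * u)) := by
        refine (Complex.continuous_ofReal.comp (continuous_reducedJ.comp ?_)).mul continuous_const
        unfold expShift
        fun_prop
      exact (hc.tendsto 1).mono_left nhdsWithin_le_nhds

/-- Bound for `J₀(2 y sinh s)`. -/
noncomputable def besselJBound (s : ℝ) : ℝ := s ^ (-(1 : ℝ) / 2) * Real.exp (-(1 / 4) * s)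

lemma integrableOn_besselJBound : IntegrableOn besselJBound (Ioi 0) := by
  have := integrableOn_rpow_mul_exp_neg_mul_rpow (s := -(1 : ℝ) / 2) (p := 1) (b := 1 / 4)
    (by norm_num) one_pos (by norm_num)
  refine this.congr_fun (fun s _ => ?_) measurableSet_Ioi
  simp only [besselJBound, Real.rpow_one]

lemma mul_exp_le_sinh {s : ℝ} (hs : 0 ≤ s) : s / 2 * Real.exp (s / 2) ≤ Real.sinh s := by
  have h1 : s / 2 ≤ Real.sinh (s / 2) := Real.self_le_sinh_iff.2 (by linarith)
  have h2 : Real.sinh s = 2 * Real.sinh (s / 2) * Real.cosh (s / 2) := by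
    rw [← Real.sinh_two_mul]; congr 1; ring
  have h3 : Real.exp (s / 2) ≤ 2 * Real.cosh (s / 2) := by
    rw [Real.cosh_eq]
    linarith [Real.exp_pos (-(s / 2))]
  rw [h2]
  calc s / 2 * Real.exp (s / 2) ≤ Real.sinh (s / 2) * (2 * Real.cosh (s / 2)) := by gcongr
    _ = _ := by ring

lemma abs_reducedJ_sinh_le {y s : ℝ} (hy : 0 < y) (hs : 0 < s) :
    |reducedJ (y ^ 2 * Real.sinh s ^ 2)| ≤ 2 * y ^ (-(1 : ℝ) / 2) * besselJBound s := by
  have hsh : 0 < Real.sinh s := Real.sinh_pos_iff.2 hs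
  have h := mul_reducedJ_sq_le (z := 2 * y * Real.sinh s) (by positivity)
  rw [show (2 * y * Real.sinh s) ^ 2 / 4 = y ^ 2 * Real.sinh s ^ 2 by ring] at h
  refine abs_le_of_sq_le_sq ?_ (by unfold besselJBound; positivity)
  have e1 : ∀ a : ℝ, 0 < a → (a ^ (-(1 : ℝ) / 2)) ^ 2 = a⁻¹ := by
    intro a ha
    rw [← Real.rpow_natCast, ← Real.rpow_mul ha.le, ← Real.rpow_neg_one]
    norm_num
  have e2 : Real.exp (-(1 / 4) * s) ^ 2 = (Real.exp (s / 2))⁻¹ := by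
    rw [← Real.exp_neg, ← Real.exp_nat_mul]; congr 1; push_cast; ring
  rw [besselJBound, mul_pow, mul_pow, mul_pow, e1 y hy, e1 s hs, e2]
  have h3 := mul_exp_le_sinh hs.le
  have hpos : 0 < y * (s / 2 * Real.exp (s / 2)) := by positivity
  have h4 : y * (s / 2 * Real.exp (s / 2)) * reducedJ (y ^ 2 * Real.sinh s ^ 2) ^ 2 ≤ 1 := by
    have : y * (s / 2 * Real.exp (s / 2)) * reducedJ (y ^ 2 * Real.sinh s ^ 2) ^ 2 ≤
      y * Real.sinh s * reducedJ (y ^ 2 * Real.sinh s ^ 2) ^ 2 := by gcongr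
    linarith
  have h5 : reducedJ (y ^ 2 * Real.sinh s ^ 2) ^ 2 ≤ 1 / (y * (s / 2 * Real.exp (s / 2))) := by
    rw [le_div_iff₀ hpos]; linarith
  refine h5.trans ?_
  have : 1 / (y * (s / 2 * Real.exp (s / 2))) = 2 * (y⁻¹ * (s⁻¹ * (Real.exp (s / 2))⁻¹)) := by
    field_simp
  rw [this]
  have : 0 ≤ y⁻¹ * (s⁻¹ * (Real.exp (s / 2))⁻¹) := by positivity
  nlinarith

lemma half_reducedI_mul_reducedK_eq_integral {ν : ℂ} (hν : 0 < ν.re) {y : ℝ} :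
    1 / 2 * (reducedI ν ((y ^ 2 / 4 : ℝ) : ℂ) * reducedK ν (y ^ 2 / 4)) =
      ∫ s in Ioi (0 : ℝ), (reducedJ (y ^ 2 * Real.sinh s ^ 2) : ℂ) * Complex.exp (-(2 * ν * s)) := by
  rw [reducedI_mul_reducedK_eq_integral hν (by positivity)]
  have h := integral_comp_mul_left_Ioi (fun u : ℝ => (reducedJ (y ^ 2 / 4 * expShift 1 u) : ℂ) *
    Complex.exp (-(ν * u))) 0 two_pos
  rw [mul_zero, Complex.real_smul] at h
  rw [show (1 / 2 : ℂ) = ((2⁻¹ : ℝ) : ℂ) by norm_num, ← h]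
  congr 1
  ext s
  rw [expShift_one]
  congr 3
  · ring_nf
  · push_cast; ring

/-- An integral representation of the product of `I_{iτ}` and `K_{iτ}`. -/
lemma besselIK_eq_integral (τ : ℝ) {y : ℝ} (hy : 0 < y) :
    besselIK τ y = ∫ s in Ioi (0 : ℝ), (reducedJ (y ^ 2 * Real.sinh s ^ 2) : ℂ) *
      Complex.exp (-(2 * (Complex.I * τ) * s)) := by
  set ν : ℝ → ℂ := fun ε => Complex.I * τ + ε with hν
  have hre : ∀ ε, (ν ε).re = ε := by intro ε; simp [hν]
  have hlim : Tendsto ν (nhdsWithin 0 (Ioi 0)) (nhds (Complex.I * τ)) := by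
    have hc : Continuous ν := by simp only [hν]; fun_prop
    have := (hc.tendsto 0).mono_left (nhdsWithin_le_nhds (s := Ioi 0))
    simpa [hν] using this
  have h1 : Tendsto (fun ε => 1 / 2 * (reducedI (ν ε) ((y ^ 2 / 4 : ℝ) : ℂ) * reducedK (ν ε) (y ^ 2 / 4)))
      (nhdsWithin 0 (Ioi 0)) (nhds (besselIK τ y)) := by
    refine Tendsto.const_mul _ (Tendsto.mul ?_ ?_)
    · refine (continuousWithinAt_reducedI_order _).tendsto.comp (tendsto_nhdsWithin_iff.2 ⟨hlim, ?_⟩)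
      exact eventually_nhdsWithin_of_forall fun ε hε => by simpa [hre] using le_of_lt hε
    · exact (continuousAt_reducedK_order _ (by positivity)).tendsto.comp hlim
  refine tendsto_nhds_unique h1 (Tendsto.congr' (f₁ := fun ε => ∫ s in Ioi (0 : ℝ),
    (reducedJ (y ^ 2 * Real.sinh s ^ 2) : ℂ) * Complex.exp (-(2 * ν ε * s))) ?_ ?_)
  · exact eventually_nhdsWithin_of_forall fun ε hε =>
      (half_reducedI_mul_reducedK_eq_integral (by rw [hre]; exact hε)).symm
  · refine tendsto_integral_filter_of_dominated_convergence
      (fun s => 2 * y ^ (-(1 : ℝ) / 2) * besselJBound s) ?_ ?_ (integrableOn_besselJBound.const_mul _) ?_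
    · refine Eventually.of_forall fun ε => Continuous.aestronglyMeasurable ?_
      refine (Complex.continuous_ofReal.comp (continuous_reducedJ.comp ?_)).mul (by fun_prop)
      have := Real.continuous_sinh
      fun_prop
    · refine eventually_nhdsWithin_of_forall fun ε (hε : 0 < ε) => ?_
      refine (ae_restrict_iff' measurableSet_Ioi).2 (ae_of_all _ fun s (hs : 0 < s) => ?_)
      rw [norm_mul, norm_exp_neg_mul, Complex.norm_real]
      refine le_trans (mul_le_of_le_one_right (norm_nonneg _) ?_) (abs_reducedJ_sinh_le hy hs)
      rw [Real.exp_le_one_iff]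
      have : (2 * ν ε).re = 2 * ε := by simp [hν]
      rw [this]
      nlinarith
    · refine ae_of_all _ fun s => ?_
      have hc : Continuous fun z : ℂ => (reducedJ (y ^ 2 * Real.sinh s ^ 2) : ℂ) *
        Complex.exp (-(2 * z * s)) := by fun_prop
      exact (hc.tendsto _).comp hlim

/-- The integrand in the representation of `besselIK`. -/
noncomputable def besselIKKernel (τ y s : ℝ) : ℂ :=
  (reducedJ (y ^ 2 * Real.sinh s ^ 2) : ℂ) * Complex.exp (-(2 * (Complex.I * τ) * s))

lemma norm_exp_neg_two_I_mul (τ s : ℝ) : ‖Complex.exp (-(2 * (Complex.I * τ) * s))‖ = 1 := by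
  rw [Complex.norm_exp]
  simp

@[fun_prop]
lemma continuous_besselIKKernel {X : Type*} [TopologicalSpace X] {f g h : X → ℝ} (hf : Continuous f)
    (hg : Continuous g) (hh : Continuous h) : Continuous fun x => besselIKKernel (f x) (g x) (h x) := by
  have h1 : Continuous fun x => reducedJ (g x ^ 2 * Real.sinh (h x) ^ 2) :=
    continuous_reducedJ.comp' ((hg.pow 2).mul ((Real.continuous_sinh.comp' hh).pow 2))
  unfold besselIKKernel
  fun_prop

lemma norm_besselIKKernel_le (τ : ℝ) {y s : ℝ} (hy : 0 < y) (hs : 0 < s) :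
    ‖besselIKKernel τ y s‖ ≤ 2 * y ^ (-(1 : ℝ) / 2) * besselJBound s := by
  rw [besselIKKernel, norm_mul, norm_exp_neg_two_I_mul, mul_one, Complex.norm_real]
  exact abs_reducedJ_sinh_le hy hs

lemma integrableOn_besselIKKernel (τ : ℝ) {y : ℝ} (hy : 0 < y) :
    IntegrableOn (besselIKKernel τ y) (Ioi 0) := by
  have hc : Continuous fun s => besselIKKernel τ y s := by fun_prop
  exact Integrable.mono' (integrableOn_besselJBound.const_mul _) hc.aestronglyMeasurable
    ((ae_restrict_iff' measurableSet_Ioi).2 (ae_of_all _ fun s hs => norm_besselIKKernel_le τ hy hs))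

lemma integral_besselIKKernel (τ : ℝ) {y : ℝ} (hy : 0 < y) :
    ∫ s in Ioi (0 : ℝ), besselIKKernel τ y s = besselIK τ y := (besselIK_eq_integral τ hy).symm

/-- The constant in the uniform bound for `besselIK`. -/
noncomputable def besselIKBound : ℝ := 2 * ∫ s in Ioi (0 : ℝ), besselJBound s

lemma besselJBound_nonneg {s : ℝ} (hs : 0 < s) : 0 ≤ besselJBound s := by
  unfold besselJBound; positivity

lemma besselIKBound_nonneg : 0 ≤ besselIKBound :=
  mul_nonneg zero_le_two (setIntegral_nonneg measurableSet_Ioi fun _ hs => besselJBound_nonneg hs)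

lemma norm_besselIK_le (τ : ℝ) {y : ℝ} (hy : 0 < y) :
    ‖besselIK τ y‖ ≤ besselIKBound * y ^ (-(1 : ℝ) / 2) := by
  rw [← integral_besselIKKernel τ hy]
  refine (norm_integral_le_of_norm_le (integrableOn_besselJBound.const_mul _)
    ((ae_restrict_iff' measurableSet_Ioi).2 (ae_of_all _ fun s hs =>
      norm_besselIKKernel_le τ hy hs))).trans_eq ?_
  rw [integral_const_mul, besselIKBound]
  ring

lemma continuous_besselIK_left {y : ℝ} (hy : 0 < y) : Continuous fun τ => besselIK τ y := by
  simp only [← integral_besselIKKernel _ hy]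
  refine continuous_of_dominated (bound := fun s => 2 * y ^ (-(1 : ℝ) / 2) * besselJBound s)
    (fun τ => (integrableOn_besselIKKernel τ hy).aestronglyMeasurable)
    (fun τ => (ae_restrict_iff' measurableSet_Ioi).2 (ae_of_all _ fun s hs =>
      norm_besselIKKernel_le τ hy hs)) (integrableOn_besselJBound.const_mul _) (ae_of_all _ fun s => ?_)
  fun_prop

lemma exists_measurable_eq_besselIK : ∃ F : ℝ × ℝ → ℂ, Measurable F ∧
    ∀ τ y : ℝ, 0 < y → F (τ, y) = besselIK τ y := by
  refine ⟨fun p => ∫ s in Ioi (0 : ℝ), besselIKKernel p.1 p.2 s, ?_, fun τ y hy =>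
    integral_besselIKKernel τ hy⟩
  have hc : Continuous fun p : (ℝ × ℝ) × ℝ => besselIKKernel p.1.1 p.1.2 p.2 := by fun_prop
  exact (hc.stronglyMeasurable.integral_prod_right
    (ν := volume.restrict (Ioi (0 : ℝ)))).measurable

lemma im_besselIK_nonpos {τ y : ℝ} (hτ : 0 ≤ τ) (hy : 0 < y) : (besselIK τ y).im ≤ 0 := by
  have h := sinh_mul_besselKi_sq τ hy
  have h1 : 0 ≤ Real.sinh (Real.pi * τ) := Real.sinh_nonneg_iff.2 (by positivity)
  have h2 : 0 ≤ Real.sinh (Real.pi * τ) * besselKi τ y ^ 2 := by positivity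
  rw [h] at h2
  nlinarith [Real.pi_pos]

lemma re_besselIK_eq_integral (τ : ℝ) {y : ℝ} (hy : 0 < y) : (besselIK τ y).re =
    ∫ s in Ioi (0 : ℝ), reducedJ (y ^ 2 * Real.sinh s ^ 2) * Real.cos (2 * τ * s) := by
  rw [← integral_besselIKKernel τ hy]
  have h := integral_re (𝕜 := ℂ) (integrableOn_besselIKKernel τ hy)
  simp only [RCLike.re_eq_complex_re] at h
  rw [← h]
  congr 1
  ext s
  rw [besselIKKernel, Complex.re_ofReal_mul, Complex.exp_re]
  simp

lemma im_besselIK_eq_integral (τ : ℝ) {y : ℝ} (hy : 0 < y) : (besselIK τ y).im =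
    -∫ s in Ioi (0 : ℝ), reducedJ (y ^ 2 * Real.sinh s ^ 2) * Real.sin (2 * τ * s) := by
  rw [← integral_besselIKKernel τ hy, ← integral_neg]
  have h := integral_im (𝕜 := ℂ) (integrableOn_besselIKKernel τ hy)
  simp only [RCLike.im_eq_complex_im] at h
  rw [← h]
  congr 1
  ext s
  rw [besselIKKernel, Complex.im_ofReal_mul, Complex.exp_im]
  simp

/-- The unimodular phase `Γ(1 - iτ) / Γ(1 + iτ)`. -/
noncomputable def gammaPhase (τ : ℂ) : ℂ :=
  Complex.Gamma (1 - Complex.I * τ) * (Complex.Gamma (1 + Complex.I * τ))⁻¹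

lemma Gamma_one_sub_I_mul (τ : ℝ) : Complex.Gamma (1 - Complex.I * τ) =
    starRingEnd ℂ (Complex.Gamma (1 + Complex.I * τ)) := by
  rw [← Complex.Gamma_conj]
  simp [sub_eq_add_neg]

lemma Gamma_one_add_I_mul_ne_zero (τ : ℝ) : Complex.Gamma (1 + Complex.I * τ) ≠ 0 :=
  Complex.Gamma_ne_zero_of_re_pos (by simp)

lemma norm_gammaPhase (τ : ℝ) : ‖gammaPhase τ‖ = 1 := by
  rw [gammaPhase, norm_mul, norm_inv, Gamma_one_sub_I_mul, Complex.norm_conj]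
  exact mul_inv_cancel₀ (norm_ne_zero_iff.2 (Gamma_one_add_I_mul_ne_zero τ))

lemma normSq_Gamma_one_add_I_mul {τ : ℝ} (hτ : 0 < τ) :
    Complex.Gamma (1 + Complex.I * τ) * Complex.Gamma (1 - Complex.I * τ) *
      Real.sinh (Real.pi * τ) = Real.pi * τ := by
  have hτ' : (τ : ℂ) ≠ 0 := by exact_mod_cast hτ.ne'
  have h := Complex.Gamma_mul_Gamma_one_sub (Complex.I * τ)
  rw [add_comm, Complex.Gamma_add_one _ (mul_ne_zero Complex.I_ne_zero hτ'), mul_assoc (Complex.I * τ), h,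
    show (Real.pi : ℂ) * (Complex.I * τ) = ((Real.pi * τ : ℝ) : ℂ) * Complex.I by push_cast; ring,
    Complex.sin_mul_I, ← Complex.ofReal_sinh]
  have hs : (Real.sinh (Real.pi * τ) : ℂ) ≠ 0 := by
    have : 0 < Real.sinh (Real.pi * τ) := Real.sinh_pos_iff.2 (by positivity)
    exact_mod_cast this.ne'
  have := Complex.I_ne_zero
  field_simp

/-- The leading oscillation `(Γ(1 - iτ) / Γ(1 + iτ)) exp (2 * I * τ * L)`. -/
noncomputable def besselPhase (L τ : ℝ) : ℂ := gammaPhase τ * Complex.exp (2 * (Complex.I * τ) * L)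

lemma norm_besselPhase (L τ : ℝ) : ‖besselPhase L τ‖ = 1 := by
  rw [besselPhase, norm_mul, norm_gammaPhase, one_mul, Complex.norm_exp]
  simp

/-- The correction `Γ(1 + iτ) reducedI (iτ) (y²/4) - 1`. -/
noncomputable def besselCorrection (τ y : ℝ) : ℂ :=
  Complex.Gamma (Complex.I * τ + 1) * reducedI (Complex.I * τ) ((y ^ 2 / 4 : ℝ) : ℂ) - 1

lemma two_mul_besselIK_eq {τ y : ℝ} (hτ : 0 < τ) (hy : 0 < y) :
    2 * τ * besselIK τ y = Complex.I * (besselPhase (Real.log (y / 2)) τ * (1 + besselCorrection τ y) ^ 2 -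
      (1 + besselCorrection τ y) * starRingEnd ℂ (1 + besselCorrection τ y)) := by
  set r := 1 + besselCorrection τ y with hr
  set G := Complex.Gamma (1 + Complex.I * τ) with hG
  set e := Complex.exp (Complex.I * τ * (Real.log (y / 2) : ℝ)) with he
  have hG0 : G ≠ 0 := Gamma_one_add_I_mul_ne_zero τ
  have hGc : Complex.Gamma (1 - Complex.I * τ) = starRingEnd ℂ G := Gamma_one_sub_I_mul τ
  have hI : G * besselI (Complex.I * τ) y = e * r := by
    rw [besselI_eq_reducedI _ hy, Complex.cpow_def_of_ne_zero (by
      have : 0 < y / 2 := by positivity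
      exact_mod_cast this.ne'), ← Complex.ofReal_log (by positivity), hr, besselCorrection,
      add_comm (Complex.I * (τ : ℂ)) 1, ← hG, he, mul_comm (Complex.I * (τ : ℂ))]
    ring
  have hK := sinh_mul_besselKi τ hy
  have hIK := besselI_mul_besselKi τ hy
  have hGG := normSq_Gamma_one_add_I_mul hτ
  rw [hGc, ← hG] at hGG
  have hGc0 : starRingEnd ℂ G ≠ 0 := (map_ne_zero _).2 hG0
  have hee : e * starRingEnd ℂ e = 1 := by
    rw [he, ← Complex.exp_conj, ← Complex.exp_add]
    simp
  have hph : G * besselPhase (Real.log (y / 2)) τ = starRingEnd ℂ G * e ^ 2 := by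
    have he2 : e ^ 2 = Complex.exp (2 * (Complex.I * τ) * (Real.log (y / 2) : ℝ)) := by
      rw [he, ← Complex.exp_nat_mul]
      congr 1
      push_cast
      ring
    rw [besselPhase, gammaPhase, hGc, ← hG, he2]
    linear_combination (starRingEnd ℂ G * Complex.exp (2 * (Complex.I * τ) * (Real.log (y / 2) : ℝ))) *
      mul_inv_cancel₀ hG0
  have hKc : (Real.sinh (Real.pi * τ) : ℂ) * besselKi τ y =
      -Real.pi * (besselI (Complex.I * τ) y - starRingEnd ℂ (besselI (Complex.I * τ) y)) /
          (2 * Complex.I) := by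
    have h2 : ((besselI (Complex.I * τ) y).im : ℂ) =
      (besselI (Complex.I * τ) y - starRingEnd ℂ (besselI (Complex.I * τ) y)) / (2 * Complex.I) :=
      Complex.im_eq_sub_conj _
    rw [mul_div_assoc, ← h2]
    exact_mod_cast hK
  have hIc : starRingEnd ℂ G * starRingEnd ℂ (besselI (Complex.I * τ) y) = starRingEnd ℂ e *
      starRingEnd ℂ r := by
    rw [← map_mul, hI, map_mul]
  have hs : (Real.sinh (Real.pi * τ) : ℂ) ≠ 0 := by
    have : 0 < Real.sinh (Real.pi * τ) := Real.sinh_pos_iff.2 (by positivity)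
    exact_mod_cast this.ne'
  have hpi : (Real.pi : ℂ) ≠ 0 := by exact_mod_cast Real.pi_ne_zero
  set p := besselPhase (Real.log (y / 2)) τ
  set B := besselI (Complex.I * τ) y
  have hsB : (Real.sinh (Real.pi * τ) : ℂ) * besselIK τ y =
      Real.pi * Complex.I / 2 * (B ^ 2 - B * starRingEnd ℂ B) := by
    rw [← hIK, mul_left_comm, hKc]
    field_simp
    linear_combination (B * starRingEnd ℂ B - B ^ 2) * Complex.I_sq
  have h1 : G * (starRingEnd ℂ G * B ^ 2 * G) = G * (p * r ^ 2) := by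
    linear_combination starRingEnd ℂ G * (G * B + e * r) * hI - r ^ 2 * hph
  have h2 : G * B * (starRingEnd ℂ G * starRingEnd ℂ B) = r * starRingEnd ℂ r := by
    rw [hI, hIc]
    linear_combination r * starRingEnd ℂ r * hee
  have h3 := mul_left_cancel₀ hG0 h1
  refine mul_left_cancel₀ hpi ?_
  linear_combination -2 * besselIK τ y * hGG + 2 * G * starRingEnd ℂ G * hsB +
    Real.pi * Complex.I * (h3 - h2)

/-- The remainder in the leading-order asymptotics of `2τ besselIK τ y` as `τ → ∞`. -/
noncomputable def besselRemainder (τ y : ℝ) : ℂ :=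
  2 * τ * besselIK τ y - Complex.I * (besselPhase (Real.log (y / 2)) τ - 1)

lemma norm_besselRemainder_le_correction {τ y : ℝ} (hτ : 0 < τ) (hy : 0 < y) :
    ‖besselRemainder τ y‖ ≤ 2 * ‖besselCorrection τ y‖ * (2 + ‖besselCorrection τ y‖) := by
  set c := besselCorrection τ y with hc
  set p := besselPhase (Real.log (y / 2)) τ with hp
  have hp1 : ‖p‖ = 1 := norm_besselPhase _ _
  have h : besselRemainder τ y =
      Complex.I * (p * (c * (2 + c)) - (c + starRingEnd ℂ c * (1 + c))) := by
    rw [besselRemainder, two_mul_besselIK_eq hτ hy, ← hc, ← hp, map_add, map_one]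
    ring
  rw [h, norm_mul, Complex.norm_I, one_mul]
  have h1 : ‖p * (c * (2 + c))‖ ≤ ‖c‖ * (2 + ‖c‖) := by
    rw [norm_mul, hp1, one_mul, norm_mul]
    have : ‖(2 : ℂ) + c‖ ≤ 2 + ‖c‖ := (norm_add_le _ _).trans_eq (by simp)
    gcongr
  have h2 : ‖c + starRingEnd ℂ c * (1 + c)‖ ≤ ‖c‖ * (2 + ‖c‖) := by
    refine (norm_add_le _ _).trans ?_
    rw [norm_mul, Complex.norm_conj]
    have : ‖(1 : ℂ) + c‖ ≤ 1 + ‖c‖ := (norm_add_le _ _).trans_eq (by simp)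
    nlinarith [norm_nonneg c]
  linarith [norm_sub_le (p * (c * (2 + c))) (c + starRingEnd ℂ c * (1 + c))]

lemma norm_besselCorrection_le {τ : ℝ} (hτ : 0 < τ) (y : ℝ) :
    ‖besselCorrection τ y‖ ≤ Real.exp (y ^ 2 / 4 / τ) - 1 := by
  have h := norm_Gamma_mul_reducedI_sub_one_le hτ ((y ^ 2 / 4 : ℝ) : ℂ)
  rwa [Complex.norm_real, Real.norm_of_nonneg (by positivity)] at h

lemma norm_besselRemainder_le_of_sq_le {τ y : ℝ} (hτ : 0 < τ) (hy : 0 < y) (h : y ^ 2 ≤ τ) :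
    ‖besselRemainder τ y‖ ≤ 5 / 2 * y ^ 2 / τ := by
  have h1 : y ^ 2 / τ ≤ 1 := (div_le_one hτ).2 h
  have h0 : 0 ≤ y ^ 2 / τ := by positivity
  have he : y ^ 2 / 4 / τ = y ^ 2 / τ / 4 := by ring
  have h2 : ‖besselCorrection τ y‖ ≤ y ^ 2 / τ / 2 := by
    refine (norm_besselCorrection_le hτ y).trans ?_
    have := Real.abs_exp_sub_one_le (x := y ^ 2 / 4 / τ) (by rw [abs_of_nonneg] <;> linarith)
    rw [abs_of_nonneg (by linarith : (0 : ℝ) ≤ y ^ 2 / 4 / τ)] at this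
    linarith [le_abs_self (Real.exp (y ^ 2 / 4 / τ) - 1)]
  have h3 := norm_besselRemainder_le_correction hτ hy
  have h4 : 5 / 2 * y ^ 2 / τ = 5 / 2 * (y ^ 2 / τ) := by ring
  rw [h4]
  nlinarith [norm_nonneg (besselCorrection τ y)]

lemma exists_norm_besselRemainder_le {y : ℝ} (hy : 0 < y) :
    ∃ C, 0 ≤ C ∧ ∀ τ, 1 ≤ τ → ‖besselRemainder τ y‖ ≤ C / τ := by
  set M := y ^ 2 / 4 * Real.exp (y ^ 2 / 4) with hM
  have hM0 : 0 ≤ M := by positivity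
  refine ⟨2 * M * (2 + M), by positivity, fun τ hτ => ?_⟩
  have hτ0 : 0 < τ := by linarith
  have h1 : ‖besselCorrection τ y‖ ≤ M / τ := by
    refine (norm_besselCorrection_le hτ0 y).trans ?_
    set h := y ^ 2 / 4 / τ with hh
    have h2 : h ≤ y ^ 2 / 4 := div_le_self (by positivity) hτ
    have h3 : Real.exp h - 1 ≤ h * Real.exp h := by
      have := Real.add_one_le_exp (-h)
      rw [Real.exp_neg] at this
      have h4 := Real.exp_pos h
      have := mul_le_mul_of_nonneg_right this h4.le
      rw [inv_mul_cancel₀ h4.ne'] at this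
      linarith
    refine h3.trans ?_
    calc h * Real.exp h ≤ h * Real.exp (y ^ 2 / 4) := by gcongr
      _ = M / τ := by rw [hh, hM]; ring
  have h2 : M / τ ≤ M := div_le_self hM0 hτ
  refine (norm_besselRemainder_le_correction hτ0 hy).trans ?_
  calc 2 * ‖besselCorrection τ y‖ * (2 + ‖besselCorrection τ y‖) ≤ 2 * (M / τ) * (2 + M) := by
        gcongr; exact h1.trans h2
    _ = _ := by ring

lemma norm_betaIntegral_le (u v : ℂ) :
    ‖Complex.betaIntegral u v‖ ≤ (Complex.betaIntegral u.re v.re).re := by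
  have h : Complex.betaIntegral u.re v.re =
      ((∫ x in (0 : ℝ)..1, x ^ (u.re - 1) * (1 - x) ^ (v.re - 1) : ℝ) : ℂ) := by
    rw [Complex.betaIntegral, ← intervalIntegral.integral_ofReal]
    refine intervalIntegral.integral_congr fun x hx => ?_
    rw [uIcc_of_le zero_le_one] at hx
    push_cast [Complex.ofReal_cpow hx.1, Complex.ofReal_cpow (sub_nonneg.2 hx.2)]
    rfl
  rw [h, Complex.ofReal_re, Complex.betaIntegral]
  refine (intervalIntegral.norm_integral_le_integral_norm zero_le_one).trans_eq ?_
  refine intervalIntegral.integral_congr_ae ?_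
  have h1 : ∀ᵐ x : ℝ, x ≠ 1 := by simp [ae_iff]
  filter_upwards [h1] with x hx1 hx
  rw [uIoc_of_le zero_le_one] at hx
  have hx2 : 0 < 1 - x := sub_pos.2 (lt_of_le_of_ne hx.2 hx1)
  rw [norm_mul, Complex.norm_cpow_eq_rpow_re_of_pos hx.1, ← Complex.ofReal_one, ← Complex.ofReal_sub,
    Complex.norm_cpow_eq_rpow_re_of_pos hx2]
  simp

lemma norm_Gamma_div_Gamma_add_le {u : ℂ} (hu : 0 < u.re) {c : ℝ} (hc : 0 < c) :
    ‖Complex.Gamma u‖ * Real.Gamma (u.re + c) ≤ ‖Complex.Gamma (u + c)‖ * Real.Gamma u.re := by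
  have h1 := Complex.Gamma_mul_Gamma_eq_betaIntegral hu (t := (c : ℂ)) (by simpa)
  have h2 := Complex.Gamma_mul_Gamma_eq_betaIntegral (s := (u.re : ℂ)) (t := (c : ℂ)) (by simpa) (by simpa)
  have h3 := norm_betaIntegral_le u c
  rw [Complex.ofReal_re] at h3
  rw [← Complex.ofReal_add, Complex.Gamma_ofReal, Complex.Gamma_ofReal, Complex.Gamma_ofReal] at h2
  have h4 := congrArg Complex.re h2
  rw [Complex.re_ofReal_mul, Complex.re_ofReal_mul, Complex.ofReal_re] at h4
  have h5 := congrArg norm h1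
  rw [Complex.Gamma_ofReal, norm_mul, norm_mul, Complex.norm_real,
    Real.norm_of_nonneg (Real.Gamma_pos_of_pos hc).le] at h5
  have hG := Real.Gamma_pos_of_pos hc
  have hG2 : 0 < Real.Gamma (u.re + c) := Real.Gamma_pos_of_pos (by linarith)
  refine le_of_mul_le_mul_right ?_ hG
  calc _ = (‖Complex.Gamma u‖ * Real.Gamma c) * Real.Gamma (u.re + c) := by ring
    _ ≤ ‖Complex.Gamma (u + c)‖ * (Complex.betaIntegral u.re c).re * Real.Gamma (u.re + c) := by
        rw [h5]; gcongr
    _ = ‖Complex.Gamma (u + c)‖ * (Real.Gamma u.re * Real.Gamma c) := by rw [h4]; ring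
    _ = _ := by ring

lemma Gamma_le_one {t : ℝ} (h1 : 1 ≤ t) (h2 : t ≤ 2) : Real.Gamma t ≤ 1 := by
  have h := Real.convexOn_Gamma.2 (mem_Ioi.2 one_pos) (mem_Ioi.2 two_pos) (sub_nonneg.2 h2)
    (sub_nonneg.2 h1) (by ring)
  simp only [smul_eq_mul, Real.Gamma_one, Real.Gamma_two] at h
  rw [show (2 - t) * 1 + (t - 1) * 2 = t by ring] at h
  linarith

lemma one_le_Gamma {t : ℝ} (h : 2 ≤ t) : 1 ≤ Real.Gamma t := by
  rw [← Real.Gamma_two]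
  exact Real.Gamma_strictMonoOn_Ici.monotoneOn (by simp) h h

lemma norm_Gamma_two_sub_le {η : ℝ} (h0 : 0 ≤ η) (h1 : η ≤ 1) (σ : ℝ) :
    ‖Complex.Gamma ((2 - η : ℝ) + σ * Complex.I)‖ ≤ ‖Complex.Gamma ((2 + η : ℝ) + σ * Complex.I)‖ := by
  rcases h0.eq_or_lt with rfl | h0
  · simp
  set u : ℂ := (2 - η : ℝ) + σ * Complex.I with hu
  have hre : u.re = 2 - η := by simp [hu]
  have h := norm_Gamma_div_Gamma_add_le (u := u) (by rw [hre]; linarith) (c := 2 * η) (by linarith)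
  rw [hre] at h
  have e : u + ((2 * η : ℝ) : ℂ) = (2 + η : ℝ) + σ * Complex.I := by rw [hu]; push_cast; ring
  rw [e] at h
  have a := Gamma_le_one (t := 2 - η) (by linarith) (by linarith)
  have b := one_le_Gamma (t := 2 - η + 2 * η) (by linarith)
  nlinarith [norm_nonneg (Complex.Gamma u), norm_nonneg (Complex.Gamma ((2 + η : ℝ) + σ * Complex.I))]

lemma norm_gammaPhase_sub_mul_I_le {η σ : ℝ} (h0 : 0 ≤ η) (h1 : η ≤ 1) (hσ : 1 ≤ σ) :
    ‖gammaPhase (σ - η * Complex.I)‖ ≤ 3 := by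
  set u : ℂ := (1 - η : ℝ) + σ * Complex.I with hu
  set v : ℂ := (1 + η : ℝ) + σ * Complex.I with hv
  have hum : u.im = σ := by simp [hu]
  have hvm : v.im = σ := by simp [hv]
  have hu0 : u ≠ 0 := fun h => by rw [h] at hum; simp at hum; linarith
  have hv0 : v ≠ 0 := fun h => by rw [h] at hvm; simp at hvm; linarith
  have e1 : (1 : ℂ) - Complex.I * (σ - η * Complex.I) = starRingEnd ℂ u := by
    apply Complex.ext <;> simp [hu]
  have e2 : (1 : ℂ) + Complex.I * (σ - η * Complex.I) = v := by
    apply Complex.ext <;> simp [hv]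
  have h := norm_Gamma_two_sub_le h0 h1 σ
  rw [show ((2 - η : ℝ) : ℂ) + σ * Complex.I = u + 1 by rw [hu]; push_cast; ring,
    show ((2 + η : ℝ) : ℂ) + σ * Complex.I = v + 1 by rw [hv]; push_cast; ring,
    Complex.Gamma_add_one _ hu0, Complex.Gamma_add_one _ hv0, norm_mul, norm_mul] at h
  have hun : σ ≤ ‖u‖ := by rw [← hum]; exact (le_abs_self _).trans (Complex.abs_im_le_norm u)
  have hvn : ‖v‖ ≤ 3 * σ := by
    refine (norm_add_le _ _).trans ?_
    rw [norm_mul, Complex.norm_real, Complex.norm_real, Complex.norm_I, Real.norm_of_nonneg (by linarith),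
      Real.norm_of_nonneg (by linarith)]
    linarith
  have hGv : Complex.Gamma v ≠ 0 := Complex.Gamma_ne_zero_of_re_pos (by simp [hv]; linarith)
  rw [gammaPhase, e1, e2, Complex.Gamma_conj, norm_mul, Complex.norm_conj, norm_inv, ← div_eq_mul_inv,
    div_le_iff₀ (norm_pos_iff.2 hGv)]
  have hσ0 : 0 < σ := by linarith
  refine le_of_mul_le_mul_left ?_ hσ0
  nlinarith [norm_nonneg (Complex.Gamma u), norm_nonneg (Complex.Gamma v)]

lemma norm_gammaPhase_sub_I_le {σ : ℝ} (hσ : 1 ≤ σ) :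
    ‖gammaPhase (σ - Complex.I)‖ ≤ 1 / σ ^ 2 := by
  have hσ0 : 0 < σ := by linarith
  have hne : -(Complex.I * (σ : ℂ)) ≠ 0 :=
    neg_ne_zero.2 (mul_ne_zero Complex.I_ne_zero (by exact_mod_cast hσ0.ne'))
  have hne2 : (1 : ℂ) + Complex.I * σ ≠ 0 := fun h => by
    have := congrArg Complex.im h
    simp at this
    linarith
  have e1 : (1 : ℂ) - Complex.I * (σ - Complex.I) = -(Complex.I * σ) := by
    linear_combination Complex.I_sq
  have e2 : (1 : ℂ) + Complex.I * (σ - Complex.I) = (1 + Complex.I * σ) + 1 := by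
    linear_combination -Complex.I_sq
  have e3 : Complex.Gamma (1 - Complex.I * σ) =
      -(Complex.I * σ) * Complex.Gamma (-(Complex.I * σ)) := by
    rw [← Complex.Gamma_add_one _ hne]; ring_nf
  have hn : ‖Complex.Gamma (1 - Complex.I * σ)‖ = ‖Complex.Gamma (1 + Complex.I * σ)‖ := by
    rw [Gamma_one_sub_I_mul, Complex.norm_conj]
  rw [e3, norm_mul, norm_neg, norm_mul, Complex.norm_I, one_mul, Complex.norm_real,
    Real.norm_of_nonneg hσ0.le] at hn
  rw [gammaPhase, e1, e2, Complex.Gamma_add_one _ hne2, norm_mul, norm_inv, norm_mul, ← hn]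
  have h1 : σ ≤ ‖(1 : ℂ) + Complex.I * σ‖ := by
    have := (le_abs_self _).trans (Complex.abs_im_le_norm ((1 : ℂ) + Complex.I * σ))
    simpa using this
  have hG : 0 < ‖Complex.Gamma (-(Complex.I * (σ : ℂ)))‖ := by
    rw [norm_pos_iff]
    intro h
    rw [h, mul_zero, Gamma_one_sub_I_mul, map_eq_zero] at e3
    exact Gamma_one_add_I_mul_ne_zero σ e3
  have h2 : 0 < ‖(1 : ℂ) + Complex.I * σ‖ := by linarith
  rw [← div_eq_mul_inv, div_le_div_iff₀ (by positivity) (by positivity), one_mul]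
  nlinarith [mul_le_mul_of_nonneg_right h1 (mul_pos hσ0 hG).le]

lemma differentiableAt_gammaPhase {z : ℂ} (hz : 0 < z.re) : DifferentiableAt ℂ gammaPhase z := by
  have h1 : DifferentiableAt ℂ (fun z : ℂ => Complex.Gamma (1 - Complex.I * z)) z := by
    refine DifferentiableAt.comp z (Complex.differentiableAt_Gamma _ fun m h => ?_) (by fun_prop)
    have := congrArg Complex.im h
    simp at this
    linarith
  have h2 : DifferentiableAt ℂ (fun z : ℂ => (Complex.Gamma (1 + Complex.I * z))⁻¹) z :=
    (Complex.differentiable_one_div_Gamma _).comp z (by fun_prop)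
  exact h1.mul h2

@[fun_prop]
lemma continuous_gammaPhase : Continuous fun τ : ℝ => gammaPhase τ := by
  unfold gammaPhase
  have h1 : Continuous fun τ : ℝ => Complex.Gamma (1 - Complex.I * τ) := by
    refine continuous_iff_continuousAt.2 fun τ => ?_
    refine ContinuousAt.comp' (f := fun τ : ℝ => 1 - Complex.I * (τ : ℂ))
        (Complex.differentiableAt_Gamma _ fun m h => ?_).continuousAt (by fun_prop)
    have := congrArg Complex.re h
    simp at this
    have h0 : (0 : ℝ) ≤ m := by positivity
    linarith
  exact h1.mul (Complex.differentiable_one_div_Gamma.continuous.comp' (by fun_prop))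

/-- Oscillatory integrals of powers of `gammaPhase` stay bounded. -/
lemma norm_integral_gammaPhase_pow_le {k : ℕ} (hk1 : 1 ≤ k) (hk2 : k ≤ 2) (L : ℝ) {a b : ℝ} (ha : 1 ≤ a)
    (hab : a ≤ b) : ‖∫ τ in a..b, gammaPhase τ ^ k * Complex.exp (2 * (Complex.I * τ) * L)‖ ≤
      19 * (1 + Real.exp (2 * L)) := by
  set f : ℂ → ℂ := fun z => gammaPhase z ^ k * Complex.exp (2 * (Complex.I * z) * L) with hf
  have hd : DifferentiableOn ℂ f (uIcc ((a : ℂ) - Complex.I).re (b : ℂ).re ×ℂ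
      uIcc ((a : ℂ) - Complex.I).im (b : ℂ).im) := by
    intro z hz
    have hz1 := hz.1
    simp only [Complex.sub_re, Complex.ofReal_re, Complex.I_re, sub_zero, mem_preimage, uIcc_of_le hab] at hz1
    have : 0 < z.re := by linarith [hz1.1]
    have h1 := differentiableAt_gammaPhase this
    exact ((h1.pow k).mul (by fun_prop)).differentiableWithinAt
  have hint := Complex.integral_boundary_rect_eq_zero_of_differentiableOn f _ _ hd
  simp only [Complex.sub_re, Complex.ofReal_re, Complex.I_re, sub_zero, Complex.sub_im, Complex.ofReal_im,
    Complex.I_im, zero_sub, Complex.ofReal_zero, zero_mul, add_zero, Complex.ofReal_neg,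
    Complex.ofReal_one, neg_mul, one_mul, smul_eq_mul, ← sub_eq_add_neg] at hint
  have hexp : ∀ σ η : ℝ, 0 ≤ η → η ≤ 1 →
      ‖Complex.exp (2 * (Complex.I * (σ - η * Complex.I)) * L)‖ ≤ 1 + Real.exp (2 * L) := by
    intro σ η h0 h1
    rw [Complex.norm_exp]
    have : (2 * (Complex.I * (σ - η * Complex.I)) * L).re = 2 * L * η := by
      simp; ring
    rw [this]
    rcases le_total 0 L with h | h
    · have : Real.exp (2 * L * η) ≤ Real.exp (2 * L) := Real.exp_le_exp.2 (by nlinarith)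
      linarith
    · have : Real.exp (2 * L * η) ≤ 1 := Real.exp_le_one_iff.2 (by nlinarith)
      linarith [Real.exp_pos (2 * L)]
  set E := 1 + Real.exp (2 * L) with hE
  have hE0 : 0 < E := by positivity
  have hside : ∀ c : ℝ, 1 ≤ c → ‖∫ y in (-1 : ℝ)..0, f (c + y * Complex.I)‖ ≤ 9 * E := by
    intro c hc
    refine (intervalIntegral.norm_integral_le_of_norm_le_const (C := 9 * E) fun y hy => ?_).trans_eq
        (by norm_num)
    rw [uIoc_of_le (by norm_num)] at hy
    have e : (c : ℂ) + y * Complex.I = c - ((-y : ℝ) : ℂ) * Complex.I := by push_cast; ring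
    rw [e, hf]
    simp only
    rw [norm_mul, norm_pow]
    have h1 := norm_gammaPhase_sub_mul_I_le (η := -y) (σ := c) (by linarith [hy.2]) (by linarith [hy.1]) hc
    have h2 := hexp c (-y) (by linarith [hy.2]) (by linarith [hy.1])
    have h3 : ‖gammaPhase (c - ((-y : ℝ) : ℂ) * Complex.I)‖ ^ k ≤ 9 :=
      calc _ ≤ (3 : ℝ) ^ k := by gcongr
        _ ≤ 3 ^ 2 := by gcongr; norm_num
        _ = 9 := by norm_num
    gcongr
  have hbot : ‖∫ x in a..b, f (x - Complex.I)‖ ≤ E := by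
    have hb : ∀ x ∈ Ioc a b, ‖f (x - Complex.I)‖ ≤ E * x ^ (-2 : ℝ) := by
      intro x hx
      have hx1 : 1 ≤ x := by linarith [hx.1]
      have h1 := norm_gammaPhase_sub_I_le hx1
      have h2 := hexp x 1 zero_le_one le_rfl
      rw [Complex.ofReal_one, one_mul] at h2
      rw [hf]
      simp only
      rw [norm_mul, norm_pow, mul_comm]
      have h4 : 1 / x ^ 2 ≤ 1 := by rw [div_le_one (by positivity)]; nlinarith
      have h3 : ‖gammaPhase (x - Complex.I)‖ ^ k ≤ x ^ (-2 : ℝ) :=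
        calc ‖gammaPhase (x - Complex.I)‖ ^ k ≤ ‖gammaPhase (x - Complex.I)‖ ^ 1 :=
              pow_le_pow_of_le_one (norm_nonneg _) (h1.trans h4) hk1
          _ ≤ 1 / x ^ 2 := by rwa [pow_one]
          _ = x ^ (-2 : ℝ) := by
            rw [Real.rpow_neg (by linarith), Real.rpow_two, one_div]
      gcongr
    have h0 : (0 : ℝ) ∉ uIcc a b := by rw [uIcc_of_le hab]; intro h; linarith [h.1]
    refine (intervalIntegral.norm_integral_le_of_norm_le hab (ae_of_all _ hb)
      ((intervalIntegral.intervalIntegrable_rpow (Or.inr h0)).const_mul _)).trans ?_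
    rw [intervalIntegral.integral_const_mul, integral_rpow (Or.inr ⟨by norm_num, h0⟩)]
    norm_num
    rw [show (b ^ (-1 : ℝ) : ℝ) = b⁻¹ from Real.rpow_neg_one b, show (a ^ (-1 : ℝ) : ℝ) = a⁻¹
      from Real.rpow_neg_one a]
    have h1 : a⁻¹ ≤ 1 := inv_le_one_of_one_le₀ ha
    have h2 : 0 ≤ b⁻¹ := inv_nonneg.2 (by linarith)
    nlinarith
  have hfin : ∫ τ in a..b, f τ = (∫ x in a..b, f (x - Complex.I)) +
      Complex.I * (∫ y in (-1 : ℝ)..0, f (b + y * Complex.I)) -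
      Complex.I * ∫ y in (-1 : ℝ)..0, f (a + y * Complex.I) := by
    linear_combination -hint
  change ‖∫ τ in a..b, f τ‖ ≤ _
  rw [hfin]
  have n1 := norm_sub_le ((∫ x in a..b, f (x - Complex.I)) +
      Complex.I * (∫ y in (-1 : ℝ)..0, f (b + y * Complex.I)))
          (Complex.I * ∫ y in (-1 : ℝ)..0, f (a + y * Complex.I))
  have n2 := norm_add_le (∫ x in a..b, f (x - Complex.I))
      (Complex.I * (∫ y in (-1 : ℝ)..0, f (b + y * Complex.I)))
  have n3 := hside a ha
  have n4 := hside b (ha.trans hab)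
  rw [norm_mul, Complex.norm_I, one_mul] at n1 n2
  linarith

lemma integral_sq_inv {a b : ℝ} (ha : 0 < a) (hab : a ≤ b) : ∫ t in a..b, (t ^ 2)⁻¹ = a⁻¹ - b⁻¹ := by
  have h0 : (0 : ℝ) ∉ uIcc a b := by rw [uIcc_of_le hab]; intro h; linarith [h.1]
  have h := integral_rpow (a := a) (b := b) (r := -2) (Or.inr ⟨by norm_num, h0⟩)
  norm_num at h
  rw [Real.rpow_neg_one, Real.rpow_neg_one] at h
  rw [h]
  ring

lemma intervalIntegrable_sq_inv {a b : ℝ} (ha : 0 < a) (hab : a ≤ b) :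
    IntervalIntegrable (fun t : ℝ => (t ^ 2)⁻¹) volume a b := by
  refine ContinuousOn.intervalIntegrable fun t ht => ?_
  rw [uIcc_of_le hab] at ht
  have : t ≠ 0 := by linarith [ht.1]
  exact ((continuousAt_id.pow 2).inv₀ (pow_ne_zero 2 this)).continuousWithinAt

/-- Integration by parts: bounded primitives control `∫ g τ / τ`. -/
lemma norm_integral_div_le {g : ℝ → ℂ} (hg : Continuous g) {a b M : ℝ} (ha : 0 < a) (hab : a ≤ b)
    (hM : ∀ t ∈ Icc a b, ‖∫ τ in a..t, g τ‖ ≤ M) : ‖∫ τ in a..b, g τ / τ‖ ≤ M / a := by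
  set G : ℝ → ℂ := fun t => ∫ τ in a..t, g τ with hG
  have hGd : ∀ t, HasDerivAt G (g t) t := fun t => (hg.integral_hasStrictDerivAt a t).hasDerivAt
  have hGc : Continuous G := continuous_iff_continuousAt.2 fun t => (hGd t).continuousAt
  have hne : ∀ t ∈ uIcc a b, t ≠ 0 := fun t ht => by
    rw [uIcc_of_le hab] at ht; linarith [ht.1]
  have hu : ∀ t ∈ uIcc a b, HasDerivAt (fun t : ℝ => ((t⁻¹ : ℝ) : ℂ)) ((-(t ^ 2)⁻¹ : ℝ) : ℂ) t :=
    fun t ht => (hasDerivAt_inv (hne t ht)).ofReal_comp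
  have hi2 : IntervalIntegrable (fun t : ℝ => ((-(t ^ 2)⁻¹ : ℝ) : ℂ)) volume a b :=
    ⟨(intervalIntegrable_sq_inv ha hab).neg.1.ofReal, (intervalIntegrable_sq_inv ha hab).neg.2.ofReal⟩
  have h := intervalIntegral.integral_mul_deriv_eq_deriv_mul hu (fun t _ => hGd t) hi2
    (hg.intervalIntegrable a b)
  have e : ∀ τ : ℝ, g τ / τ = ((τ⁻¹ : ℝ) : ℂ) * g τ := fun τ => by
    push_cast; rw [div_eq_inv_mul]
  simp only [e]
  have hGa : G a = 0 := by simp [hG]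
  rw [h, hGa, mul_zero, sub_zero]
  have hb : 0 < b := by linarith
  have hM0 : 0 ≤ M := (norm_nonneg _).trans (hM a ⟨le_rfl, hab⟩)
  have h1 : ‖((b⁻¹ : ℝ) : ℂ) * G b‖ ≤ M * b⁻¹ := by
    rw [norm_mul, Complex.norm_real, Real.norm_of_nonneg (by positivity), mul_comm]
    gcongr
    exact hM b ⟨hab, le_rfl⟩
  have h2 : ‖∫ t in a..b, ((-(t ^ 2)⁻¹ : ℝ) : ℂ) * G t‖ ≤ M * (a⁻¹ - b⁻¹) := by
    rw [← integral_sq_inv ha hab, ← intervalIntegral.integral_const_mul]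
    refine intervalIntegral.norm_integral_le_of_norm_le hab (ae_of_all _ fun t ht => ?_)
      ((intervalIntegrable_sq_inv ha hab).const_mul _)
    rw [norm_mul, Complex.norm_real, norm_neg, Real.norm_of_nonneg (by positivity), mul_comm]
    gcongr
    exact hM t ⟨ht.1.le, ht.2⟩
  calc _ ≤ M * b⁻¹ + M * (a⁻¹ - b⁻¹) := (norm_sub_le _ _).trans (add_le_add h1 h2)
    _ = M / a := by ring

lemma norm_integral_exp_mul_I_le {δ : ℝ} (hδ : 0 < δ) (a b : ℝ) :
    ‖∫ τ in a..b, Complex.exp (((δ : ℂ) * Complex.I) * τ)‖ ≤ 2 / δ := by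
  have h0 : (δ : ℂ) * Complex.I ≠ 0 := mul_ne_zero (by exact_mod_cast hδ.ne') Complex.I_ne_zero
  rw [integral_exp_mul_complex h0, norm_div, norm_mul, Complex.norm_real, Complex.norm_I, mul_one,
    Real.norm_of_nonneg hδ.le]
  gcongr
  refine (norm_sub_le _ _).trans_eq ?_
  rw [Complex.norm_exp, Complex.norm_exp]
  norm_num

lemma abs_integral_sin_div_le_of_pos {δ a b : ℝ} (hδ : 0 < δ) (ha : 0 < a) (hab : a ≤ b) :
    |∫ τ in a..b, Real.sin (δ * τ) / τ| ≤ 3 := by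
  have hci : ∀ c d : ℝ, 0 < c → c ≤ d → IntervalIntegrable (fun τ => Real.sin (δ * τ) / τ) volume c d := by
    intro c d hc hcd
    refine ContinuousOn.intervalIntegrable fun t ht => ?_
    rw [uIcc_of_le hcd] at ht
    have : t ≠ 0 := by linarith [ht.1]
    exact (ContinuousAt.div (by fun_prop) continuousAt_id this).continuousWithinAt
  have hsmall : ∀ c d : ℝ, 0 < c → c ≤ d → d ≤ 1 / δ → |∫ τ in c..d, Real.sin (δ * τ) / τ| ≤ 1 := by
    intro c d hc hcd hd
    have h := intervalIntegral.norm_integral_le_of_norm_le_const (a := c) (b := d) (C := δ)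
      (f := fun τ => Real.sin (δ * τ) / τ) fun t ht => by
        rw [uIoc_of_le hcd] at ht
        have ht0 : 0 < t := by linarith [ht.1]
        rw [norm_div, Real.norm_of_nonneg ht0.le, div_le_iff₀ ht0]
        have := Real.abs_sin_le_abs (x := δ * t)
        rwa [abs_of_pos (by positivity : 0 < δ * t)] at this
    rw [Real.norm_eq_abs, abs_of_nonneg (by linarith : 0 ≤ d - c)] at h
    refine h.trans ?_
    have : δ * d ≤ 1 := by rwa [mul_comm, ← le_div_iff₀ hδ]
    nlinarith
  have hlarge : ∀ c d : ℝ, 1 / δ ≤ c → c ≤ d → |∫ τ in c..d, Real.sin (δ * τ) / τ| ≤ 2 := by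
    intro c d hc hcd
    have hc0 : 0 < c := lt_of_lt_of_le (by positivity) hc
    have h := norm_integral_div_le (g := fun τ : ℝ => Complex.exp (((δ : ℂ) * Complex.I) * τ))
      (by fun_prop) hc0 hcd (fun t _ => norm_integral_exp_mul_I_le hδ c t)
    have hii : IntervalIntegrable (fun τ : ℝ => Complex.exp (((δ : ℂ) * Complex.I) * τ) / τ) volume c d := by
      refine ContinuousOn.intervalIntegrable fun t ht => ?_
      rw [uIcc_of_le hcd] at ht
      have : (t : ℂ) ≠ 0 := by exact_mod_cast (show t ≠ 0 by linarith [ht.1])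
      exact (ContinuousAt.div (by fun_prop) Complex.continuous_ofReal.continuousAt this).continuousWithinAt
    have e : ∫ τ in c..d, Real.sin (δ * τ) / τ =
        (∫ τ in c..d, Complex.exp (((δ : ℂ) * Complex.I) * τ) / τ).im := by
      have := Complex.imCLM.intervalIntegral_comp_comm hii
      simp only [Complex.imCLM_apply] at this
      rw [← this]
      refine intervalIntegral.integral_congr fun t _ => ?_
      rw [Complex.div_ofReal_im, Complex.exp_im]
      simp
    rw [e]
    refine (Complex.abs_im_le_norm _).trans (h.trans ?_)
    rw [div_div, div_le_iff₀ (by positivity)]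
    have : 1 ≤ c * δ := by rwa [div_le_iff₀ hδ] at hc
    linarith
  rcases le_total b (1 / δ) with h | h
  · linarith [hsmall a b ha hab h]
  rcases le_total (1 / δ) a with h' | h'
  · linarith [hlarge a b h' hab]
  · have h0 : 0 < 1 / δ := by positivity
    rw [← intervalIntegral.integral_add_adjacent_intervals (hci a _ ha h') (hci _ b h0 h)]
    linarith [abs_add_le (∫ τ in a..1 / δ, Real.sin (δ * τ) / τ) (∫ τ in (1 / δ)..b, Real.sin (δ * τ) / τ),
      hsmall a _ ha h' le_rfl, hlarge _ b le_rfl h]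

lemma abs_integral_sin_div_le (δ : ℝ) {a b : ℝ} (ha : 0 < a) (hab : a ≤ b) :
    |∫ τ in a..b, Real.sin (δ * τ) / τ| ≤ 3 := by
  rcases lt_trichotomy δ 0 with h | rfl | h
  · have := abs_integral_sin_div_le_of_pos (neg_pos.2 h) ha hab
    simpa only [neg_mul, Real.sin_neg, neg_div, intervalIntegral.integral_neg, abs_neg] using this
  · simp
  · exact abs_integral_sin_div_le_of_pos h ha hab

lemma integrable_mul_besselIKKernel {g : ℝ → ℂ} (hg : Continuous g) (a b : ℝ) {y : ℝ} (hy : 0 < y) :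
    Integrable (Function.uncurry fun τ s => g τ * besselIKKernel τ y s)
      ((volume.restrict (uIoc a b)).prod (volume.restrict (Ioi (0 : ℝ)))) := by
  have hc : Continuous (Function.uncurry fun τ s => g τ * besselIKKernel τ y s) := by
    have h1 : Continuous fun p : ℝ × ℝ => besselIKKernel p.1 y p.2 := by fun_prop
    exact (hg.comp' continuous_fst).mul h1
  have hgi : Integrable (fun τ => ‖g τ‖) (volume.restrict (uIoc a b)) :=
    (hg.norm.intervalIntegrable a b).def'
  refine (hgi.mul_prod (integrableOn_besselJBound.const_mul (2 * y ^ (-(1 : ℝ) / 2)))).mono'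
    hc.aestronglyMeasurable ?_
  rw [Measure.prod_restrict]
  refine (ae_restrict_iff' (measurableSet_uIoc.prod measurableSet_Ioi)).2 (ae_of_all _ fun p hp => ?_)
  rw [Function.uncurry, norm_mul]
  exact mul_le_mul_of_nonneg_left (norm_besselIKKernel_le _ hy hp.2) (norm_nonneg _)

lemma integral_mul_besselIK {g : ℝ → ℂ} (hg : Continuous g) (a b : ℝ) {y : ℝ} (hy : 0 < y) :
    ∫ τ in a..b, g τ * besselIK τ y = ∫ s in Ioi (0 : ℝ), (reducedJ (y ^ 2 * Real.sinh s ^ 2) : ℂ) *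
      ∫ τ in a..b, g τ * Complex.exp (-(2 * (Complex.I * τ) * s)) := by
  have h := intervalIntegral_integral_swap (integrable_mul_besselIKKernel hg a b hy)
  simp only [integral_const_mul, integral_besselIKKernel _ hy] at h
  rw [h]
  refine integral_congr_ae (ae_of_all _ fun s => ?_)
  simp only
  rw [← intervalIntegral.integral_const_mul]
  refine intervalIntegral.integral_congr fun τ _ => ?_
  simp only [besselIKKernel]
  ring

lemma norm_integral_mul_besselIK_le {g : ℝ → ℂ} (hg : Continuous g) (a b : ℝ) {y M : ℝ} (hy : 0 < y)
    (hM : ∀ s : ℝ, 0 < s → ‖∫ τ in a..b, g τ * Complex.exp (-(2 * (Complex.I * τ) * s))‖ ≤ M) :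
    ‖∫ τ in a..b, g τ * besselIK τ y‖ ≤ M * (besselIKBound * y ^ (-(1 : ℝ) / 2)) := by
  rw [integral_mul_besselIK hg a b hy]
  have hM0 : 0 ≤ M := (norm_nonneg _).trans (hM 1 one_pos)
  refine (norm_integral_le_of_norm_le
    (integrableOn_besselJBound.const_mul (M * (2 * y ^ (-(1 : ℝ) / 2))))
    ((ae_restrict_iff' measurableSet_Ioi).2 (ae_of_all _ fun s hs => ?_))).trans_eq ?_
  · rw [norm_mul, Complex.norm_real, Real.norm_eq_abs, mul_comm]
    calc _ ≤ M * (2 * y ^ (-(1 : ℝ) / 2) * besselJBound s) := by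
          gcongr
          · exact hM s hs
          · exact abs_reducedJ_sinh_le hy hs
      _ = _ := by ring
  · rw [integral_const_mul, besselIKBound]
    ring

/-- Integrated decay of `besselIK` in the order. -/
lemma norm_integral_besselIK_le {y T : ℝ} (hy : 0 < y) (hT : 1 ≤ T) :
    ‖∫ τ in (1 : ℝ)..T, besselIK τ y‖ ≤ 8 * y ^ (-(1 : ℝ) / 2) * T ^ ((1 : ℝ) / 2) := by
  have hT0 : 0 < T := by linarith
  have h := integral_mul_besselIK (g := fun _ => 1) continuous_const 1 T hy
  simp only [one_mul] at h
  rw [h]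
  set Y := y ^ (-(1 : ℝ) / 2) with hY
  have hY0 : 0 < Y := by positivity
  set F : ℝ → ℂ := fun s => (reducedJ (y ^ 2 * Real.sinh s ^ 2) : ℂ) *
      ∫ τ in (1 : ℝ)..T, Complex.exp (-(2 * (Complex.I * τ) * s)) with hF
  have hJ : ∀ s, 0 < s → ‖(reducedJ (y ^ 2 * Real.sinh s ^ 2) : ℂ)‖ ≤ 2 * Y * s ^ (-(1 : ℝ) / 2) := by
    intro s hs
    rw [Complex.norm_real, Real.norm_eq_abs]
    refine (abs_reducedJ_sinh_le hy hs).trans ?_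
    rw [besselJBound]
    have : Real.exp (-(1 / 4) * s) ≤ 1 := Real.exp_le_one_iff.2 (by linarith)
    have h2 : 0 ≤ s ^ (-(1 : ℝ) / 2) := by positivity
    gcongr
    nlinarith
  have hE1 : ∀ s : ℝ, ‖∫ τ in (1 : ℝ)..T, Complex.exp (-(2 * (Complex.I * τ) * s))‖ ≤ T := by
    intro s
    refine (intervalIntegral.norm_integral_le_of_norm_le_const (C := 1) fun τ _ =>
      (norm_exp_neg_two_I_mul τ s).le).trans ?_
    rw [abs_of_nonneg (by linarith)]
    linarith
  have hE2 : ∀ s : ℝ, 0 < s → ‖∫ τ in (1 : ℝ)..T, Complex.exp (-(2 * (Complex.I * τ) * s))‖ ≤ s⁻¹ := by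
    intro s hs
    have h0 : -(2 * Complex.I * (s : ℂ)) ≠ 0 :=
      neg_ne_zero.2 (mul_ne_zero (mul_ne_zero two_ne_zero Complex.I_ne_zero) (by exact_mod_cast hs.ne'))
    have e : ∀ τ : ℝ, -(2 * (Complex.I * τ) * (s : ℂ)) = -(2 * Complex.I * (s : ℂ)) * τ := fun τ => by ring
    have hn : ∀ τ : ℝ, ‖Complex.exp (-(2 * Complex.I * (s : ℂ)) * τ)‖ = 1 := fun τ => by
      rw [← e, norm_exp_neg_two_I_mul]
    simp only [e]
    rw [integral_exp_mul_complex h0, norm_div, norm_neg, norm_mul, norm_mul, Complex.norm_real,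
      Complex.norm_I,
      Complex.norm_ofNat, mul_one, Real.norm_of_nonneg hs.le, div_le_iff₀ (by positivity)]
    refine (norm_sub_le _ _).trans_eq ?_
    rw [hn, hn]
    field_simp
    norm_num
  have hFc : Continuous F := by
    have h1 : Continuous fun s => reducedJ (y ^ 2 * Real.sinh s ^ 2) :=
      continuous_reducedJ.comp' (continuous_const.mul (Real.continuous_sinh.pow 2))
    have h2 : Continuous fun s : ℝ => ∫ τ in (1 : ℝ)..T, Complex.exp (-(2 * (Complex.I * τ) * s)) :=
      intervalIntegral.continuous_parametric_intervalIntegral_of_continuous' (by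
        simp only [Function.uncurry_def]
        fun_prop) _ _
    exact (Complex.continuous_ofReal.comp' h1).mul h2
  set c := T⁻¹ with hc
  have hc0 : 0 < c := by positivity
  have hi1 : IntegrableOn (fun s : ℝ => 2 * Y * T * s ^ (-(1 : ℝ) / 2)) (Ioc 0 c) :=
    ((intervalIntegrable_iff_integrableOn_Ioc_of_le hc0.le).1
      (intervalIntegral.intervalIntegrable_rpow' (by norm_num))).const_mul _
  have hi2 : IntegrableOn (fun s : ℝ => 2 * Y * s ^ (-(3 : ℝ) / 2)) (Ioi c) :=
    (integrableOn_Ioi_rpow_of_lt (by norm_num) hc0).const_mul _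
  have hb1 : ∀ᵐ s ∂volume.restrict (Ioc 0 c), ‖F s‖ ≤ 2 * Y * T * s ^ (-(1 : ℝ) / 2) := by
    refine (ae_restrict_iff' measurableSet_Ioc).2 (ae_of_all _ fun s hs => ?_)
    rw [hF, norm_mul]
    calc _ ≤ 2 * Y * s ^ (-(1 : ℝ) / 2) * T := by
          have := hJ s hs.1
          have := hE1 s
          have := Real.rpow_nonneg hs.1.le (-(1 : ℝ) / 2)
          gcongr
      _ = _ := by ring
  have hb2 : ∀ᵐ s ∂volume.restrict (Ioi c), ‖F s‖ ≤ 2 * Y * s ^ (-(3 : ℝ) / 2) := by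
    refine (ae_restrict_iff' measurableSet_Ioi).2 (ae_of_all _ fun s hs => ?_)
    have hs0 : 0 < s := hc0.trans hs
    rw [hF, norm_mul]
    calc _ ≤ 2 * Y * s ^ (-(1 : ℝ) / 2) * s⁻¹ := by
          have := hJ s hs0
          have := hE2 s hs0
          have := Real.rpow_nonneg hs0.le (-(1 : ℝ) / 2)
          gcongr
      _ = _ := by
          rw [mul_assoc (2 * Y), ← Real.rpow_neg_one, ← Real.rpow_add hs0]
          norm_num
  have hF1 : IntegrableOn F (Ioc 0 c) := Integrable.mono' hi1 hFc.aestronglyMeasurable hb1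
  have hF2 : IntegrableOn F (Ioi c) := Integrable.mono' hi2 hFc.aestronglyMeasurable hb2
  have hTc : T * c ^ ((1 : ℝ) / 2) = T ^ ((1 : ℝ) / 2) := by
    rw [hc, Real.inv_rpow hT0.le, ← div_eq_mul_inv, div_eq_iff (by positivity), ← Real.rpow_add hT0]
    norm_num
  have hTc2 : c ^ (-(1 : ℝ) / 2) = T ^ ((1 : ℝ) / 2) := by
    rw [hc, Real.inv_rpow hT0.le, ← Real.rpow_neg hT0.le]
    norm_num
  change ‖∫ s in Ioi (0 : ℝ), F s‖ ≤ _
  rw [← Ioc_union_Ioi_eq_Ioi hc0.le, setIntegral_union Ioc_disjoint_Ioi_same measurableSet_Ioi hF1 hF2]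
  have n1 := norm_integral_le_of_norm_le hi1 hb1
  have n2 := norm_integral_le_of_norm_le hi2 hb2
  have i1 : ∫ s in Ioc 0 c, s ^ (-(1 : ℝ) / 2) = 2 * c ^ ((1 : ℝ) / 2) := by
    rw [← intervalIntegral.integral_of_le hc0.le, integral_rpow (Or.inl (by norm_num)),
      Real.zero_rpow (by norm_num)]
    norm_num
    ring
  have i2 : ∫ s in Ioi c, s ^ (-(3 : ℝ) / 2) = 2 * c ^ (-(1 : ℝ) / 2) := by
    rw [integral_Ioi_rpow_of_lt (by norm_num) hc0]
    norm_num
    ring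
  rw [integral_const_mul, i1] at n1
  rw [integral_const_mul, i2, hTc2] at n2
  rw [show 2 * Y * T * (2 * c ^ ((1 : ℝ) / 2)) = 4 * Y * (T * c ^ ((1 : ℝ) / 2)) by ring, hTc] at n1
  linarith [norm_add_le (∫ s in Ioc 0 c, F s) (∫ s in Ioi c, F s)]

/-- The kernel of the truncated expansion, up to the factor `-2π`. -/
noncomputable def lebedevKernel (x y τ : ℝ) : ℝ := τ * (besselIK τ x).im * (besselIK τ y).re

@[fun_prop]
lemma continuous_besselPhase (L : ℝ) : Continuous (besselPhase L) := by
  unfold besselPhase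
  fun_prop

lemma continuous_besselRemainder {y : ℝ} (hy : 0 < y) : Continuous fun τ => besselRemainder τ y := by
  have := continuous_besselIK_left hy
  unfold besselRemainder
  fun_prop

lemma continuous_lebedevKernel {x y : ℝ} (hx : 0 < x) (hy : 0 < y) : Continuous (lebedevKernel x y) := by
  have h1 := continuous_besselIK_left hx
  have h2 := continuous_besselIK_left hy
  exact (continuous_id.mul (Complex.continuous_im.comp' h1)).mul (Complex.continuous_re.comp' h2)

lemma two_mul_im_besselIK (τ y : ℝ) : 2 * τ * (besselIK τ y).im =
    (besselPhase (Real.log (y / 2)) τ).re - 1 + (besselRemainder τ y).im := by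
  have h : ((2 * τ : ℝ) : ℂ) * besselIK τ y = Complex.I * (besselPhase (Real.log (y / 2)) τ - 1) +
      besselRemainder τ y := by
    rw [besselRemainder]; push_cast; ring
  have := congrArg Complex.im h
  rw [Complex.im_ofReal_mul] at this
  simpa using this

lemma two_mul_re_besselIK (τ y : ℝ) : 2 * τ * (besselIK τ y).re =
    -(besselPhase (Real.log (y / 2)) τ).im + (besselRemainder τ y).re := by
  have h : ((2 * τ : ℝ) : ℂ) * besselIK τ y = Complex.I * (besselPhase (Real.log (y / 2)) τ - 1) +
      besselRemainder τ y := by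
    rw [besselRemainder]; push_cast; ring
  have := congrArg Complex.re h
  rw [Complex.re_ofReal_mul] at this
  simpa using this

lemma abs_integral_im_le {f : ℝ → ℂ} {a b : ℝ} (hf : IntervalIntegrable f volume a b) :
    |∫ τ in a..b, (f τ).im| ≤ ‖∫ τ in a..b, f τ‖ := by
  have h : ∫ τ in a..b, (f τ).im = (∫ τ in a..b, f τ).im := Complex.imCLM.intervalIntegral_comp_comm hf
  rw [h]
  exact Complex.abs_im_le_norm _

lemma abs_integral_re_le {f : ℝ → ℂ} {a b : ℝ} (hf : IntervalIntegrable f volume a b) :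
    |∫ τ in a..b, (f τ).re| ≤ ‖∫ τ in a..b, f τ‖ := by
  have h : ∫ τ in a..b, (f τ).re = (∫ τ in a..b, f τ).re := Complex.reCLM.intervalIntegral_comp_comm hf
  rw [h]
  exact Complex.abs_re_le_norm _

lemma exp_two_mul_log {c : ℝ} (hc : 0 < c) : Real.exp (2 * Real.log c) = c ^ 2 := by
  rw [two_mul, Real.exp_add, Real.exp_log hc, sq]

lemma rpow_neg_half_mul_one_add {y : ℝ} (hy : 0 < y) :
    y ^ (-(1 : ℝ) / 2) * (1 + y) = y ^ (-(1 : ℝ) / 2) + y ^ ((1 : ℝ) / 2) := by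
  rw [mul_add, mul_one]
  congr 1
  nth_rw 2 [← Real.rpow_one y]
  rw [← Real.rpow_add hy]
  norm_num

lemma one_le_rpow_add_rpow {y : ℝ} (hy : 0 < y) : 1 ≤ y ^ (-(1 : ℝ) / 2) + y ^ ((1 : ℝ) / 2) := by
  have h1 : 0 < y ^ (-(1 : ℝ) / 2) := by positivity
  have h2 : 0 < y ^ ((1 : ℝ) / 2) := by positivity
  rcases le_total y 1 with h | h
  · have := Real.one_le_rpow_of_pos_of_le_one_of_nonpos hy h (by norm_num : -(1 : ℝ) / 2 ≤ 0)
    linarith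
  · have := Real.one_le_rpow h (by norm_num : (0 : ℝ) ≤ 1 / 2)
    linarith

lemma abs_lebedevKernel_le {x y τ : ℝ} (hx : 0 < x) (hy : 0 < y) (hτ : 0 ≤ τ) : |lebedevKernel x y τ| ≤
    τ * (besselIKBound * x ^ (-(1 : ℝ) / 2)) * (besselIKBound * y ^ (-(1 : ℝ) / 2)) := by
  rw [lebedevKernel, abs_mul, abs_mul, abs_of_nonneg hτ]
  have h1 := (Complex.abs_im_le_norm _).trans (norm_besselIK_le τ hx)
  have h2 := (Complex.abs_re_le_norm _).trans (norm_besselIK_le τ hy)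
  have := besselIKBound_nonneg
  gcongr

lemma norm_integral_besselPhase_mul_besselIK_le (L : ℝ) {y T : ℝ} (hy : 0 < y) (hT : 1 ≤ T) :
    ‖∫ τ in (1 : ℝ)..T, besselPhase L τ * besselIK τ y‖ ≤
      19 * (1 + Real.exp (2 * L)) * (besselIKBound * y ^ (-(1 : ℝ) / 2)) := by
  refine norm_integral_mul_besselIK_le (continuous_besselPhase L) _ _ hy fun s hs => ?_
  have h := norm_integral_gammaPhase_pow_le le_rfl one_le_two (L - s) le_rfl hT
  have e : ∀ τ : ℝ, besselPhase L τ * Complex.exp (-(2 * (Complex.I * τ) * s)) =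
      gammaPhase τ ^ 1 * Complex.exp (2 * (Complex.I * τ) * ((L - s : ℝ) : ℂ)) := by
    intro τ
    rw [besselPhase, mul_assoc, ← Complex.exp_add, pow_one]
    congr 2
    push_cast
    ring
  simp only [e]
  refine h.trans ?_
  have : Real.exp (2 * (L - s)) ≤ Real.exp (2 * L) := Real.exp_le_exp.2 (by linarith)
  gcongr

lemma exists_abs_integral_lebedevKernel_mid_le {x : ℝ} (hx : 0 < x) : ∃ C, 0 ≤ C ∧ ∀ y T : ℝ, 0 < y → 1 ≤ T →
    T ≤ max 1 (y ^ 2) →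
      |∫ τ in (1 : ℝ)..T, lebedevKernel x y τ| ≤ C * (y ^ (-(1 : ℝ) / 2) + y ^ ((1 : ℝ) / 2)) := by
  obtain ⟨C, hC0, hC⟩ := exists_norm_besselRemainder_le hx
  set L := Real.log (x / 2) with hL
  set K := besselIKBound with hK
  have hK0 : 0 ≤ K := besselIKBound_nonneg
  refine ⟨1 / 2 * (19 * (1 + Real.exp (2 * L)) * K + 16 + 2 * C * K), by positivity,
    fun y T hy hT hTy => ?_⟩
  have hT0 : 0 < T := by linarith
  set W := y ^ (-(1 : ℝ) / 2) + y ^ ((1 : ℝ) / 2) with hW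
  have hY0 : 0 < y ^ (-(1 : ℝ) / 2) := by positivity
  have hY1 : 0 < y ^ ((1 : ℝ) / 2) := by positivity
  have hYW : y ^ (-(1 : ℝ) / 2) ≤ W := by linarith
  have hsqrt : T ^ ((1 : ℝ) / 2) ≤ 1 + y := by
    rw [← Real.sqrt_eq_rpow, Real.sqrt_le_left (by linarith)]
    refine hTy.trans (max_le ?_ ?_) <;> nlinarith
  have hWy : y ^ (-(1 : ℝ) / 2) * T ^ ((1 : ℝ) / 2) ≤ W := by
    rw [hW, ← rpow_neg_half_mul_one_add hy]
    gcongr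
  have hB : Continuous fun τ => besselIK τ y := continuous_besselIK_left hy
  have hδ : Continuous fun τ => besselRemainder τ x := continuous_besselRemainder hx
  have hp : Continuous (besselPhase L) := continuous_besselPhase L
  have hBi := hB.intervalIntegrable (μ := volume) 1 T
  have hBn : ‖∫ τ in (1 : ℝ)..T, besselIK τ y‖ ≤ 8 * W := by
    have := norm_integral_besselIK_le hy hT
    linarith
  have t1 : |∫ τ in (1 : ℝ)..T, (besselPhase L τ * besselIK τ y).re| ≤
      19 * (1 + Real.exp (2 * L)) * (K * W) :=
    calc _ ≤ _ := abs_integral_re_le ((hp.mul hB).intervalIntegrable _ _)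
      _ ≤ _ := norm_integral_besselPhase_mul_besselIK_le L hy hT
      _ ≤ _ := by gcongr
  have t2 : |∫ τ in (1 : ℝ)..T, (besselPhase L τ).im * (besselIK τ y).im| ≤ 8 * W := by
    have h1 : |∫ τ in (1 : ℝ)..T, (besselPhase L τ).im * (besselIK τ y).im| ≤
        ∫ τ in (1 : ℝ)..T, -(besselIK τ y).im := by
      rw [← Real.norm_eq_abs]
      refine intervalIntegral.norm_integral_le_of_norm_le hT (ae_of_all _ fun τ hτ => ?_)
        ((Complex.continuous_im.comp' hB).neg.intervalIntegrable _ _)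
      have h2 := im_besselIK_nonpos (by linarith [hτ.1] : 0 ≤ τ) hy
      rw [norm_mul, Real.norm_eq_abs, Real.norm_eq_abs, abs_of_nonpos h2]
      have h3 := (Complex.abs_im_le_norm _).trans_eq (norm_besselPhase L τ)
      nlinarith
    rw [intervalIntegral.integral_neg] at h1
    linarith [neg_abs_le (∫ τ in (1 : ℝ)..T, (besselIK τ y).im), abs_integral_im_le hBi]
  have t3 : |∫ τ in (1 : ℝ)..T, (besselIK τ y).re| ≤ 8 * W := (abs_integral_re_le hBi).trans hBn
  have t4 : |∫ τ in (1 : ℝ)..T, (besselRemainder τ x).im * (besselIK τ y).re| ≤ 2 * C * (K * W) := by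
    have h1 : |∫ τ in (1 : ℝ)..T, (besselRemainder τ x).im * (besselIK τ y).re| ≤
        ∫ τ in (1 : ℝ)..T, C * (K * y ^ (-(1 : ℝ) / 2)) * τ⁻¹ := by
      rw [← Real.norm_eq_abs]
      refine intervalIntegral.norm_integral_le_of_norm_le hT (ae_of_all _ fun τ hτ => ?_) ?_
      · rw [norm_mul, Real.norm_eq_abs, Real.norm_eq_abs]
        have h2 := (Complex.abs_im_le_norm _).trans (hC τ hτ.1.le)
        have h3 := (Complex.abs_re_le_norm _).trans (norm_besselIK_le τ hy)
        calc _ ≤ C / τ * (K * y ^ (-(1 : ℝ) / 2)) := by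
              have : 0 ≤ C / τ := (abs_nonneg _).trans h2
              gcongr
          _ = _ := by ring
      · refine (intervalIntegrable_inv_iff.2 (Or.inr ?_)).const_mul _
        rw [uIcc_of_le hT]
        intro h
        linarith [h.1]
    rw [intervalIntegral.integral_const_mul, integral_inv_of_pos one_pos hT0, div_one] at h1
    have h2 : Real.log T ≤ 2 * T ^ ((1 : ℝ) / 2) := by
      have := Real.log_le_rpow_div hT0.le (by norm_num : (0 : ℝ) < 1 / 2)
      linarith
    calc _ ≤ _ := h1
      _ ≤ C * (K * y ^ (-(1 : ℝ) / 2)) * (2 * T ^ ((1 : ℝ) / 2)) := by gcongr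
      _ = 2 * C * (K * (y ^ (-(1 : ℝ) / 2) * T ^ ((1 : ℝ) / 2))) := by ring
      _ ≤ _ := by gcongr
  have i1 : IntervalIntegrable (fun τ => (besselPhase L τ * besselIK τ y).re) volume 1 T :=
    (Complex.continuous_re.comp' (hp.mul hB)).intervalIntegrable _ _
  have i2 : IntervalIntegrable (fun τ => (besselPhase L τ).im * (besselIK τ y).im) volume 1 T :=
    ((Complex.continuous_im.comp' hp).mul (Complex.continuous_im.comp' hB)).intervalIntegrable _ _
  have i3 : IntervalIntegrable (fun τ => (besselIK τ y).re) volume 1 T :=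
    (Complex.continuous_re.comp' hB).intervalIntegrable _ _
  have i4 : IntervalIntegrable (fun τ => (besselRemainder τ x).im * (besselIK τ y).re) volume 1 T :=
    ((Complex.continuous_im.comp' hδ).mul (Complex.continuous_re.comp' hB)).intervalIntegrable _ _
  have e : ∫ τ in (1 : ℝ)..T, lebedevKernel x y τ =
      1 / 2 * ((∫ τ in (1 : ℝ)..T, (besselPhase L τ * besselIK τ y).re) +
        (∫ τ in (1 : ℝ)..T, (besselPhase L τ).im * (besselIK τ y).im) -
        (∫ τ in (1 : ℝ)..T, (besselIK τ y).re) +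
        ∫ τ in (1 : ℝ)..T, (besselRemainder τ x).im * (besselIK τ y).re) := by
    rw [← intervalIntegral.integral_add i1 i2, ← intervalIntegral.integral_sub (i1.add i2) i3,
      ← intervalIntegral.integral_add ((i1.add i2).sub i3) i4, ← intervalIntegral.integral_const_mul]
    refine intervalIntegral.integral_congr fun τ _ => ?_
    have := two_mul_im_besselIK τ x
    rw [← hL] at this
    simp only [lebedevKernel, Complex.mul_re]
    linear_combination 1 / 2 * (besselIK τ y).re * this
  rw [e, abs_mul, abs_of_pos (by norm_num : (0 : ℝ) < 1 / 2)]
  have := abs_add_le ((∫ τ in (1 : ℝ)..T, (besselPhase L τ * besselIK τ y).re) +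
        (∫ τ in (1 : ℝ)..T, (besselPhase L τ).im * (besselIK τ y).im) -
        (∫ τ in (1 : ℝ)..T, (besselIK τ y).re))
        (∫ τ in (1 : ℝ)..T, (besselRemainder τ x).im * (besselIK τ y).re)
  have := abs_sub ((∫ τ in (1 : ℝ)..T, (besselPhase L τ * besselIK τ y).re) +
        (∫ τ in (1 : ℝ)..T, (besselPhase L τ).im * (besselIK τ y).im))
        (∫ τ in (1 : ℝ)..T, (besselIK τ y).re)
  have := abs_add_le (∫ τ in (1 : ℝ)..T, (besselPhase L τ * besselIK τ y).re)
        (∫ τ in (1 : ℝ)..T, (besselPhase L τ).im * (besselIK τ y).im)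
  linarith

lemma norm_integral_besselPhase_div_le (L : ℝ) {a b : ℝ} (ha : 1 ≤ a) (hab : a ≤ b) :
    ‖∫ τ in a..b, besselPhase L τ / τ‖ ≤ 19 * (1 + Real.exp (2 * L)) / a := by
  refine norm_integral_div_le (continuous_besselPhase L) (by linarith) hab fun t ht => ?_
  have := norm_integral_gammaPhase_pow_le le_rfl one_le_two L ha ht.1
  simp only [pow_one] at this
  exact this

lemma norm_integral_besselPhase_mul_div_le (L L' : ℝ) {a b : ℝ} (ha : 1 ≤ a) (hab : a ≤ b) :
    ‖∫ τ in a..b, besselPhase L τ * besselPhase L' τ / τ‖ ≤ 19 * (1 + Real.exp (2 * (L + L'))) / a := by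
  refine norm_integral_div_le (g := fun τ => besselPhase L τ * besselPhase L' τ)
      ((continuous_besselPhase L).mul (continuous_besselPhase L')) (by linarith)
    hab fun t ht => ?_
  have := norm_integral_gammaPhase_pow_le one_le_two le_rfl (L + L') ha ht.1
  refine le_of_eq_of_le ?_ this
  congr 1
  refine intervalIntegral.integral_congr fun τ _ => ?_
  simp only [besselPhase]
  rw [show 2 * (Complex.I * (τ : ℂ)) * ((L + L' : ℝ) : ℂ) =
    2 * (Complex.I * τ) * L + 2 * (Complex.I * τ) * L' by push_cast; ring, Complex.exp_add]
  ring

lemma im_besselPhase_mul_re (L L' τ : ℝ) : 2 * ((besselPhase L τ).re * (besselPhase L' τ).im) =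
    (besselPhase L τ * besselPhase L' τ).im + Real.sin (2 * (L' - L) * τ) := by
  have h : besselPhase L' τ * starRingEnd ℂ (besselPhase L τ) =
      Complex.exp (((2 * (L' - L) * τ : ℝ) : ℂ) * Complex.I) := by
    have h1 : gammaPhase τ * starRingEnd ℂ (gammaPhase τ) = 1 := by
      rw [Complex.mul_conj, Complex.normSq_eq_norm_sq, norm_gammaPhase]
      norm_num
    rw [besselPhase, besselPhase, map_mul, ← Complex.exp_conj, mul_mul_mul_comm, h1, one_mul,
      ← Complex.exp_add]
    congr 1
    simp [map_ofNat]
    ring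
  have h2 := congrArg Complex.im h
  rw [Complex.exp_ofReal_mul_I_im] at h2
  rw [← h2]
  simp
  ring

lemma exists_abs_integral_lebedevKernel_tail_le {x : ℝ} (hx : 0 < x) : ∃ C, 0 ≤ C ∧ ∀ y T N : ℝ,
    0 < y → 1 ≤ T →
    y ^ 2 ≤ T → T ≤ N → |∫ τ in T..N, lebedevKernel x y τ| ≤ C := by
  obtain ⟨C, hC0, hC⟩ := exists_norm_besselRemainder_le hx
  set L := Real.log (x / 2) with hL
  refine ⟨1 / 4 * (19 * (1 + 1 / 4) + 1 / 2 * (19 * (1 + x ^ 2 / 16)) + 3 / 2) + (5 + 4 * C) / 4,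
    by positivity,
    fun y T N hy hT hyT hTN => ?_⟩
  have hT0 : 0 < T := by linarith
  set L' := Real.log (y / 2) with hL'
  have hexp' : Real.exp (2 * L') = y ^ 2 / 4 := by
    rw [hL', exp_two_mul_log (by positivity)]; ring
  have hexp : Real.exp (2 * (L + L')) = x ^ 2 * y ^ 2 / 16 := by
    rw [mul_add, Real.exp_add, hexp', hL, exp_two_mul_log (by positivity)]; ring
  have hne : ∀ t ∈ uIcc T N, t ≠ 0 := fun t ht => by
    rw [uIcc_of_le hTN] at ht; linarith [ht.1]
  have hdiv : ∀ g : ℝ → ℂ, Continuous g → IntervalIntegrable (fun τ => g τ / τ) volume T N := by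
    intro g hg
    refine ContinuousOn.intervalIntegrable fun t ht => ?_
    have : (t : ℂ) ≠ 0 := by exact_mod_cast hne t ht
    exact (hg.continuousAt.div Complex.continuous_ofReal.continuousAt this).continuousWithinAt
  have j1 := hdiv _ (continuous_besselPhase L')
  have j2 := hdiv (fun τ => besselPhase L τ * besselPhase L' τ)
      ((continuous_besselPhase L).mul (continuous_besselPhase L'))
  have i1 : IntervalIntegrable (fun τ : ℝ => (besselPhase L' τ / τ).im) volume T N := ⟨j1.1.im, j1.2.im⟩
  have i2 : IntervalIntegrable (fun τ : ℝ => (besselPhase L τ * besselPhase L' τ / τ).im) volume T N :=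
    ⟨j2.1.im, j2.2.im⟩
  have i3 : IntervalIntegrable (fun τ : ℝ => Real.sin (2 * (L' - L) * τ) / τ) volume T N := by
    refine ContinuousOn.intervalIntegrable fun t ht => ?_
    exact (ContinuousAt.div (by fun_prop) continuousAt_id (hne t ht)).continuousWithinAt
  have i0 := (continuous_lebedevKernel hx hy).intervalIntegrable (μ := volume) T N
  have t1 : |∫ τ in T..N, (besselPhase L' τ / τ).im| ≤ 19 * (1 + 1 / 4) := by
    refine (abs_integral_im_le j1).trans ((norm_integral_besselPhase_div_le L' hT hTN).trans ?_)
    rw [hexp', div_le_iff₀ hT0]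
    nlinarith
  have t2 : |∫ τ in T..N, (besselPhase L τ * besselPhase L' τ / τ).im| ≤ 19 * (1 + x ^ 2 / 16) := by
    refine (abs_integral_im_le j2).trans ((norm_integral_besselPhase_mul_div_le L L' hT hTN).trans ?_)
    rw [hexp, div_le_iff₀ hT0]
    nlinarith [mul_le_mul_of_nonneg_left hyT (sq_nonneg x)]
  have t3 := abs_integral_sin_div_le (2 * (L' - L)) hT0 hTN
  set E : ℝ → ℝ := fun τ => lebedevKernel x y τ - 1 / 4 * ((besselPhase L' τ / τ).im -
    1 / 2 * (besselPhase L τ * besselPhase L' τ / τ).im - 1 / 2 * (Real.sin (2 * (L' - L) * τ) / τ)) with hE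
  have i4 : IntervalIntegrable (fun τ : ℝ => 1 / 4 * ((besselPhase L' τ / τ).im -
    1 / 2 * (besselPhase L τ * besselPhase L' τ / τ).im - 1 / 2 *
        (Real.sin (2 * (L' - L) * τ) / τ))) volume T N :=
    ((i1.sub (i2.const_mul _)).sub (i3.const_mul _)).const_mul _
  have hEeq : ∫ τ in T..N, E τ = (∫ τ in T..N, lebedevKernel x y τ) - 1 / 4 *
      ((∫ τ in T..N, (besselPhase L' τ / τ).im) -
      1 / 2 * (∫ τ in T..N, (besselPhase L τ * besselPhase L' τ / τ).im) -
      1 / 2 * ∫ τ in T..N, Real.sin (2 * (L' - L) * τ) / τ) := by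
    rw [hE, intervalIntegral.integral_sub i0 i4, intervalIntegral.integral_const_mul,
      intervalIntegral.integral_sub (i1.sub (i2.const_mul _)) (i3.const_mul _),
      intervalIntegral.integral_sub i1 (i2.const_mul _), intervalIntegral.integral_const_mul,
      intervalIntegral.integral_const_mul]
  have hEb : |∫ τ in T..N, E τ| ≤ (5 + 4 * C) / 4 := by
    have h1 : |∫ τ in T..N, E τ| ≤ ∫ τ in T..N, (5 * y ^ 2 + 4 * C) / 4 * (τ ^ 2)⁻¹ := by
      rw [← Real.norm_eq_abs]
      refine intervalIntegral.norm_integral_le_of_norm_le hTN (ae_of_all _ fun τ hτ => ?_)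
        ((intervalIntegrable_sq_inv hT0 hTN).const_mul _)
      have hτ0 : 0 < τ := by linarith [hτ.1]
      have a1 := two_mul_im_besselIK τ x
      have a2 := two_mul_re_besselIK τ y
      have a3 := im_besselPhase_mul_re L L' τ
      rw [← hL] at a1
      rw [← hL'] at a2
      have e1 : E τ = 1 / (4 * τ) * (((besselPhase L τ).re - 1) * (besselRemainder τ y).re +
          (besselRemainder τ x).im * (-(besselPhase L' τ).im + (besselRemainder τ y).re)) := by
        simp only [hE, lebedevKernel, Complex.div_ofReal_im]
        generalize Real.sin (2 * (L' - L) * τ) = S at a3 ⊢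
        field_simp
        linear_combination 2 * (2 * τ * (besselIK τ y).re) * a1 + 2 *
            ((besselPhase L τ).re - 1 + (besselRemainder τ x).im) * a2 - a3
      have b1 : |(besselPhase L τ).re - 1| ≤ 2 := by
        have := abs_le.1 ((Complex.abs_re_le_norm _).trans_eq (norm_besselPhase L τ))
        rw [abs_le]; constructor <;> linarith [this.1, this.2]
      have b2 : |(besselRemainder τ y).re| ≤ 5 / 2 * y ^ 2 / τ :=
        (Complex.abs_re_le_norm _).trans (norm_besselRemainder_le_of_sq_le hτ0 hy (by linarith [hτ.1]))
      have b3 : |(besselRemainder τ x).im| ≤ C / τ :=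
        (Complex.abs_im_le_norm _).trans (hC τ (by linarith [hτ.1]))
      have b4 : |-(besselPhase L' τ).im + (besselRemainder τ y).re| ≤ 4 := by
        refine (abs_add_le _ _).trans ?_
        rw [abs_neg]
        have h2 := (Complex.abs_im_le_norm _).trans_eq (norm_besselPhase L' τ)
        have h3 : 5 / 2 * y ^ 2 / τ ≤ 5 / 2 := by rw [div_le_iff₀ hτ0]; linarith [hτ.1]
        linarith
      rw [e1, Real.norm_eq_abs, abs_mul, abs_of_pos (by positivity : 0 < 1 / (4 * τ))]
      calc _ ≤ 1 / (4 * τ) * (2 * (5 / 2 * y ^ 2 / τ) + C / τ * 4) := by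
            gcongr
            refine (abs_add_le _ _).trans ?_
            rw [abs_mul, abs_mul]
            gcongr
        _ = _ := by field_simp
    rw [intervalIntegral.integral_const_mul, integral_sq_inv hT0 hTN] at h1
    refine h1.trans ?_
    have h2 : T⁻¹ - N⁻¹ ≤ T⁻¹ := by linarith [inv_nonneg.2 (hT0.le.trans hTN)]
    calc _ ≤ (5 * y ^ 2 + 4 * C) / 4 * T⁻¹ := by gcongr
      _ ≤ (5 * T + 4 * C * T) / 4 * T⁻¹ := by
          refine mul_le_mul_of_nonneg_right ?_ (by positivity)
          nlinarith
      _ = _ := by field_simp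
  have hfin : ∫ τ in T..N, lebedevKernel x y τ = (∫ τ in T..N, E τ) + 1 / 4 *
      ((∫ τ in T..N, (besselPhase L' τ / τ).im) -
      1 / 2 * (∫ τ in T..N, (besselPhase L τ * besselPhase L' τ / τ).im) -
      1 / 2 * ∫ τ in T..N, Real.sin (2 * (L' - L) * τ) / τ) := by
    rw [hEeq]; ring
  rw [hfin]
  rw [abs_le] at t1 t2 t3 hEb ⊢
  constructor <;> linarith [t1.1, t1.2, t2.1, t2.2, t3.1, t3.2, hEb.1, hEb.2]

/-- The truncated kernels are dominated by a fixed weight, uniformly in the truncation. -/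
lemma exists_abs_integral_lebedevKernel_le {x : ℝ} (hx : 0 < x) : ∃ C, 0 ≤ C ∧ ∀ y N : ℝ, 0 < y → 1 ≤ N →
    |∫ τ in (0 : ℝ)..N, lebedevKernel x y τ| ≤ C * (y ^ (-(1 : ℝ) / 2) + y ^ ((1 : ℝ) / 2)) := by
  obtain ⟨C₁, h1, H1⟩ := exists_abs_integral_lebedevKernel_mid_le hx
  obtain ⟨C₂, h2, H2⟩ := exists_abs_integral_lebedevKernel_tail_le hx
  set K := besselIKBound with hK
  have hK0 : 0 ≤ K := besselIKBound_nonneg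
  set X := x ^ (-(1 : ℝ) / 2) with hX
  have hX0 : 0 < X := by positivity
  refine ⟨K * X * K + C₁ + C₂, by positivity, fun y N hy hN => ?_⟩
  set W := y ^ (-(1 : ℝ) / 2) + y ^ ((1 : ℝ) / 2) with hW
  have hW1 : 1 ≤ W := one_le_rpow_add_rpow hy
  have hc := continuous_lebedevKernel hx hy
  have hi : ∀ a b, IntervalIntegrable (lebedevKernel x y) volume a b := fun a b => hc.intervalIntegrable a b
  have hhead : |∫ τ in (0 : ℝ)..1, lebedevKernel x y τ| ≤ K * X * K * W := by
    have h := intervalIntegral.norm_integral_le_of_norm_le_const (a := (0 : ℝ)) (b := 1) (C := K * X * K * W)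
      (f := lebedevKernel x y) fun τ hτ => by
        rw [uIoc_of_le zero_le_one] at hτ
        refine (abs_lebedevKernel_le hx hy hτ.1.le).trans ?_
        have hYW : y ^ (-(1 : ℝ) / 2) ≤ W := by
          have : 0 < y ^ ((1 : ℝ) / 2) := by positivity
          linarith
        calc τ * (K * X) * (K * y ^ (-(1 : ℝ) / 2)) ≤ 1 * (K * X) * (K * W) := by
              have := hτ.2
              gcongr
          _ = _ := by ring
    simpa using h
  set T := min N (max 1 (y ^ 2)) with hT
  have hT1 : 1 ≤ T := le_min hN (le_max_left _ _)
  have hmid : |∫ τ in (1 : ℝ)..T, lebedevKernel x y τ| ≤ C₁ * W := H1 y T hy hT1 (min_le_right _ _)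
  have htail : |∫ τ in T..N, lebedevKernel x y τ| ≤ C₂ * W := by
    rcases le_total N (max 1 (y ^ 2)) with h | h
    · rw [hT, min_eq_left h, intervalIntegral.integral_same, abs_zero]
      positivity
    · refine (H2 y T N hy hT1 ?_ (min_le_left _ _)).trans (by nlinarith)
      rw [hT, min_eq_right h]
      exact le_max_right _ _
  rw [← intervalIntegral.integral_add_adjacent_intervals (hi 0 1) (hi 1 N),
    ← intervalIntegral.integral_add_adjacent_intervals (hi 1 T) (hi T N)]
  have := abs_add_le (∫ τ in (0 : ℝ)..1, lebedevKernel x y τ)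
    ((∫ τ in (1 : ℝ)..T, lebedevKernel x y τ) + ∫ τ in T..N, lebedevKernel x y τ)
  have := abs_add_le (∫ τ in (1 : ℝ)..T, lebedevKernel x y τ) (∫ τ in T..N, lebedevKernel x y τ)
  linarith

lemma integrable_of_even_of_integrableOn_Ioi {h : ℝ → ℝ} (he : ∀ t, h (-t) = h t)
    (hi : IntegrableOn h (Ioi 0)) : Integrable h := by
  have hn : IntegrableOn h (Iic 0) := by
    rw [← Measure.map_neg_eq_self (volume : Measure ℝ)]
    have m : MeasurableEmbedding fun x : ℝ => -x := (Homeomorph.neg ℝ).measurableEmbedding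
    rw [m.integrableOn_map_iff]
    simp_rw [Function.comp_def, he, neg_preimage, neg_Iic, neg_zero]
    exact Iff.mpr integrableOn_Ici_iff_integrableOn_Ioi hi
  have := hn.union hi
  rwa [Iic_union_Ioi, integrableOn_univ] at this

lemma integral_exp_smul_of_even {h : ℝ → ℝ} (he : ∀ t, h (-t) = h t) (hi : Integrable h) (c : ℝ) :
    ∫ v : ℝ, Complex.exp ((c * v : ℝ) * Complex.I) • (h v : ℂ) =
      ((2 * ∫ v in Ioi (0 : ℝ), h v * Real.cos (c * v) : ℝ) : ℂ) := by
  have i1 : Integrable fun v => h v * Real.cos (c * v) :=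
    hi.mul_bdd (c := 1) (by fun_prop) (ae_of_all _ fun v => Real.abs_cos_le_one _)
  have i2 : Integrable fun v => h v * Real.sin (c * v) :=
    hi.mul_bdd (c := 1) (by fun_prop) (ae_of_all _ fun v => Real.abs_sin_le_one _)
  have e1 : ∫ v, h v * Real.cos (c * v) = 2 * ∫ v in Ioi (0 : ℝ), h v * Real.cos (c * v) := by
    rw [← integral_comp_abs (f := fun v => h v * Real.cos (c * v))]
    refine integral_congr_ae (ae_of_all _ fun v => ?_)
    rcases abs_cases v with ⟨h1, -⟩ | ⟨h1, -⟩ <;> simp only [h1, he, mul_neg, Real.cos_neg]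
  have e2 : ∫ v, h v * Real.sin (c * v) = 0 := by
    have := integral_neg_eq_self (fun v => h v * Real.sin (c * v)) volume
    simp only [he, mul_neg, Real.sin_neg, integral_neg] at this
    linarith
  have e3 : ∀ v : ℝ, Complex.exp ((c * v : ℝ) * Complex.I) • (h v : ℂ) =
      ((h v * Real.cos (c * v) : ℝ) : ℂ) + ((h v * Real.sin (c * v) : ℝ) : ℂ) * Complex.I := by
    intro v
    rw [Complex.exp_mul_I, smul_eq_mul]
    push_cast
    ring
  simp_rw [e3]
  have j1 : Integrable fun v => ((h v * Real.cos (c * v) : ℝ) : ℂ) := i1.ofReal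
  have j2 : Integrable fun v => ((h v * Real.sin (c * v) : ℝ) : ℂ) := i2.ofReal
  rw [integral_add j1 (j2.mul_const _), integral_mul_const,
    integral_complex_ofReal, integral_complex_ofReal, e1, e2]
  simp

/-- Inversion of the Fourier cosine transform. -/
lemma integral_cosTransform_mul_cos {h g : ℝ → ℝ} (he : ∀ t, h (-t) = h t) (hc : Continuous h)
    (hi : Integrable h) (hg : ∀ τ, g τ = ∫ t in Ioi (0 : ℝ), h t * Real.cos (τ * t))
    (hgi : Integrable g) (u : ℝ) :
    ∫ τ in Ioi (0 : ℝ), g τ * Real.cos (u * τ) = Real.pi / 2 * h u := by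
  have hge : ∀ τ, g (-τ) = g τ := fun τ => by simp only [hg, neg_mul, Real.cos_neg]
  have hF : FourierTransform.fourier (fun t => (h t : ℂ)) =
      fun w : ℝ => ((2 * g (2 * Real.pi * w) : ℝ) : ℂ) := by
    ext w
    rw [Real.fourier_eq']
    have := integral_exp_smul_of_even he hi (-(2 * Real.pi * w))
    simp only [neg_mul, Real.cos_neg] at this
    rw [hg, ← this]
    refine integral_congr_ae (ae_of_all _ fun v => ?_)
    simp only [RCLike.inner_apply, conj_trivial]
    congr 4
    ring
  have hgi' : Integrable fun w : ℝ => 2 * g (2 * Real.pi * w) :=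
    (hgi.comp_mul_left' (by positivity)).const_mul 2
  have hinv := Continuous.fourierInv_fourier_eq (f := fun t => (h t : ℂ)) (by fun_prop)
    (hi.ofReal (𝕜 := ℂ)) (by rw [hF]; exact hgi'.ofReal (𝕜 := ℂ))
  have hu := congr_fun hinv u
  rw [hF, Real.fourierInv_eq'] at hu
  have := integral_exp_smul_of_even (h := fun w => 2 * g (2 * Real.pi * w))
    (fun t => by simp only [mul_neg, hge]) hgi' (2 * Real.pi * u)
  have e : ∀ v : ℝ, Complex.exp (((2 * Real.pi * u * v : ℝ) : ℂ) * Complex.I) =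
      Complex.exp (((2 * Real.pi * inner ℝ v u : ℝ) : ℂ) * Complex.I) := fun v => by
    simp only [RCLike.inner_apply, conj_trivial]
    congr 3
    ring
  simp_rw [e] at this
  rw [this] at hu
  have hu' := Complex.ofReal_injective hu
  have hs := integral_comp_mul_left_Ioi (fun τ => 2 * g τ * Real.cos (u * τ)) 0
    (by positivity : 0 < 2 * Real.pi)
  have e' : ∀ v : ℝ, 2 * g (2 * Real.pi * v) * Real.cos (2 * Real.pi * u * v) =
      2 * g (2 * Real.pi * v) * Real.cos (u * (2 * Real.pi * v)) := fun v => by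
    congr 2
    ring
  simp_rw [e'] at hu'
  rw [hs, mul_zero] at hu'
  simp only [mul_assoc, integral_const_mul, smul_eq_mul] at hu'
  rw [← hu']
  field_simp

lemma continuous_exp_neg_mul_cosh (b : ℝ) : Continuous fun t => Real.exp (-b * Real.cosh t) := by
  have := Real.continuous_cosh
  fun_prop

lemma integrable_exp_neg_mul_cosh {b : ℝ} (hb : 0 < b) : Integrable fun t => Real.exp (-b * Real.cosh t) := by
  refine (integrable_exp_neg_mul_sq (half_pos hb)).mono' (continuous_exp_neg_mul_cosh b).aestronglyMeasurable
    (ae_of_all _ fun t => ?_)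
  rw [Real.norm_eq_abs, Real.abs_exp, Real.exp_le_exp]
  nlinarith [one_add_sq_div_two_le_cosh t]

lemma besselKi_neg (τ b : ℝ) : besselKi (-τ) b = besselKi τ b := by
  simp only [besselKi, neg_mul, Real.cos_neg]

lemma continuous_besselKi_left {b : ℝ} (hb : 0 < b) : Continuous fun τ => besselKi τ b := by
  have hc := continuous_exp_neg_mul_cosh b
  unfold besselKi
  refine continuous_of_dominated (bound := fun t => Real.exp (-b * Real.cosh t))
    (fun τ => by fun_prop) (fun τ => ae_of_all _ fun t => ?_)
    (integrable_exp_neg_mul_cosh hb).integrableOn (ae_of_all _ fun t => by fun_prop)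
  rw [norm_mul, Real.norm_eq_abs, Real.abs_exp]
  exact mul_le_of_le_one_right (Real.exp_pos _).le (Real.abs_cos_le_one _)

lemma abs_besselKi_le {b : ℝ} (hb : 0 < b) (τ : ℝ) :
    |besselKi τ b| ≤ ∫ t in Ioi (0 : ℝ), Real.exp (-b * Real.cosh t) := by
  rw [besselKi, ← Real.norm_eq_abs]
  refine norm_integral_le_of_norm_le (integrable_exp_neg_mul_cosh hb).integrableOn
    (ae_of_all _ fun t => ?_)
  rw [norm_mul, Real.norm_eq_abs, Real.abs_exp]
  exact mul_le_of_le_one_right (Real.exp_pos _).le (Real.abs_cos_le_one _)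

/-- Exponential decay of `besselKi` in the order. -/
lemma exists_abs_besselKi_le {b : ℝ} (hb : 0 < b) :
    ∃ M, 0 ≤ M ∧ ∀ τ, 0 ≤ τ → |besselKi τ b| ≤ M * Real.exp (-τ) := by
  set K₀ := ∫ t in Ioi (0 : ℝ), Real.exp (-b * Real.cosh t)
  set K₁ := 2 * (Real.pi * (besselIKBound * b ^ (-(1 : ℝ) / 2))) + K₀ ^ 2 with hK₁
  have hK0 : 0 ≤ K₀ := (abs_nonneg _).trans (abs_besselKi_le hb 0)
  refine ⟨Real.sqrt K₁, Real.sqrt_nonneg _, fun τ hτ => ?_⟩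
  have h1 := sinh_mul_besselKi_sq τ hb
  have h2 := abs_le.1 ((Complex.abs_im_le_norm _).trans (norm_besselIK_le τ hb))
  have h3 : besselKi τ b ^ 2 ≤ K₀ ^ 2 := by
    rw [← sq_abs]
    exact pow_le_pow_left₀ (abs_nonneg _) (abs_besselKi_le hb τ) 2
  have h4 : Real.exp (2 * τ) ≤ 2 * Real.sinh (Real.pi * τ) + 1 := by
    have e1 : Real.exp (2 * τ) ≤ Real.exp (Real.pi * τ) :=
      Real.exp_le_exp.2 (mul_le_mul_of_nonneg_right Real.two_le_pi hτ)
    have e2 : Real.exp (-(Real.pi * τ)) ≤ 1 := Real.exp_le_one_iff.2 (by have := Real.pi_pos; nlinarith)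
    rw [Real.sinh_eq]
    linarith
  have h5 : besselKi τ b ^ 2 * Real.exp (2 * τ) ≤ K₁ := by
    have := mul_le_mul_of_nonneg_left h4 (sq_nonneg (besselKi τ b))
    have := mul_le_mul_of_nonneg_left h2.1 Real.pi_pos.le
    rw [hK₁]
    linarith
  have h6 : |besselKi τ b| * Real.exp τ ≤ Real.sqrt K₁ := by
    refine Real.le_sqrt_of_sq_le ?_
    rwa [mul_pow, sq_abs, ← Real.exp_nat_mul, Nat.cast_ofNat]
  rw [Real.exp_neg, ← div_eq_mul_inv, le_div_iff₀ (Real.exp_pos _)]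
  exact h6

lemma integrableOn_mul_besselKi {b : ℝ} (hb : 0 < b) : IntegrableOn (fun τ => τ * besselKi τ b) (Ioi 0) := by
  obtain ⟨M, -, hM⟩ := exists_abs_besselKi_le hb
  have hi : IntegrableOn (fun τ : ℝ => M * (τ ^ (1 : ℝ) * Real.exp (-1 * τ ^ (1 : ℝ)))) (Ioi 0) :=
    (integrableOn_rpow_mul_exp_neg_mul_rpow (by norm_num) one_pos one_pos).const_mul M
  refine hi.mono' (continuous_id.mul (continuous_besselKi_left hb)).aestronglyMeasurable
    ((ae_restrict_iff' measurableSet_Ioi).2 (ae_of_all _ fun τ (hτ : 0 < τ) => ?_))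
  rw [norm_mul, Real.norm_eq_abs, Real.norm_eq_abs, abs_of_pos hτ, Real.rpow_one, neg_one_mul]
  have := mul_le_mul_of_nonneg_left (hM τ hτ.le) hτ.le
  linarith

lemma integrable_besselKi {b : ℝ} (hb : 0 < b) : Integrable fun τ => besselKi τ b := by
  obtain ⟨M, -, hM⟩ := exists_abs_besselKi_le hb
  refine integrable_of_even_of_integrableOn_Ioi (fun τ => besselKi_neg τ b) ?_
  have hi : IntegrableOn (fun τ : ℝ => M * Real.exp (-1 * τ)) (Ioi 0) :=
    (integrableOn_exp_mul_Ioi (by norm_num) 0).const_mul M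
  refine hi.mono' (continuous_besselKi_left hb).aestronglyMeasurable
    ((ae_restrict_iff' measurableSet_Ioi).2 (ae_of_all _ fun τ (hτ : 0 < τ) => ?_))
  rw [neg_one_mul]
  exact hM τ hτ.le

lemma integral_besselKi_mul_cos {b : ℝ} (hb : 0 < b) (u : ℝ) :
    ∫ τ in Ioi (0 : ℝ), besselKi τ b * Real.cos (u * τ) = Real.pi / 2 * Real.exp (-b * Real.cosh u) :=
  integral_cosTransform_mul_cos (h := fun t => Real.exp (-b * Real.cosh t)) (fun t => by simp)
    (continuous_exp_neg_mul_cosh b) (integrable_exp_neg_mul_cosh hb) (fun _ => rfl) (integrable_besselKi hb) u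

lemma integral_mul_besselKi_mul_sin {b : ℝ} (hb : 0 < b) (u : ℝ) :
    ∫ τ in Ioi (0 : ℝ), τ * besselKi τ b * Real.sin (u * τ) =
      Real.pi / 2 * (b * Real.sinh u * Real.exp (-b * Real.cosh u)) := by
  have hK := continuous_besselKi_left hb
  have h1 := hasDerivAt_integral_of_dominated_loc_of_deriv_le (𝕜 := ℝ) (μ := volume.restrict (Ioi (0 : ℝ)))
    (F := fun u τ => besselKi τ b * Real.cos (u * τ))
    (F' := fun u τ => -(τ * besselKi τ b * Real.sin (u * τ)))
    (bound := fun τ => |τ * besselKi τ b|) (x₀ := u) (s := univ) univ_mem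
    (Eventually.of_forall fun v => (by fun_prop : Continuous _).aestronglyMeasurable)
    ((integrable_besselKi hb).integrableOn.mul_bdd (c := 1) (by fun_prop)
      (ae_of_all _ fun v => Real.abs_cos_le_one _))
    (by fun_prop)
    (ae_of_all _ fun τ v _ => by
      rw [norm_neg, norm_mul]
      exact mul_le_of_le_one_right (norm_nonneg _) (Real.abs_sin_le_one _))
    (integrableOn_mul_besselKi hb).abs
    (ae_of_all _ fun τ v _ => by
      have := (((hasDerivAt_id v).mul_const τ).cos).const_mul (besselKi τ b)
      simp only [id, one_mul] at this
      exact this.congr_deriv (by ring))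
  have h2 : HasDerivAt (fun u => Real.pi / 2 * Real.exp (-b * Real.cosh u))
      (Real.pi / 2 * (Real.exp (-b * Real.cosh u) * (-b * Real.sinh u))) u :=
    (((Real.hasDerivAt_cosh u).const_mul (-b)).exp).const_mul _
  have h3 := h1.2
  simp only [integral_besselKi_mul_cos hb] at h3
  have h4 := h3.unique h2
  rw [integral_neg] at h4
  linarith

lemma integral_mul_reducedJ_sq_mul_exp {w t : ℝ} (hw : 0 ≤ w) (ht : 0 < t) :
    ∫ y in Ioi (0 : ℝ), y * Real.exp (-(t * y ^ 2)) * reducedJ (y ^ 2 * w) = Real.exp (-w / t) / (2 * t) := by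
  have h := integral_Ioi_zero_eq_integral_deriv_smul (φ := fun y => y ^ 2) (φ' := fun y => 2 * y)
    (by fun_prop) (by simp) (fun u _ => by simpa using hasDerivAt_pow 2 u) (fun u hu => by linarith)
    (tendsto_pow_atTop two_ne_zero) (fun v => reducedJ (w * v) * Real.exp (-(t * v)))
  rw [integral_reducedJ_mul_exp hw ht] at h
  have e : ∀ u : ℝ, (2 * u) • (reducedJ (w * u ^ 2) * Real.exp (-(t * u ^ 2))) =
      2 * (u * Real.exp (-(t * u ^ 2)) * reducedJ (u ^ 2 * w)) := fun u => by
    rw [mul_comm w, smul_eq_mul]; ring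
  simp only [e, integral_const_mul] at h
  rw [mul_comm 2 t, ← div_div, h]
  ring

lemma integral_sinh_cosh_mul_reducedJ {w t : ℝ} (hw : 0 ≤ w) (ht : 0 < t) :
    ∫ s in Ioi (0 : ℝ), 2 * Real.sinh s * Real.cosh s *
      (reducedJ (w * Real.sinh s ^ 2) * Real.exp (-(t * Real.sinh s ^ 2))) = Real.exp (-w / t) / t := by
  have h := integral_Ioi_zero_eq_integral_deriv_smul (φ := fun s => Real.sinh s ^ 2)
    (φ' := fun s => 2 * Real.sinh s * Real.cosh s)
    (Real.continuous_sinh.pow 2) (by simp)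
    (fun u _ => by simpa [Pi.pow_def] using (Real.hasDerivAt_sinh u).pow 2)
    (fun u hu => by have := Real.sinh_pos_iff.2 hu; have := Real.cosh_pos u; positivity)
    (tendsto_atTop_mono sq_le_sinh_sq (tendsto_pow_atTop two_ne_zero))
    (fun v => reducedJ (w * v) * Real.exp (-(t * v)))
  rw [integral_reducedJ_mul_exp hw ht] at h
  simpa using h.symm

lemma besselKi_eq_integral_sinh_sq (τ b : ℝ) : 2 * ∫ s in Ioi (0 : ℝ),
    Real.cos (2 * τ * s) * Real.exp (-(2 * b * Real.sinh s ^ 2)) = Real.exp b * besselKi τ b := by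
  have h := integral_comp_mul_left_Ioi (fun t => Real.exp (-b * Real.cosh t) * Real.cos (τ * t)) 0 two_pos
  rw [mul_zero] at h
  have e : ∀ s : ℝ, Real.exp (-b * Real.cosh (2 * s)) * Real.cos (τ * (2 * s)) =
      Real.exp (-b) * (Real.cos (2 * τ * s) * Real.exp (-(2 * b * Real.sinh s ^ 2))) := fun s => by
    rw [mul_left_comm (Real.exp (-b)), ← Real.exp_add, Real.cosh_two_mul, Real.cosh_sq, mul_comm]
    congr 2 <;> ring
  simp only [e, integral_const_mul, smul_eq_mul] at h
  rw [besselKi, ← mul_inv_cancel_left₀ (Real.exp_ne_zero b) (∫ s in Ioi (0 : ℝ), Real.cos _ * _),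
    ← Real.exp_neg, h]
  ring

/-- The index transform of `y exp (-y² / (2 b))`. -/
lemma integral_gaussian_mul_re_besselIK (τ : ℝ) {b : ℝ} (hb : 0 < b) :
    ∫ y in Ioi (0 : ℝ), y * Real.exp (-((2 * b)⁻¹ * y ^ 2)) * (2 * (besselIK τ y).re) =
      b * Real.exp b * besselKi τ b := by
  have ht : 0 < (2 * b)⁻¹ := by positivity
  set G : ℝ → ℝ := fun y => y * Real.exp (-((2 * b)⁻¹ * y ^ 2)) with hG
  have hGi : IntegrableOn (fun y : ℝ => G y * (2 * y ^ (-(1 : ℝ) / 2))) (Ioi 0) := by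
    refine IntegrableOn.congr_fun
      ((integrableOn_rpow_mul_exp_neg_mul_sq ht (s := 1 / 2) (by norm_num)).const_mul 2)
      (fun y (hy : 0 < y) => ?_) measurableSet_Ioi
    have : y ^ ((1 : ℝ) / 2) = y * y ^ (-(1 : ℝ) / 2) := by
      conv_rhs => rw [← Real.rpow_one_add' hy.le (by norm_num)]
      norm_num
    simp only [hG, this, neg_mul]
    ring
  have hint : Integrable (Function.uncurry fun y s => G y *
      (reducedJ (y ^ 2 * Real.sinh s ^ 2) * Real.cos (2 * τ * s)))
      ((volume.restrict (Ioi (0 : ℝ))).prod (volume.restrict (Ioi (0 : ℝ)))) := by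
    have hc : Continuous (Function.uncurry fun y s =>
        G y * (reducedJ (y ^ 2 * Real.sinh s ^ 2) * Real.cos (2 * τ * s))) := by
      have h1 : Continuous fun p : ℝ × ℝ => reducedJ (p.1 ^ 2 * Real.sinh p.2 ^ 2) :=
        continuous_reducedJ.comp' ((continuous_fst.pow 2).mul
            ((Real.continuous_sinh.comp' continuous_snd).pow 2))
      simp only [hG, Function.uncurry_def]
      fun_prop
    refine (hGi.mul_prod integrableOn_besselJBound).mono' hc.aestronglyMeasurable ?_
    rw [Measure.prod_restrict]
    refine (ae_restrict_iff' (measurableSet_Ioi.prod measurableSet_Ioi)).2 (ae_of_all _ fun p hp => ?_)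
    have hp1 : 0 < p.1 := hp.1
    have hG0 : 0 ≤ G p.1 := by simp only [hG]; positivity
    rw [Function.uncurry, norm_mul (G p.1), Real.norm_of_nonneg hG0, norm_mul (reducedJ _), mul_assoc (G p.1)]
    refine mul_le_mul_of_nonneg_left ?_ hG0
    exact (mul_le_of_le_one_right (norm_nonneg _) (Real.abs_cos_le_one _)).trans
      (abs_reducedJ_sinh_le hp1 hp.2)
  have e1 : ∫ y in Ioi (0 : ℝ), G y * (2 * (besselIK τ y).re) =
      2 * ∫ y in Ioi (0 : ℝ), ∫ s in Ioi (0 : ℝ), G y *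
          (reducedJ (y ^ 2 * Real.sinh s ^ 2) * Real.cos (2 * τ * s)) := by
    rw [← integral_const_mul]
    refine setIntegral_congr_fun measurableSet_Ioi fun y hy => ?_
    rw [re_besselIK_eq_integral τ hy, integral_const_mul]
    ring
  rw [e1, integral_integral_swap hint, mul_assoc b, ← besselKi_eq_integral_sinh_sq, mul_left_comm]
  congr 1
  rw [← integral_const_mul]
  refine setIntegral_congr_fun measurableSet_Ioi fun s _ => ?_
  have e2 := integral_mul_reducedJ_sq_mul_exp (sq_nonneg (Real.sinh s)) ht
  simp only [← mul_assoc, integral_mul_const]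
  rw [e2, div_inv_eq_mul]
  rw [show -Real.sinh s ^ 2 * (2 * b) = -(2 * b * Real.sinh s ^ 2) by ring]
  field_simp

/-- The expansion theorem for `y exp (-y² / (2 b))`. -/
lemma integral_lebedev_gaussian {x b : ℝ} (hx : 0 < x) (hb : 0 < b) :
    ∫ τ in Ioi (0 : ℝ), τ * besselKi τ b * (besselIK τ x).im =
      -(Real.pi / 4 * (Real.exp (-b) * Real.exp (-((2 * b)⁻¹ * x ^ 2)))) := by
  have hint : Integrable (Function.uncurry fun τ s =>
      τ * besselKi τ b * (reducedJ (x ^ 2 * Real.sinh s ^ 2) * Real.sin (2 * τ * s)))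
      ((volume.restrict (Ioi (0 : ℝ))).prod (volume.restrict (Ioi (0 : ℝ)))) := by
    have hc : Continuous (Function.uncurry fun τ s =>
        τ * besselKi τ b * (reducedJ (x ^ 2 * Real.sinh s ^ 2) * Real.sin (2 * τ * s))) := by
      have h1 : Continuous fun p : ℝ × ℝ => reducedJ (x ^ 2 * Real.sinh p.2 ^ 2) :=
        continuous_reducedJ.comp' (continuous_const.mul ((Real.continuous_sinh.comp' continuous_snd).pow 2))
      have h2 : Continuous fun p : ℝ × ℝ => besselKi p.1 b := (continuous_besselKi_left hb).comp'
          continuous_fst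
      simp only [Function.uncurry_def]
      fun_prop
    refine ((integrableOn_mul_besselKi hb).norm.mul_prod
      (integrableOn_besselJBound.const_mul (2 * x ^ (-(1 : ℝ) / 2)))).mono' hc.aestronglyMeasurable ?_
    rw [Measure.prod_restrict]
    refine (ae_restrict_iff' (measurableSet_Ioi.prod measurableSet_Ioi)).2 (ae_of_all _ fun p hp => ?_)
    rw [Function.uncurry, norm_mul]
    refine mul_le_mul_of_nonneg_left ?_ (norm_nonneg _)
    rw [norm_mul]
    exact (mul_le_of_le_one_right (norm_nonneg _) (Real.abs_sin_le_one _)).trans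
      (abs_reducedJ_sinh_le hx hp.2)
  have e1 : ∫ τ in Ioi (0 : ℝ), τ * besselKi τ b * (besselIK τ x).im = -∫ τ in Ioi (0 : ℝ),
      ∫ s in Ioi (0 : ℝ), τ * besselKi τ b * (reducedJ (x ^ 2 * Real.sinh s ^ 2) * Real.sin (2 * τ * s)) := by
    rw [← integral_neg]
    refine setIntegral_congr_fun measurableSet_Ioi fun τ _ => ?_
    rw [im_besselIK_eq_integral τ hx, integral_const_mul]
    ring
  rw [e1, integral_integral_swap hint]
  congr 1
  have e2 := integral_sinh_cosh_mul_reducedJ (sq_nonneg x) (by positivity : 0 < 2 * b)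
  have e3 : ∀ s : ℝ, ∫ τ in Ioi (0 : ℝ), τ * besselKi τ b *
      (reducedJ (x ^ 2 * Real.sinh s ^ 2) * Real.sin (2 * τ * s)) =
      Real.pi / 2 * b * Real.exp (-b) * (2 * Real.sinh s * Real.cosh s *
      (reducedJ (x ^ 2 * Real.sinh s ^ 2) * Real.exp (-(2 * b * Real.sinh s ^ 2)))) := by
    intro s
    have h1 := integral_mul_besselKi_mul_sin hb (2 * s)
    have h2 : Real.exp (-b * Real.cosh (2 * s)) = Real.exp (-b) * Real.exp (-(2 * b * Real.sinh s ^ 2)) := by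
      rw [← Real.exp_add, Real.cosh_two_mul, Real.cosh_sq]
      congr 1
      ring
    rw [h2, Real.sinh_two_mul] at h1
    have h3 : ∀ τ : ℝ, τ * besselKi τ b * (reducedJ (x ^ 2 * Real.sinh s ^ 2) * Real.sin (2 * τ * s)) =
        reducedJ (x ^ 2 * Real.sinh s ^ 2) * (τ * besselKi τ b * Real.sin (2 * s * τ)) := fun τ => by
      rw [mul_right_comm 2 τ s]; ring
    simp only [h3, integral_const_mul, h1]
    ring
  simp only [e3, integral_const_mul, e2]
  rw [show -x ^ 2 / (2 * b) = -((2 * b)⁻¹ * x ^ 2) by field_simp]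
  field_simp
  ring

/-- Polynomials are dense in `L¹` of a finite measure on the unit interval. -/
lemma exists_polynomial_integral_abs_sub_le {ν : Measure ℝ} [IsFiniteMeasure ν]
    (hν : ∀ᵐ z ∂ν, z ∈ Icc (0 : ℝ) 1) {h : ℝ → ℝ} (hh : Integrable h ν) {ε : ℝ} (hε : 0 < ε) :
    ∃ P : Polynomial ℝ, ∫ z, |h z - P.eval z| ∂ν ≤ ε := by
  obtain ⟨g, hg, hgi⟩ := hh.exists_boundedContinuous_integral_sub_le (half_pos hε)
  set m := ν.real univ with hm
  have hm0 : 0 ≤ m := measureReal_nonneg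
  obtain ⟨P, hP⟩ := exists_polynomial_near_of_continuousOn 0 1 g g.continuous.continuousOn
    (ε / (2 * (m + 1))) (by positivity)
  have hb : ∀ᵐ z ∂ν, ‖P.eval z - g z‖ ≤ ε / (2 * (m + 1)) := by
    filter_upwards [hν] with z hz
    exact (hP z hz).le
  have hi : Integrable (fun z => P.eval z - g z) ν :=
    Integrable.of_bound (by have := P.continuous; fun_prop) _ hb
  refine ⟨P, ?_⟩
  calc ∫ z, |h z - P.eval z| ∂ν ≤ ∫ z, (‖h z - g z‖ + ‖P.eval z - g z‖) ∂ν := by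
        refine integral_mono_of_nonneg (ae_of_all _ fun z => abs_nonneg _)
          ((hh.sub hgi).norm.add hi.norm) (ae_of_all _ fun z => ?_)
        have := abs_sub (h z - g z) (P.eval z - g z)
        simpa using this
    _ = (∫ z, ‖h z - g z‖ ∂ν) + ∫ z, ‖P.eval z - g z‖ ∂ν := integral_add (hh.sub hgi).norm hi.norm
    _ ≤ ε / 2 + ε / (2 * (m + 1)) * m := by
        gcongr
        have := integral_mono_ae hi.norm (integrable_const (ε / (2 * (m + 1)))) hb
        rwa [integral_const, smul_eq_mul, mul_comm] at this
    _ ≤ ε := by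
        have : ε / (2 * (m + 1)) * m ≤ ε / 2 := by
          rw [div_mul_eq_mul_div, div_le_div_iff₀ (by positivity) two_pos]
          nlinarith
        linarith

/-- The weight of the space on which the expansion holds. -/
noncomputable def lebedevWeight (y : ℝ) : ℝ := y ^ (-(1 : ℝ) / 2) + y ^ ((1 : ℝ) / 2)

lemma measurable_lebedevWeight : Measurable lebedevWeight := by
  unfold lebedevWeight
  fun_prop

lemma lebedevWeight_pos {y : ℝ} (hy : 0 < y) : 0 < lebedevWeight y := by
  unfold lebedevWeight
  positivity

lemma one_le_lebedevWeight {y : ℝ} (hy : 0 < y) : 1 ≤ lebedevWeight y := one_le_rpow_add_rpow hy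

/-- A Gaussian times a polynomial in `exp (-y²)`. -/
noncomputable def gaussianPoly (P : Polynomial ℝ) (y : ℝ) : ℝ :=
  y * Real.exp (-y ^ 2) * P.eval (Real.exp (-y ^ 2))

lemma continuous_gaussianPoly (P : Polynomial ℝ) : Continuous (gaussianPoly P) := by
  have h : Continuous fun y : ℝ => P.eval (Real.exp (-y ^ 2)) := P.continuous.comp' (by fun_prop)
  unfold gaussianPoly
  fun_prop

lemma integrableOn_mul_exp_mul_lebedevWeight :
    IntegrableOn (fun y => y * Real.exp (-y ^ 2) * lebedevWeight y) (Ioi 0) := by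
  have h1 := integrableOn_rpow_mul_exp_neg_mul_sq one_pos (s := 1 / 2) (by norm_num)
  have h2 := integrableOn_rpow_mul_exp_neg_mul_sq one_pos (s := 3 / 2) (by norm_num)
  refine IntegrableOn.congr_fun (h1.add h2) (fun y (hy : 0 < y) => ?_) measurableSet_Ioi
  have e1 : y ^ ((1 : ℝ) / 2) = y * y ^ (-(1 : ℝ) / 2) := by
    conv_rhs => rw [← Real.rpow_one_add' hy.le (by norm_num)]
    norm_num
  have e2 : y ^ ((3 : ℝ) / 2) = y * y ^ ((1 : ℝ) / 2) := by
    conv_rhs => rw [← Real.rpow_one_add' hy.le (by norm_num)]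
    norm_num
  simp only [Pi.add_apply, neg_mul, one_mul, lebedevWeight]
  rw [e2, mul_add]
  nth_rewrite 1 [e1]
  ring

lemma integrableOn_gaussianPoly_mul_lebedevWeight (P : Polynomial ℝ) :
    IntegrableOn (fun y => gaussianPoly P y * lebedevWeight y) (Ioi 0) := by
  obtain ⟨M, hM⟩ := isCompact_Icc.exists_bound_of_continuousOn (s := Icc (0 : ℝ) 1) P.continuous.continuousOn
  have hm : Measurable fun y : ℝ => P.eval (Real.exp (-y ^ 2)) :=
    (P.continuous.comp' (by fun_prop : Continuous fun y : ℝ => Real.exp (-y ^ 2))).measurable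
  refine IntegrableOn.congr_fun (Integrable.mul_bdd (c := M) integrableOn_mul_exp_mul_lebedevWeight
    hm.aestronglyMeasurable (ae_of_all _ fun y => hM _
        ⟨(Real.exp_pos _).le, Real.exp_le_one_iff.2 (by nlinarith [sq_nonneg y])⟩))
    (fun y _ => ?_) measurableSet_Ioi
  simp only [gaussianPoly]
  ring

/-- Density of Gaussians in the weighted space. -/
lemma exists_integral_abs_sub_gaussianPoly_le {f : ℝ → ℝ} (hf : Measurable f)
    (hfi : IntegrableOn (fun y => f y * lebedevWeight y) (Ioi 0)) {ε : ℝ} (hε : 0 < ε) :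
    ∃ P, ∫ y in Ioi (0 : ℝ), |f y - gaussianPoly P y| * lebedevWeight y ≤ ε := by
  set ρ : ℝ → ℝ := fun y => y * Real.exp (-y ^ 2) * lebedevWeight y with hρ
  have hρm : Measurable ρ := by
    have := measurable_lebedevWeight
    fun_prop
  have hρ0 : ∀ y, 0 < y → 0 < ρ y := fun y hy => by
    have := lebedevWeight_pos hy
    simp only [hρ]
    positivity
  set μ := (volume.restrict (Ioi (0 : ℝ))).withDensity fun y => ENNReal.ofReal (ρ y) with hμ
  have : IsFiniteMeasure μ := isFiniteMeasure_withDensity_ofReal integrableOn_mul_exp_mul_lebedevWeight.2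
  have hρm' : Measurable fun y => ENNReal.ofReal (ρ y) := hρm.ennreal_ofReal
  have hρt : ∀ᵐ y ∂(volume.restrict (Ioi (0 : ℝ))), ENNReal.ofReal (ρ y) < ⊤ :=
    ae_of_all _ fun y => ENNReal.ofReal_lt_top
  have hE : Measurable fun y : ℝ => Real.exp (-y ^ 2) := by fun_prop
  set k : ℝ → ℝ := fun y => f y / (y * Real.exp (-y ^ 2)) with hk
  set h : ℝ → ℝ := fun z => k (Real.sqrt (-Real.log z)) with hh
  have hkm : Measurable k := by fun_prop
  have hhm : Measurable h := by fun_prop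
  have hhk : ∀ y, 0 < y → h (Real.exp (-y ^ 2)) = k y := fun y hy => by
    simp only [hh]
    rw [Real.log_exp, neg_neg, Real.sqrt_sq hy.le]
  have hhi : Integrable h (μ.map fun y => Real.exp (-y ^ 2)) := by
    rw [integrable_map_measure hhm.aestronglyMeasurable hE.aemeasurable,
      integrable_withDensity_iff_integrable_smul' hρm' hρt]
    refine IntegrableOn.congr_fun hfi (fun y (hy : 0 < y) => ?_) measurableSet_Ioi
    rw [ENNReal.toReal_ofReal (hρ0 y hy).le, Function.comp_apply, hhk y hy, smul_eq_mul]
    simp only [hρ, hk]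
    have := Real.exp_ne_zero (-y ^ 2)
    field_simp
  have hmem : ∀ᵐ z ∂(μ.map fun y => Real.exp (-y ^ 2)), z ∈ Icc (0 : ℝ) 1 :=
    (ae_map_iff hE.aemeasurable measurableSet_Icc).2 (ae_of_all _ fun y =>
      ⟨(Real.exp_pos _).le, Real.exp_le_one_iff.2 (by nlinarith [sq_nonneg y])⟩)
  obtain ⟨P, hP⟩ := exists_polynomial_integral_abs_sub_le hmem hhi hε
  refine ⟨P, le_of_eq_of_le ?_ hP⟩
  have hm : Measurable fun z => |h z - P.eval z| := (hhm.sub P.continuous.measurable).norm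
  rw [integral_map hE.aemeasurable hm.aestronglyMeasurable,
    integral_withDensity_eq_integral_toReal_smul hρm' hρt]
  refine setIntegral_congr_fun measurableSet_Ioi fun y (hy : 0 < y) => ?_
  rw [ENNReal.toReal_ofReal (hρ0 y hy).le, hhk y hy, smul_eq_mul]
  have hpos : 0 < y * Real.exp (-y ^ 2) := by positivity
  have e : f y - gaussianPoly P y = y * Real.exp (-y ^ 2) * (k y - P.eval (Real.exp (-y ^ 2))) := by
    simp only [hk, gaussianPoly]
    field_simp
  rw [e, abs_mul, abs_of_pos hpos]
  simp only [hρ]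
  ring

lemma rpow_neg_half_le_lebedevWeight {y : ℝ} (hy : 0 < y) : y ^ (-(1 : ℝ) / 2) ≤ lebedevWeight y :=
  le_add_of_nonneg_right (by positivity)

lemma integrable_mul_lebedevKernel {f : ℝ → ℝ} (hf : Measurable f)
    (hfi : IntegrableOn (fun y => f y * lebedevWeight y) (Ioi 0)) {x N : ℝ} (hx : 0 < x) (hN : 0 ≤ N) :
    Integrable (Function.uncurry fun τ y => f y * lebedevKernel x y τ)
      ((volume.restrict (uIoc 0 N)).prod (volume.restrict (Ioi (0 : ℝ)))) := by
  obtain ⟨F, hF, hFe⟩ := exists_measurable_eq_besselIK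
  have hx' := (Complex.continuous_im.comp' (continuous_besselIK_left hx)).measurable
  have hm : Measurable fun p : ℝ × ℝ => f p.2 * (p.1 * (besselIK p.1 x).im * (F p).re) := by
    have h1 : Measurable fun p : ℝ × ℝ => (besselIK p.1 x).im := hx'.comp measurable_fst
    have h2 : Measurable fun p : ℝ × ℝ => f p.2 := hf.comp measurable_snd
    have h3 : Measurable fun p : ℝ × ℝ => (F p).re := Complex.measurable_re.comp hF
    fun_prop
  have hd : Integrable (fun τ : ℝ => |τ|) (volume.restrict (uIoc 0 N)) :=
    (continuous_abs.intervalIntegrable 0 N).def'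
  set K := besselIKBound * x ^ (-(1 : ℝ) / 2) * besselIKBound with hK
  have hb := besselIKBound_nonneg
  refine (hd.mul_prod (hfi.norm.const_mul K)).mono' ?_ ?_
  all_goals rw [Measure.prod_restrict]
  · refine hm.aestronglyMeasurable.congr ((ae_restrict_iff' (measurableSet_uIoc.prod measurableSet_Ioi)).2
      (ae_of_all _ fun p hp => ?_))
    simp only [Function.uncurry, lebedevKernel, ← hFe p.1 p.2 hp.2]
  · refine (ae_restrict_iff' (measurableSet_uIoc.prod measurableSet_Ioi)).2 (ae_of_all _ fun p hp => ?_)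
    obtain ⟨h1, hy : 0 < p.2⟩ := hp
    rw [uIoc_of_le hN] at h1
    have h2 := abs_lebedevKernel_le hx hy h1.1.le
    rw [Function.uncurry, norm_mul, norm_mul, Real.norm_of_nonneg (lebedevWeight_pos hy).le, abs_of_pos h1.1]
    calc ‖f p.2‖ * ‖lebedevKernel x p.2 p.1‖ ≤ ‖f p.2‖ *
          (p.1 * (besselIKBound * x ^ (-(1 : ℝ) / 2)) * (besselIKBound * p.2 ^ (-(1 : ℝ) / 2))) := by
          gcongr
          exact h2
      _ = p.1 * (K * (‖f p.2‖ * p.2 ^ (-(1 : ℝ) / 2))) := by rw [hK]; ring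
      _ ≤ p.1 * (K * (‖f p.2‖ * lebedevWeight p.2)) := by
          have := h1.1.le
          gcongr
          exact rpow_neg_half_le_lebedevWeight hy

/-- The truncated expansion of `f`. -/
noncomputable def lebedevTrunc (x N : ℝ) (f : ℝ → ℝ) : ℝ :=
  ∫ y in Ioi (0 : ℝ), f y * ∫ τ in (0 : ℝ)..N, lebedevKernel x y τ

lemma integrableOn_mul_integral_lebedevKernel {f : ℝ → ℝ} (hf : Measurable f)
    (hfi : IntegrableOn (fun y => f y * lebedevWeight y) (Ioi 0)) {x N : ℝ} (hx : 0 < x) (hN : 0 ≤ N) :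
    IntegrableOn (fun y => f y * ∫ τ in (0 : ℝ)..N, lebedevKernel x y τ) (Ioi 0) := by
  have h := (integrable_mul_lebedevKernel hf hfi hx hN).integral_prod_right
  simpa only [IntegrableOn, Function.uncurry, uIoc_of_le hN, ← intervalIntegral.integral_of_le hN,
    intervalIntegral.integral_const_mul] using h

lemma integral_mul_integral_eq_lebedevTrunc {f : ℝ → ℝ} (hf : Measurable f)
    (hfi : IntegrableOn (fun y => f y * lebedevWeight y) (Ioi 0)) {x N : ℝ} (hx : 0 < x) (hN : 0 ≤ N) :
    ∫ τ in (0 : ℝ)..N, τ * Real.sinh (Real.pi * τ) * besselKi τ x ^ 2 *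
      ∫ y in Ioi (0 : ℝ), f y * (2 * (besselIK τ y).re) = -(2 * Real.pi) * lebedevTrunc x N f := by
  have h := intervalIntegral_integral_swap (integrable_mul_lebedevKernel hf hfi hx hN)
  simp only [intervalIntegral.integral_const_mul] at h
  rw [lebedevTrunc, ← h, ← intervalIntegral.integral_const_mul]
  refine intervalIntegral.integral_congr fun τ _ => ?_
  rw [mul_assoc τ, sinh_mul_besselKi_sq τ hx, ← integral_const_mul, ← integral_const_mul]
  refine integral_congr_ae (ae_of_all _ fun y => ?_)
  simp only [lebedevKernel]
  ring

lemma exists_abs_lebedevTrunc_le {x : ℝ} (hx : 0 < x) : ∃ C, 0 ≤ C ∧ ∀ (f : ℝ → ℝ) (N : ℝ), 1 ≤ N →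
    IntegrableOn (fun y => f y * lebedevWeight y) (Ioi 0) →
    |lebedevTrunc x N f| ≤ C * ∫ y in Ioi (0 : ℝ), |f y| * lebedevWeight y := by
  obtain ⟨C, hC0, hC⟩ := exists_abs_integral_lebedevKernel_le hx
  refine ⟨C, hC0, fun f N hN hfi => ?_⟩
  have hi : IntegrableOn (fun y => |f y| * lebedevWeight y) (Ioi 0) := by
    refine IntegrableOn.congr_fun hfi.norm (fun y (hy : 0 < y) => ?_) measurableSet_Ioi
    rw [norm_mul, Real.norm_of_nonneg (lebedevWeight_pos hy).le, Real.norm_eq_abs]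
  rw [lebedevTrunc, ← Real.norm_eq_abs, ← integral_const_mul]
  refine norm_integral_le_of_norm_le (hi.const_mul C)
    ((ae_restrict_iff' measurableSet_Ioi).2 (ae_of_all _ fun y hy => ?_))
  rw [norm_mul, Real.norm_eq_abs, mul_left_comm]
  exact mul_le_mul_of_nonneg_left (hC y N hy hN) (abs_nonneg _)

lemma integral_Ioi_gaussian (x : ℝ) {b : ℝ} (hb : 0 < b) :
    ∫ y in Ioi x, y * Real.exp (-((2 * b)⁻¹ * y ^ 2)) = b * Real.exp (-((2 * b)⁻¹ * x ^ 2)) := by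
  have ht : 0 < (2 * b)⁻¹ := by positivity
  have hd : ∀ y ∈ Ici x, HasDerivAt (fun y => -(b * Real.exp (-((2 * b)⁻¹ * y ^ 2))))
      (y * Real.exp (-((2 * b)⁻¹ * y ^ 2))) y := fun y _ => by
    have := ((((hasDerivAt_pow 2 y).const_mul (2 * b)⁻¹).neg.exp).const_mul b).neg
    refine this.congr_deriv ?_
    simp only [Nat.cast_ofNat, Nat.add_one_sub_one, pow_one, Pi.neg_apply]
    field_simp
  have hi : IntegrableOn (fun y => y * Real.exp (-((2 * b)⁻¹ * y ^ 2))) (Ioi x) := by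
    have := (integrable_mul_exp_neg_mul_sq ht).integrableOn (s := Ioi x)
    simpa only [neg_mul] using this
  have hl : Tendsto (fun y => -(b * Real.exp (-((2 * b)⁻¹ * y ^ 2)))) atTop (nhds (-(b * 0))) := by
    refine ((Real.tendsto_exp_neg_atTop_nhds_zero.comp
      ((tendsto_pow_atTop two_ne_zero).const_mul_atTop ht)).const_mul b).neg
  rw [integral_Ioi_of_hasDerivAt_of_tendsto' hd hi hl]
  ring

lemma tendsto_lebedevTrunc_gaussianPoly_monomial {x : ℝ} (hx : 0 < x) (k : ℕ) (a : ℝ) :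
    Tendsto (fun N => lebedevTrunc x N (gaussianPoly (Polynomial.monomial k a))) atTop
      (nhds (-(Real.pi / 8) * ∫ y in Ioi x, gaussianPoly (Polynomial.monomial k a) y)) := by
  set b : ℝ := (2 * ((k : ℝ) + 1))⁻¹ with hb
  have hb0 : 0 < b := by positivity
  have hbk : (2 * b)⁻¹ = (k : ℝ) + 1 := by
    rw [hb]
    field_simp
  set G : ℝ → ℝ := fun y => y * Real.exp (-((2 * b)⁻¹ * y ^ 2)) with hG
  have hP : gaussianPoly (Polynomial.monomial k a) = fun y => a * G y := by
    ext y
    simp only [gaussianPoly, hG, Polynomial.eval_monomial, hbk]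
    rw [← Real.exp_nat_mul, mul_left_comm, mul_assoc, ← Real.exp_add]
    congr 3
    ring
  have hfi := integrableOn_gaussianPoly_mul_lebedevWeight (Polynomial.monomial k a)
  have hm := (continuous_gaussianPoly (Polynomial.monomial k a)).measurable
  have hint : IntegrableOn (fun τ => τ * besselKi τ b * (besselIK τ x).im) (Ioi 0) :=
    (integrableOn_mul_besselKi hb0).mul_bdd (c := besselIKBound * x ^ (-(1 : ℝ) / 2))
      (Complex.continuous_im.comp' (continuous_besselIK_left hx)).aestronglyMeasurable
      (ae_of_all _ fun τ => (Complex.abs_im_le_norm _).trans (norm_besselIK_le τ hx))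
  have hlim := (intervalIntegral_tendsto_integral_Ioi 0 hint tendsto_id).const_mul (a * b * Real.exp b / 2)
  rw [integral_lebedev_gaussian hx hb0] at hlim
  have hval : a * b * Real.exp b / 2 * -(Real.pi / 4 * (Real.exp (-b) * Real.exp (-((2 * b)⁻¹ * x ^ 2)))) =
      -(Real.pi / 8) * ∫ y in Ioi x, gaussianPoly (Polynomial.monomial k a) y := by
    simp only [hP, integral_const_mul]
    rw [integral_Ioi_gaussian x hb0, Real.exp_neg b]
    field_simp
    ring
  rw [hval] at hlim
  refine hlim.congr' ?_
  filter_upwards [eventually_ge_atTop 0] with N hN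
  have h := integral_mul_integral_eq_lebedevTrunc hm hfi hx hN
  have e : ∀ τ : ℝ, τ * Real.sinh (Real.pi * τ) * besselKi τ x ^ 2 *
      ∫ y in Ioi (0 : ℝ), gaussianPoly (Polynomial.monomial k a) y * (2 * (besselIK τ y).re) =
      -(2 * Real.pi) * (a * b * Real.exp b / 2 * (τ * besselKi τ b * (besselIK τ x).im)) := by
    intro τ
    have h1 := integral_gaussian_mul_re_besselIK τ hb0
    simp only [hP, mul_assoc a, integral_const_mul]
    rw [h1, mul_assoc τ, sinh_mul_besselKi_sq τ hx]
    ring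
  simp only [e, intervalIntegral.integral_const_mul] at h
  exact mul_left_cancel₀ (neg_ne_zero.2 (by positivity)) h

lemma integrableOn_Ioi_of_mul_lebedevWeight {f : ℝ → ℝ} (hf : Measurable f)
    (hfi : IntegrableOn (fun y => f y * lebedevWeight y) (Ioi 0)) : IntegrableOn f (Ioi 0) := by
  refine hfi.norm.mono' hf.aestronglyMeasurable
    ((ae_restrict_iff' measurableSet_Ioi).2 (ae_of_all _ fun y (hy : 0 < y) => ?_))
  rw [norm_mul, Real.norm_of_nonneg (lebedevWeight_pos hy).le]
  exact le_mul_of_one_le_right (norm_nonneg _) (one_le_lebedevWeight hy)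

lemma tendsto_lebedevTrunc_gaussianPoly {x : ℝ} (hx : 0 < x) (P : Polynomial ℝ) :
    Tendsto (fun N => lebedevTrunc x N (gaussianPoly P)) atTop
      (nhds (-(Real.pi / 8) * ∫ y in Ioi x, gaussianPoly P y)) := by
  induction P using Polynomial.induction_on' with
  | monomial k a => exact tendsto_lebedevTrunc_gaussianPoly_monomial hx k a
  | add P Q hP hQ =>
    have e : ∀ y, gaussianPoly (P + Q) y = gaussianPoly P y + gaussianPoly Q y := fun y => by
      simp only [gaussianPoly, Polynomial.eval_add]
      ring
    have hw := fun R => integrableOn_gaussianPoly_mul_lebedevWeight R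
    have hm := fun R => (continuous_gaussianPoly R).measurable
    have hi := fun R => (integrableOn_Ioi_of_mul_lebedevWeight (hm R) (hw R)).mono_set (Ioi_subset_Ioi hx.le)
    have hsum := hP.add hQ
    simp only [e, integral_add (hi P) (hi Q), mul_add]
    refine hsum.congr' ?_
    filter_upwards [eventually_ge_atTop 0] with N hN
    simp only [lebedevTrunc, e, add_mul]
    exact (integral_add (integrableOn_mul_integral_lebedevKernel (hm P) (hw P) hx hN)
      (integrableOn_mul_integral_lebedevKernel (hm Q) (hw Q) hx hN)).symm

lemma tendsto_lebedevTrunc {f : ℝ → ℝ} (hf : Measurable f)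
    (hfi : IntegrableOn (fun y => f y * lebedevWeight y) (Ioi 0)) {x : ℝ} (hx : 0 < x) :
    Tendsto (fun N => lebedevTrunc x N f) atTop (nhds (-(Real.pi / 8) * ∫ y in Ioi x, f y)) := by
  obtain ⟨C, hC0, hC⟩ := exists_abs_lebedevTrunc_le hx
  rw [Metric.tendsto_atTop]
  intro ε hε
  set δ := ε / (2 * (C + 1)) with hδ
  have hδ0 : 0 < δ := by positivity
  obtain ⟨P, hP⟩ := exists_integral_abs_sub_gaussianPoly_le hf hfi hδ0
  obtain ⟨N₀, hN₀⟩ := Metric.tendsto_atTop.1 (tendsto_lebedevTrunc_gaussianPoly hx P) (ε / 2) (half_pos hε)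
  set g := gaussianPoly P with hg
  have hgw : IntegrableOn (fun y => g y * lebedevWeight y) (Ioi 0) :=
      integrableOn_gaussianPoly_mul_lebedevWeight P
  have hgm : Measurable g := (continuous_gaussianPoly P).measurable
  have hdw : IntegrableOn (fun y => (f y - g y) * lebedevWeight y) (Ioi 0) := by
    simp only [sub_mul]
    exact hfi.sub hgw
  have hdi := integrableOn_Ioi_of_mul_lebedevWeight (hf.sub hgm) hdw
  have hfx := (integrableOn_Ioi_of_mul_lebedevWeight hf hfi).mono_set (Ioi_subset_Ioi hx.le)
  have hgx := (integrableOn_Ioi_of_mul_lebedevWeight hgm hgw).mono_set (Ioi_subset_Ioi hx.le)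
  have hdn : IntegrableOn (fun y => |f y - g y| * lebedevWeight y) (Ioi 0) := by
    refine IntegrableOn.congr_fun hdw.norm (fun y (hy : 0 < y) => ?_) measurableSet_Ioi
    rw [norm_mul, Real.norm_of_nonneg (lebedevWeight_pos hy).le, Real.norm_eq_abs]
  have htail : |(∫ y in Ioi x, f y) - ∫ y in Ioi x, g y| ≤ δ := by
    rw [← integral_sub hfx hgx, ← Real.norm_eq_abs]
    refine (norm_integral_le_integral_norm _).trans (le_trans ?_ hP)
    refine le_trans (setIntegral_mono_set hdi.norm (ae_of_all _ fun y => norm_nonneg _)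
      (Ioi_subset_Ioi hx.le).eventuallyLE) ?_
    refine setIntegral_mono_on hdi.norm hdn measurableSet_Ioi fun y hy => ?_
    exact le_mul_of_one_le_right (norm_nonneg _) (one_le_lebedevWeight hy)
  refine ⟨max 1 N₀, fun N hN => ?_⟩
  have hN1 : 1 ≤ N := (le_max_left _ _).trans hN
  have h1 := hN₀ N ((le_max_right _ _).trans hN)
  have h2 : |lebedevTrunc x N f - lebedevTrunc x N g| ≤ C * δ := by
    have h3 := hC (fun y => f y - g y) N hN1 hdw
    have h4 : lebedevTrunc x N (fun y => f y - g y) = lebedevTrunc x N f - lebedevTrunc x N g := by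
      have hN0 : 0 ≤ N := zero_le_one.trans hN1
      simp only [lebedevTrunc, sub_mul]
      exact integral_sub (integrableOn_mul_integral_lebedevKernel hf hfi hx hN0)
        (integrableOn_mul_integral_lebedevKernel hgm hgw hx hN0)
    rw [h4] at h3
    exact h3.trans (mul_le_mul_of_nonneg_left hP hC0)
  have h5 : Real.pi / 8 * |(∫ y in Ioi x, f y) - ∫ y in Ioi x, g y| ≤ 1 / 2 * δ := by
    have := Real.pi_le_four
    exact mul_le_mul (by linarith) htail (abs_nonneg _) (by norm_num)
  have h6 : (C + 1) * δ = ε / 2 := by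
    rw [hδ]
    field_simp
  have h7 : |Real.pi / 8 * ((∫ y in Ioi x, g y) - ∫ y in Ioi x, f y)| ≤ 1 / 2 * δ := by
    rw [abs_mul, abs_sub_comm, abs_of_pos (by positivity : 0 < Real.pi / 8)]
    exact h5
  rw [Real.dist_eq] at h1 ⊢
  rw [abs_lt] at h1 ⊢
  rw [abs_le] at h2 h7
  constructor <;> nlinarith [h1.1, h1.2, h2.1, h2.2, h7.1, h7.2]

lemma integrableOn_mul_lebedevWeight {f : ℝ → ℝ} (hf : Measurable f)
    (h1 : IntegrableOn (fun y => |f y| * y ^ (-(1 : ℝ) / 2)) (Ioc 0 1))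
    (h2 : IntegrableOn (fun y => |f y| * y ^ ((1 : ℝ) / 2)) (Ioi 1)) :
    IntegrableOn (fun y => f y * lebedevWeight y) (Ioi 0) := by
  have hm : Measurable fun y => f y * lebedevWeight y := hf.mul measurable_lebedevWeight
  rw [← Ioc_union_Ioi_eq_Ioi zero_le_one]
  refine IntegrableOn.union ?_ ?_
  · refine (h1.const_mul 2).mono' hm.aestronglyMeasurable
      ((ae_restrict_iff' measurableSet_Ioc).2 (ae_of_all _ fun y hy => ?_))
    have h3 : y ^ ((1 : ℝ) / 2) ≤ y ^ (-(1 : ℝ) / 2) :=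
      Real.rpow_le_rpow_of_exponent_ge hy.1 hy.2 (by norm_num)
    rw [norm_mul, Real.norm_of_nonneg (lebedevWeight_pos hy.1).le, mul_left_comm, Real.norm_eq_abs]
    refine mul_le_mul_of_nonneg_left ?_ (abs_nonneg _)
    rw [lebedevWeight]
    linarith
  · refine (h2.const_mul 2).mono' hm.aestronglyMeasurable
      ((ae_restrict_iff' measurableSet_Ioi).2 (ae_of_all _ fun y (hy : 1 < y) => ?_))
    have h3 : y ^ (-(1 : ℝ) / 2) ≤ y ^ ((1 : ℝ) / 2) :=
      Real.rpow_le_rpow_of_exponent_le hy.le (by norm_num)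
    rw [norm_mul, Real.norm_of_nonneg (lebedevWeight_pos (by linarith)).le, mul_left_comm, Real.norm_eq_abs]
    refine mul_le_mul_of_nonneg_left ?_ (abs_nonneg _)
    rw [lebedevWeight]
    linarith

lemma integrableOn_mul_re_besselIK {f : ℝ → ℝ} (hf : Measurable f)
    (hfi : IntegrableOn (fun y => f y * lebedevWeight y) (Ioi 0)) (τ : ℝ) :
    IntegrableOn (fun y => f y * (2 * (besselIK τ y).re)) (Ioi 0) := by
  obtain ⟨F, hF, hFe⟩ := exists_measurable_eq_besselIK
  have hm : Measurable fun y => f y * (2 * (F (τ, y)).re) := by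
    have : Measurable fun y => (F (τ, y)).re := Complex.measurable_re.comp (hF.comp measurable_prodMk_left)
    fun_prop
  refine (hfi.norm.const_mul (2 * besselIKBound)).mono' (hm.aestronglyMeasurable.congr ?_) ?_
  · refine (ae_restrict_iff' measurableSet_Ioi).2 (ae_of_all _ fun y hy => ?_)
    simp only [hFe τ y hy]
  · refine (ae_restrict_iff' measurableSet_Ioi).2 (ae_of_all _ fun y (hy : 0 < y) => ?_)
    have h1 := (Complex.abs_re_le_norm _).trans (norm_besselIK_le τ hy)
    have hb := besselIKBound_nonneg
    rw [norm_mul, norm_mul, norm_mul, Real.norm_of_nonneg (lebedevWeight_pos hy).le,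
      Real.norm_of_nonneg zero_le_two]
    calc ‖f y‖ * (2 * ‖(besselIK τ y).re‖) ≤ ‖f y‖ * (2 * (besselIKBound * lebedevWeight y)) := by
          gcongr
          exact h1.trans (mul_le_mul_of_nonneg_left (rpow_neg_half_le_lebedevWeight hy) hb)
      _ = _ := by ring

/-- Theorem 1 (Lebedev expansion theorem). -/
theorem lebedev_expansion (f : ℝ → ℝ) (hf : Measurable f)
    (h1 : MeasureTheory.IntegrableOn (fun y => |f y| * y ^ (-(1:ℝ)/2)) (Set.Ioc 0 1))
    (h2 : MeasureTheory.IntegrableOn (fun y => |f y| * y ^ ((1:ℝ)/2)) (Set.Ioi 1)) :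
    ∀ x : ℝ, 0 < x →
      (∀ τ : ℝ, MeasureTheory.IntegrableOn (fun y =>
          f y * ((besselI (Complex.I*(τ:ℂ)) (y:ℂ) + besselI (-(Complex.I*(τ:ℂ))) (y:ℂ)).re
            * besselKi τ y)) (Set.Ioi 0)) ∧
      Tendsto (fun N => (4/Real.pi^2) * ∫ τ in (0:ℝ)..N,
          τ * Real.sinh (Real.pi*τ) * (besselKi τ x)^2 *
            ∫ y in Set.Ioi (0:ℝ),
              f y * ((besselI (Complex.I*(τ:ℂ)) (y:ℂ) + besselI (-(Complex.I*(τ:ℂ))) (y:ℂ)).re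
                * besselKi τ y))
        atTop (nhds (∫ y in Set.Ioi x, f y)) := by
  intro x hx
  have hfi := integrableOn_mul_lebedevWeight hf h1 h2
  have e : ∀ τ : ℝ, EqOn (fun y => f y * (2 * (besselIK τ y).re)) (fun y =>
      f y * ((besselI (Complex.I * τ) y + besselI (-(Complex.I * τ)) y).re * besselKi τ y)) (Ioi 0) :=
    fun τ y hy => congrArg (f y * ·) (re_besselI_add_mul_besselKi τ hy).symm
  refine ⟨fun τ => (integrableOn_mul_re_besselIK hf hfi τ).congr_fun (e τ) measurableSet_Ioi, ?_⟩
  have h := (tendsto_lebedevTrunc hf hfi hx).const_mul (4 / Real.pi ^ 2 * -(2 * Real.pi))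
  have hval : 4 / Real.pi ^ 2 * -(2 * Real.pi) * (-(Real.pi / 8) * ∫ y in Ioi x, f y) =
      ∫ y in Ioi x, f y := by
    have := Real.pi_ne_zero
    field_simp
    ring
  rw [hval] at h
  refine h.congr' ?_
  filter_upwards [eventually_ge_atTop 0] with N hN
  simp only [← setIntegral_congr_fun measurableSet_Ioi (e _)]
  rw [integral_mul_integral_eq_lebedevTrunc hf hfi hx hN, mul_assoc]
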